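/- Let G be a connected cubic graph on n vertices. If G is not isomorphic to the Petersen graph, then the paired domination number of G satisfies γ_pr(G) ≤ 4n/7. -/

import Mathlib

open Finset

/-- `m` encodes a perfect matching of the induced subgraph `G[S]`:
every vertex of `S` is matched to a distinct adjacent vertex of `S`. -/
def IsMatchingOn {V : Type*} (G : SimpleGraph V) (S : Finset V) (m : V → V) : Prop :=
  ∀ u ∈ S, m u ∈ S ∧ m u ≠ u ∧ G.Adj u (m u) ∧ m (m u) = u

/-- `S` is a paired dominating set of `G`: a dominating set such that `G[S]`
has a perfect matching. -/
def IsPDS {V : Type*} (G : SimpleGraph V) (S : Finset V) : Prop :=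
  (∀ v : V, v ∉ S → ∃ u ∈ S, G.Adj v u) ∧ ∃ m : V → V, IsMatchingOn G S m

/-- The paired domination number of `G`. -/
noncomputable def gammaPr {V : Type*} (G : SimpleGraph V) : ℕ :=
  sInf {k : ℕ | ∃ S : Finset V, IsPDS G S ∧ S.card = k}

/-- `N_S(x)`, the set of neighbours of `x` inside `S`. -/
def nbrS {V : Type*} [DecidableEq V] (G : SimpleGraph V) [DecidableRel G.Adj]
    (S : Finset V) (x : V) : Finset V :=
  S.filter (fun u => G.Adj x u)

/-- `λ(S)`: (twice) the number of edges of `G[S]` (each edge counted in both directions). -/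
def lambdaS {V : Type*} [DecidableEq V] (G : SimpleGraph V) [DecidableRel G.Adj]
    (S : Finset V) : ℕ :=
  ((S ×ˢ S).filter (fun p => G.Adj p.1 p.2)).card

/-- The private neighbours of `u ∈ S`: vertices outside `S` whose unique
neighbour in `S` is `u`. -/
def privates {V : Type*} [Fintype V] [DecidableEq V] (G : SimpleGraph V) [DecidableRel G.Adj]
    (S : Finset V) (u : V) : Finset V :=
  Finset.univ.filter (fun x => x ∉ S ∧ nbrS G S x = {u})

/-- `A = {v ∈ S : v and v̄ together have at least two private neighbours}`. -/
def setA {V : Type*} [Fintype V] [DecidableEq V] (G : SimpleGraph V) [DecidableRel G.Adj]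
    (S : Finset V) (m : V → V) : Finset V :=
  S.filter (fun v => 2 ≤ (privates G S v).card + (privates G S (m v)).card)

/-- `B = {v ∈ S : v has a private neighbour and v̄ has none}`. -/
def setB {V : Type*} [Fintype V] [DecidableEq V] (G : SimpleGraph V) [DecidableRel G.Adj]
    (S : Finset V) (m : V → V) : Finset V :=
  S.filter (fun v => (privates G S v).Nonempty ∧ privates G S (m v) = ∅)

/-- `C = {v ∈ S : v̄ ∈ B}`. -/
def setC {V : Type*} [Fintype V] [DecidableEq V] (G : SimpleGraph V) [DecidableRel G.Adj]
    (S : Finset V) (m : V → V) : Finset V :=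
  S.filter (fun v => m v ∈ setB G S m)

/-- `D = {v ∈ S : neither v nor v̄ has a private neighbour}`. -/
def setD {V : Type*} [Fintype V] [DecidableEq V] (G : SimpleGraph V) [DecidableRel G.Adj]
    (S : Finset V) (m : V → V) : Finset V :=
  S.filter (fun v => privates G S v = ∅ ∧ privates G S (m v) = ∅)

/-- The weight `f(xu)` of an edge `xu` with `x ∈ V∖S` and `u ∈ S`
(`0` on non-edges and on pairs not of this form). -/
def fwt {V : Type*} [Fintype V] [DecidableEq V] (G : SimpleGraph V) [DecidableRel G.Adj]
    (S : Finset V) (m : V → V) (x u : V) : ℚ :=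
  if x ∈ S ∨ u ∉ S ∨ ¬ G.Adj x u then 0
  else if nbrS G S x = {u} then 1
  else if nbrS G S x ⊆ setA G S m ∨ nbrS G S x ⊆ setB G S m ∪ setC G S m ∨
      nbrS G S x ⊆ setD G S m then
    1 / ((nbrS G S x).card : ℚ)
  else if u ∈ setA G S m then 0
  else if nbrS G S x ∩ setD G S m = ∅ then
    1 / (((nbrS G S x ∩ (setB G S m ∪ setC G S m))).card : ℚ)
  else if u ∈ setB G S m ∪ setC G S m then 1 / 6
  else (1 - ((nbrS G S x ∩ (setB G S m ∪ setC G S m)).card : ℚ) / 6) /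
      ((nbrS G S x ∩ setD G S m).card : ℚ)

/-- `f(S')`: total weight of the edges between `S' ⊆ S` and `V∖S`. -/
def fsum {V : Type*} [Fintype V] [DecidableEq V] (G : SimpleGraph V) [DecidableRel G.Adj]
    (S : Finset V) (m : V → V) (T : Finset V) : ℚ :=
  ∑ u ∈ T, ∑ x ∈ Finset.univ \ S, fwt G S m x u

/-- `C` is (the vertex set of) a connected component of `G[S]`. -/
def IsComponent {V : Type*} [DecidableEq V] (G : SimpleGraph V) [DecidableRel G.Adj]
    (S C : Finset V) : Prop :=
  C ⊆ S ∧ C.Nonempty ∧ (G.induce (↑C : Set V)).Connected ∧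
    ∀ u ∈ C, ∀ v ∈ S, G.Adj u v → v ∈ C

/-- `S_u = {u, m u}` is a `D`-pair. -/
def IsDPair {V : Type*} [Fintype V] [DecidableEq V] (G : SimpleGraph V) [DecidableRel G.Adj]
    (S : Finset V) (m : V → V) (u : V) : Prop :=
  u ∈ setD G S m ∧ m u ∈ setD G S m

/-- `S_u = {u, m u}` is an `A`-pair. -/
def IsAPair {V : Type*} [Fintype V] [DecidableEq V] (G : SimpleGraph V) [DecidableRel G.Adj]
    (S : Finset V) (m : V → V) (u : V) : Prop :=
  u ∈ setA G S m ∧ m u ∈ setA G S m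

/-- `S_u = {u, m u}` is a `BC`-pair. -/
def IsBCPair {V : Type*} [Fintype V] [DecidableEq V] (G : SimpleGraph V) [DecidableRel G.Adj]
    (S : Finset V) (m : V → V) (u : V) : Prop :=
  (u ∈ setB G S m ∧ m u ∈ setC G S m) ∨ (u ∈ setC G S m ∧ m u ∈ setB G S m)

/-- `u` is a leaf of `G[S]`: it has exactly one neighbour in `S`. -/
def IsLeaf {V : Type*} [DecidableEq V] (G : SimpleGraph V) [DecidableRel G.Adj]
    (S : Finset V) (u : V) : Prop :=
  (nbrS G S u).card = 1

/-- `S_u` is a solo pair: both `u` and `m u` are leaves of `G[S]`. -/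
def IsSoloPair {V : Type*} [DecidableEq V] (G : SimpleGraph V) [DecidableRel G.Adj]
    (S : Finset V) (m : V → V) (u : V) : Prop :=
  IsLeaf G S u ∧ IsLeaf G S (m u)

/-- The component `C` of `G[S]` contains no linked `D`-pairs: no edge of `G[S]`
joins vertices of two distinct `D`-pairs. -/
def NoLinkedDPairs {V : Type*} [Fintype V] [DecidableEq V] (G : SimpleGraph V)
    [DecidableRel G.Adj] (S : Finset V) (m : V → V) (C : Finset V) : Prop :=
  ∀ u ∈ C, ∀ v ∈ C, u ∈ setD G S m → v ∈ setD G S m → v ≠ u → v ≠ m u → ¬ G.Adj u v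

/-- `{w₁, w₂}` is a constraint pair of the solo `D`-pair `S_u`. -/
def ConstraintPair {V : Type*} [Fintype V] [DecidableEq V] (G : SimpleGraph V)
    [DecidableRel G.Adj] (S : Finset V) (m : V → V) (u w₁ w₂ : V) : Prop :=
  ∃ x y : V, x ∉ S ∧ y ∉ S ∧ G.Adj u y ∧ G.Adj (m u) x ∧
    G.Adj x w₁ ∧ G.Adj y w₂ ∧ w₁ ∈ setD G S m ∧ w₂ ∈ setD G S m ∧
    w₁ ≠ w₂ ∧ m w₁ ≠ w₂

/-- The pairs `S_u` and `S_v` are adjacent: some vertex of one is adjacent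
to some vertex of the other. -/
def PairAdj {V : Type*} (G : SimpleGraph V) (m : V → V) (u v : V) : Prop :=
  G.Adj u v ∨ G.Adj u (m v) ∨ G.Adj (m u) v ∨ G.Adj (m u) (m v)

/-- The Petersen graph, as the Kneser graph on 2-element subsets of a
5-element set, two subsets being adjacent iff they are disjoint. -/
def petersenGraph : SimpleGraph {s : Finset (Fin 5) // s.card = 2} where
  Adj a b := Disjoint (a : Finset (Fin 5)) (b : Finset (Fin 5))
  symm := ⟨fun _ _ h => h.symm⟩
  loopless := by
    constructor
    intro a h
    rw [disjoint_self] at h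
    have h2 := a.2
    rw [h] at h2
    simp at h2

open Finset

set_option linter.unusedSectionVars false
set_option linter.unusedVariables false
set_option linter.unusedSimpArgs false
set_option linter.style.multiGoal false

namespace PDom

section
variable {V : Type*} [Fintype V] [DecidableEq V] {G : SimpleGraph V} [DecidableRel G.Adj]
  {S : Finset V} {m : V → V}

/-- degree into a set -/
def dg (G : SimpleGraph V) [DecidableRel G.Adj] (T : Finset V) (v : V) : ℕ :=
  (T.filter (fun u => G.Adj v u)).card

/-- twice the number of edges inside a set -/
def lam (G : SimpleGraph V) [DecidableRel G.Adj] (T : Finset V) : ℕ := ∑ v ∈ T, dg G T v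

/-- `q` is the attachment vertex of a pendant gadget -/
def PendZ (G : SimpleGraph V) (q : V) : Prop :=
  ∃ u u' y y' w w' r : V, [u, u', y, y', w, w', r, q].Nodup ∧
    G.Adj u u' ∧ G.Adj u y ∧ G.Adj u y' ∧ G.Adj u' y ∧ G.Adj u' y' ∧ G.Adj y w ∧ G.Adj y' w' ∧
    G.Adj w w' ∧ G.Adj r w ∧ G.Adj r w' ∧ G.Adj r q

open Classical in
/-- number of attachment vertices in a set -/
noncomputable def zc (G : SimpleGraph V) (T : Finset V) : ℕ := (T.filter (fun q => PendZ G q)).card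

/-- an optimal paired dominating set -/
structure Opt (G : SimpleGraph V) [DecidableRel G.Adj] (S : Finset V) (m : V → V) : Prop where
  cub : ∀ v, G.degree v = 3
  dom : ∀ v, v ∉ S → ∃ u ∈ S, G.Adj v u
  mat : IsMatchingOn G S m
  smin : ∀ T, IsPDS G T → S.card ≤ T.card
  lmin : ∀ T, IsPDS G T → T.card ≤ S.card → lam G S ≤ lam G T
  zmin : ∀ T, IsPDS G T → T.card ≤ S.card → lam G T ≤ lam G S → zc G S ≤ zc G T

theorem exists_opt (hc : ∀ v, G.degree v = 3) (T₀ : Finset V) (h₀ : IsPDS G T₀) :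
    ∃ S m, Opt G S m := by
  classical
  let F : Finset (Finset V) := univ.filter (fun T => IsPDS G T)
  have hF : F.Nonempty := ⟨T₀, by simp [F, h₀]⟩
  obtain ⟨S, hS, hmin⟩ := F.exists_min_image
    (fun T => (toLex (T.card, toLex (lam G T, zc G T)) : ℕ ×ₗ (ℕ ×ₗ ℕ))) hF
  have hS' : IsPDS G S := by simpa [F] using hS
  obtain ⟨hd, m, hm⟩ := hS'
  have key : ∀ T, IsPDS G T → S.card < T.card ∨ S.card = T.card ∧
      (lam G S < lam G T ∨ lam G S = lam G T ∧ zc G S ≤ zc G T) := by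
    intro T hT
    have := hmin T (by simp [F, hT])
    simpa [Prod.Lex.le_iff] using this
  refine ⟨S, m, hc, hd, hm, ?_, ?_, ?_⟩
  · intro T hT
    rcases key T hT with h | h <;> omega
  · intro T hT h1
    rcases key T hT with h | h <;> omega
  · intro T hT h1 h2
    rcases key T hT with h | h <;> omega

theorem dg_insert (T : Finset V) (a v : V) (ha : a ∉ T) :
    dg G (insert a T) v = dg G T v + if G.Adj v a then 1 else 0 := by
  unfold dg
  rw [Finset.filter_insert]
  split_ifs with h
  · rw [Finset.card_insert_of_notMem (by simp [ha])]
  · simp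

theorem lam_insert (T : Finset V) (a : V) (ha : a ∉ T) :
    lam G (insert a T) = lam G T + 2 * dg G T a := by
  unfold lam
  rw [Finset.sum_insert ha]
  have h1 : dg G (insert a T) a = dg G T a := by rw [dg_insert _ _ _ ha]; simp
  have h2 : ∑ v ∈ T, dg G (insert a T) v = ∑ v ∈ T, dg G T v + dg G T a := by
    rw [Finset.sum_congr rfl (fun v _ => dg_insert T a v ha), Finset.sum_add_distrib]
    congr 1
    unfold dg
    rw [Finset.card_filter]
    apply Finset.sum_congr rfl
    intro v _
    simp [G.adj_comm]
  rw [h1, h2]; ring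

theorem nb3 (hc : ∀ v, G.degree v = 3) (v : V) : ∃ a b c, a ≠ b ∧ a ≠ c ∧ b ≠ c ∧
    ∀ t, G.Adj v t ↔ t = a ∨ t = b ∨ t = c := by
  have h := hc v
  rw [← G.card_neighborFinset_eq_degree, Finset.card_eq_three] at h
  obtain ⟨a, b, c, h1, h2, h3, h4⟩ := h
  refine ⟨a, b, c, h1, h2, h3, fun t => ?_⟩
  rw [← G.mem_neighborFinset, h4]; simp

/-- given one neighbour, the others -/
theorem nb3' (hc : ∀ v, G.degree v = 3) {v a : V} (ha : G.Adj v a) : ∃ b c, a ≠ b ∧ a ≠ c ∧ b ≠ c ∧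
    ∀ t, G.Adj v t ↔ t = a ∨ t = b ∨ t = c := by
  obtain ⟨x, y, z, h1, h2, h3, h4⟩ := nb3 hc v
  rcases (h4 a).1 ha with rfl | rfl | rfl
  · exact ⟨y, z, h1, h2, h3, h4⟩
  · exact ⟨x, z, h1.symm, h3, h2, fun t => by rw [h4]; tauto⟩
  · exact ⟨x, y, h2.symm, h3.symm, h1, fun t => by rw [h4]; tauto⟩

theorem nb3'' (hc : ∀ v, G.degree v = 3) {v a b : V} (ha : G.Adj v a) (hb : G.Adj v b) (hab : a ≠ b) :
    ∃ c, a ≠ c ∧ b ≠ c ∧ ∀ t, G.Adj v t ↔ t = a ∨ t = b ∨ t = c := by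
  obtain ⟨x, y, h1, h2, h3, h4⟩ := nb3' hc ha
  rcases (h4 b).1 hb with rfl | rfl | rfl
  · exact absurd rfl hab
  · exact ⟨y, h2, h3, h4⟩
  · exact ⟨x, h1, h3.symm, fun t => by rw [h4]; tauto⟩

theorem nb3''' (hc : ∀ v, G.degree v = 3) {v a b c : V} (ha : G.Adj v a) (hb : G.Adj v b)
    (hcc : G.Adj v c) (hab : a ≠ b) (hac : a ≠ c) (hbc : b ≠ c) :
    ∀ t, G.Adj v t ↔ t = a ∨ t = b ∨ t = c := by
  obtain ⟨x, h1, h2, h4⟩ := nb3'' hc ha hb hab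
  rcases (h4 c).1 hcc with rfl | rfl | rfl
  · exact absurd rfl hac
  · exact absurd rfl hbc
  · exact h4

theorem dg_eq {v a b c : V} (hab : a ≠ b) (hac : a ≠ c) (hbc : b ≠ c)
    (h : ∀ t, G.Adj v t ↔ t = a ∨ t = b ∨ t = c) (T : Finset V) :
    dg G T v = (if a ∈ T then 1 else 0) + (if b ∈ T then 1 else 0) + (if c ∈ T then 1 else 0) := by
  unfold dg
  have : T.filter (fun u => G.Adj v u) = ({a, b, c} : Finset V).filter (fun u => u ∈ T) := by
    ext t; simp only [mem_filter, h, mem_insert, mem_singleton]; tauto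
  rw [this, Finset.card_filter, Finset.sum_insert (by simp [hab, hac]), Finset.sum_insert (by simp [hbc]),
    Finset.sum_singleton]
  ring

namespace Opt
variable (h : Opt G S m)
include h

theorem mS {u : V} (hu : u ∈ S) : m u ∈ S := (h.mat u hu).1
theorem mne {u : V} (hu : u ∈ S) : m u ≠ u := (h.mat u hu).2.1
theorem madj {u : V} (hu : u ∈ S) : G.Adj u (m u) := (h.mat u hu).2.2.1
theorem mm {u : V} (hu : u ∈ S) : m (m u) = u := (h.mat u hu).2.2.2

/-- replacing `K` by `L` gives a PDS -/
theorem mkPDS (K L : Finset V) (f : V → V) (hK : ∀ k ∈ K, k ∈ S ∧ m k ∈ K)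
    (hL : IsMatchingOn G L f) (hd : ∀ l ∈ L, l ∈ S → l ∈ K)
    (hdom : ∀ z, z ∉ L → (∀ l ∈ L, ¬ G.Adj z l) → (∀ s ∈ S, G.Adj z s → s ∈ K) → (z ∈ S → z ∈ K) →
      False) : IsPDS G ((S \ K) ∪ L) := by
  classical
  refine ⟨?_, fun v => if v ∈ L then f v else m v, ?_⟩
  · intro v hv
    by_contra hcon
    push Not at hcon
    simp only [mem_union, mem_sdiff, not_or, not_and, not_not] at hv
    refine hdom v hv.2 (fun l hl => hcon l (by simp [hl])) (fun s hs hvs => ?_) hv.1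
    by_contra hsK
    exact hcon s (by simp [hs, hsK]) hvs
  · intro v hv
    by_cases hvL : v ∈ L
    · have := hL v hvL
      simp [hvL, this]
    · have hv' : v ∈ S ∧ v ∉ K := by simpa [hvL] using hv
      have h1 := h.mat v hv'.1
      have h2 : m v ∉ K := fun hk => hv'.2 (by have := (hK _ hk).2; rwa [h1.2.2.2] at this)
      have h3 : m v ∉ L := fun hl => h2 (hd _ hl h1.1)
      simp [hvL, h1, h2, h3]

theorem card_mk (K L : Finset V) (hK : K ⊆ S) (hd : ∀ l ∈ L, l ∈ S → l ∈ K) :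
    ((S \ K) ∪ L).card + K.card = S.card + L.card := by
  rw [Finset.card_union_of_disjoint, Finset.card_sdiff_of_subset hK]
  · have := Finset.card_le_card hK; omega
  · rw [Finset.disjoint_left]
    intro a ha hl
    simp at ha
    exact ha.2 (hd a hl ha.1)

theorem exch (K L : Finset V) (f : V → V) (hK : ∀ k ∈ K, k ∈ S ∧ m k ∈ K)
    (hL : IsMatchingOn G L f) (hd : ∀ l ∈ L, l ∈ S → l ∈ K) (hc : L.card < K.card) :
    ∃ z, z ∉ L ∧ (∀ l ∈ L, ¬ G.Adj z l) ∧ (∀ s ∈ S, G.Adj z s → s ∈ K) ∧ (z ∈ S → z ∈ K) := by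
  by_contra hcon
  push Not at hcon
  have h1 := h.mkPDS K L f hK hL hd (fun z a b c d => (hcon z a b c).2 ((hcon z a b c).1 |> d))
  have h2 := h.smin _ h1
  have h3 := h.card_mk K L (fun k hk => (hK k hk).1) hd
  omega

theorem lexch (K L : Finset V) (f : V → V) (hK : ∀ k ∈ K, k ∈ S ∧ m k ∈ K)
    (hL : IsMatchingOn G L f) (hd : ∀ l ∈ L, l ∈ S → l ∈ K) (hc : L.card ≤ K.card)
    (hdom : ∀ z, z ∉ L → (∀ l ∈ L, ¬ G.Adj z l) → (∀ s ∈ S, G.Adj z s → s ∈ K) → (z ∈ S → z ∈ K) →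
      False) : lam G S ≤ lam G ((S \ K) ∪ L) := by
  have h1 := h.mkPDS K L f hK hL hd hdom
  have h3 := h.card_mk K L (fun k hk => (hK k hk).1) hd
  exact h.lmin _ h1 (by omega)

end Opt
end
end PDom

open Finset
set_option linter.unusedSectionVars false
set_option linter.unusedVariables false
set_option linter.unusedSimpArgs false
namespace PDom
section
variable {V : Type*} [Fintype V] [DecidableEq V] {G : SimpleGraph V} [DecidableRel G.Adj]
  {S : Finset V} {m : V → V}

/-- the matching on a pair -/
def sw1 (a b : V) (v : V) : V := if v = a then b else a
/-- the matching on two pairs -/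
def sw2 (a b c d : V) (v : V) : V := if v = a then b else if v = b then a else if v = c then d else c
/-- the matching on three pairs -/
def sw3 (a b c d e f : V) (v : V) : V := if v = a then b else if v = b then a else
  if v = c then d else if v = d then c else if v = e then f else e

theorem swm1 {a b : V} (hab : G.Adj a b) : IsMatchingOn G {a, b} (sw1 a b) := by
  have := hab.ne
  have := hab.symm
  intro v hv
  simp only [mem_insert, mem_singleton] at hv
  rcases hv with rfl | rfl <;> simp [sw1, *] <;> grind

theorem swm2 {a b c d : V} (hab : G.Adj a b) (hcd : G.Adj c d) (h1 : a ≠ c) (h2 : a ≠ d) (h3 : b ≠ c)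
    (h4 : b ≠ d) : IsMatchingOn G {a, b, c, d} (sw2 a b c d) := by
  have := hab.ne
  have := hab.symm
  have := hcd.ne
  have := hcd.symm
  intro v hv
  simp only [mem_insert, mem_singleton] at hv
  rcases hv with rfl | rfl | rfl | rfl <;> simp [sw2, *] <;> grind

theorem swm3 {a b c d e f : V} (hab : G.Adj a b) (hcd : G.Adj c d) (hef : G.Adj e f)
    (hn : [a, b, c, d, e, f].Nodup) : IsMatchingOn G {a, b, c, d, e, f} (sw3 a b c d e f) := by
  have := hab.ne
  have := hab.symm
  have := hcd.ne
  have := hcd.symm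
  have := hef.ne
  have := hef.symm
  simp only [List.nodup_cons, List.mem_cons, List.not_mem_nil, or_false, not_or] at hn
  intro v hv
  simp only [mem_insert, mem_singleton] at hv
  rcases hv with rfl | rfl | rfl | rfl | rfl | rfl <;> simp [sw3, *] <;> grind

theorem card_four {a b c d : V} (hn : [a, b, c, d].Nodup) : ({a, b, c, d} : Finset V).card = 4 := by
  have := List.toFinset_card_of_nodup hn
  simpa using this
theorem card_six {a b c d e f : V} (hn : [a, b, c, d, e, f].Nodup) :
    ({a, b, c, d, e, f} : Finset V).card = 6 := by
  have := List.toFinset_card_of_nodup hn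
  simpa using this
theorem card_eight {a b c d e f g i : V} (hn : [a, b, c, d, e, f, g, i].Nodup) :
    ({a, b, c, d, e, f, g, i} : Finset V).card = 8 := by
  have := List.toFinset_card_of_nodup hn
  simpa using this

/-- private neighbour -/
def Pv (G : SimpleGraph V) (S : Finset V) (u x : V) : Prop :=
  x ∉ S ∧ G.Adj x u ∧ ∀ s ∈ S, G.Adj x s → s = u

/-- no private neighbour -/
def NP (G : SimpleGraph V) (S : Finset V) (u : V) : Prop :=
  ∀ x, x ∉ S → G.Adj x u → ∃ s ∈ S, G.Adj x s ∧ s ≠ u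

theorem not_NP {u : V} : ¬ NP G S u ↔ ∃ x, Pv G S u x := by
  unfold NP Pv
  push Not
  rfl

namespace Opt
variable (h : Opt G S m)
include h

theorem exch0 {p : V} (hp : p ∈ S) :
    ∃ z, (∀ s ∈ S, G.Adj z s → s = p ∨ s = m p) ∧ (z ∈ S → z = p ∨ z = m p) := by
  have h1 := h.mS hp
  have h2 := h.mm hp
  have h3 := h.mne hp
  obtain ⟨z, a, b, c, d⟩ := h.exch {p, m p} ∅ id (by simp [*]) (by intro u hu; simp at hu) (by simp)
    (by rw [Finset.card_pair h3.symm]; simp)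
  exact ⟨z, by simpa using c, by simpa using d⟩

theorem ex1 {p w a b : V} (hp : p ∈ S) (hw : w ∈ S) (hne : w ≠ p) (hne' : w ≠ m p)
    (hab : G.Adj a b) (ha : a ∈ S → a = p ∨ a = m p ∨ a = w ∨ a = m w)
    (hb : b ∈ S → b = p ∨ b = m p ∨ b = w ∨ b = m w) :
    ∃ z, z ≠ a ∧ z ≠ b ∧ ¬ G.Adj z a ∧ ¬ G.Adj z b ∧
      (∀ s ∈ S, G.Adj z s → s = p ∨ s = m p ∨ s = w ∨ s = m w) ∧
      (z ∈ S → z = p ∨ z = m p ∨ z = w ∨ z = m w) := by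
  have h1 := h.mS hp
  have h2 := h.mm hp
  have h3 := h.mne hp
  have h1' := h.mS hw
  have h2' := h.mm hw
  have h3' := h.mne hw
  have hn : [p, m p, w, m w].Nodup := by
    simp only [List.nodup_cons, List.mem_cons, List.not_mem_nil, or_false, not_or]
    grind
  obtain ⟨z, i, j, c, d⟩ := h.exch {p, m p, w, m w} {a, b} (sw1 a b) (by simp [*]) (swm1 hab)
    (by simp only [mem_insert, mem_singleton]; rintro l (rfl | rfl); exacts [ha, hb])
    (by rw [Finset.card_pair hab.ne, card_four hn]; omega)
  simp only [mem_insert, mem_singleton, not_or, forall_eq_or_imp, forall_eq] at i j c d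
  exact ⟨z, i.1, i.2, j.1, j.2, c, d⟩

theorem ex2 {p w q a b a' b' : V} (hp : p ∈ S) (hw : w ∈ S) (hq : q ∈ S) (h1 : w ≠ p) (h2 : w ≠ m p)
    (h3 : q ≠ p) (h4 : q ≠ m p) (h5 : q ≠ w) (h6 : q ≠ m w)
    (hab : G.Adj a b) (hab' : G.Adj a' b') (h7 : a ≠ a') (h8 : a ≠ b') (h9 : b ≠ a') (h10 : b ≠ b')
    (ha : a ∈ S → a = p ∨ a = m p ∨ a = w ∨ a = m w ∨ a = q ∨ a = m q)
    (hb : b ∈ S → b = p ∨ b = m p ∨ b = w ∨ b = m w ∨ b = q ∨ b = m q)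
    (ha' : a' ∈ S → a' = p ∨ a' = m p ∨ a' = w ∨ a' = m w ∨ a' = q ∨ a' = m q)
    (hb' : b' ∈ S → b' = p ∨ b' = m p ∨ b' = w ∨ b' = m w ∨ b' = q ∨ b' = m q) :
    ∃ z, z ≠ a ∧ z ≠ b ∧ z ≠ a' ∧ z ≠ b' ∧ ¬ G.Adj z a ∧ ¬ G.Adj z b ∧ ¬ G.Adj z a' ∧ ¬ G.Adj z b' ∧
      (∀ s ∈ S, G.Adj z s → s = p ∨ s = m p ∨ s = w ∨ s = m w ∨ s = q ∨ s = m q) ∧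
      (z ∈ S → z = p ∨ z = m p ∨ z = w ∨ z = m w ∨ z = q ∨ z = m q) := by
  have e1 := h.mS hp
  have e2 := h.mm hp
  have e3 := h.mne hp
  have e1' := h.mS hw
  have e2' := h.mm hw
  have e3' := h.mne hw
  have f1' := h.mS hq
  have f2' := h.mm hq
  have f3' := h.mne hq
  have hn : [p, m p, w, m w, q, m q].Nodup := by
    simp only [List.nodup_cons, List.mem_cons, List.not_mem_nil, or_false, not_or]
    grind
  have hn' : [a, b, a', b'].Nodup := by
    have := hab.ne
    have := hab'.ne
    simp only [List.nodup_cons, List.mem_cons, List.not_mem_nil, or_false, not_or]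
    grind
  obtain ⟨z, i, j, c, d⟩ := h.exch {p, m p, w, m w, q, m q} {a, b, a', b'} (sw2 a b a' b') (by simp [*])
    (swm2 hab hab' h7 h8 h9 h10)
    (by simp only [mem_insert, mem_singleton]; rintro l (rfl | rfl | rfl | rfl); exacts [ha, hb, ha', hb'])
    (by rw [card_four hn', card_six hn]; omega)
  simp only [mem_insert, mem_singleton, not_or, forall_eq_or_imp, forall_eq] at i j c d
  exact ⟨z, i.1, i.2.1, i.2.2.1, i.2.2.2, j.1, j.2.1, j.2.2.1, j.2.2.2, c, d⟩

/-- F1 -/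
theorem F1 {u y : V} (hu : u ∈ S) (hnp : NP G S u) (hy : y ∉ S) (hyu : G.Adj y (m u)) :
    dg G S u ≤ dg G (S.erase u) y := by
  have e1 := h.mS hu
  have e2 := h.mm hu
  have e3 := h.mne hu
  have e4 := h.madj hu
  have hyu' := hyu.ne
  have huy : u ≠ y := fun e => hy (e ▸ hu)
  have hSe : (S \ {u, m u}) ∪ {m u, y} = insert y (S.erase u) := by
    ext t; simp only [mem_union, mem_sdiff, mem_insert, mem_singleton, mem_erase]
    grind
  have hl := h.lexch {u, m u} {m u, y} (sw1 (m u) y) (by simp [*]) (swm1 hyu.symm) (by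
    intro l; simp only [mem_insert, mem_singleton]; grind)
    (by rw [Finset.card_pair hyu'.symm, Finset.card_pair e3.symm])
    (by
      intro z h1 h2 h3 h4
      simp only [mem_insert, mem_singleton, not_or, forall_eq_or_imp, forall_eq] at h1 h2 h3 h4
      by_cases hz : z ∈ S
      · rcases h4 hz with rfl | rfl
        · exact h2.1 e4
        · exact h1.1 rfl
      · obtain ⟨s, hs, hzs⟩ := h.dom z hz
        rcases h3 s hs hzs with rfl | rfl
        · obtain ⟨s', hs', hzs', hne⟩ := hnp z hz hzs
          rcases h3 s' hs' hzs' with rfl | rfl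
          · exact hne rfl
          · exact h2.1 hzs'
        · exact h2.1 hzs)
  rw [hSe, lam_insert _ _ (by simp [hy])] at hl
  have h5 : lam G S = lam G (S.erase u) + 2 * dg G (S.erase u) u := by
    conv_lhs => rw [← Finset.insert_erase hu]
    rw [lam_insert _ _ (by simp)]
  have h6 : dg G S u = dg G (S.erase u) u := by
    conv_lhs => rw [← Finset.insert_erase hu]
    rw [dg_insert _ _ _ (by simp)]; simp
  omega

/-- an extra edge at `u` (no privates) forces a third neighbour -/
theorem F1a {u v y : V} (hu : u ∈ S) (hnp : NP G S u) (hv : v ∈ S) (huv : G.Adj u v) (hvm : v ≠ m u)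
    (hy : y ∉ S) (hyu : G.Adj y (m u)) : ∃ s ∈ S, G.Adj y s ∧ s ≠ u ∧ s ≠ m u := by
  have h1 := h.F1 hu hnp hy hyu
  have h2 : 2 ≤ dg G S u := by
    unfold dg
    rw [← Finset.card_pair hvm]
    apply Finset.card_le_card
    intro t
    simp only [mem_insert, mem_singleton, mem_filter]
    have := h.madj hu
    have := h.mS hu
    grind
  by_contra hcon
  push Not at hcon
  have h3 : dg G (S.erase u) y ≤ 1 := by
    unfold dg
    rw [← Finset.card_singleton (m u)]
    apply Finset.card_le_card
    intro t
    simp only [mem_singleton, mem_filter, mem_erase]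
    grind
  omega

theorem F1b {u v v' y : V} (hu : u ∈ S) (hnp : NP G S u) (hv : v ∈ S) (huv : G.Adj u v) (hvm : v ≠ m u)
    (hv' : v' ∈ S) (huv' : G.Adj u v') (hvm' : v' ≠ m u) (hvv : v ≠ v')
    (hy : y ∉ S) (hyu : G.Adj y (m u)) : ∀ t, G.Adj y t → t ∈ S ∧ t ≠ u := by
  have h1 := h.F1 hu hnp hy hyu
  have h2 : 3 ≤ dg G S u := by
    unfold dg
    have : ({m u, v, v'} : Finset V).card = 3 := by
      rw [Finset.card_eq_three]; exact ⟨m u, v, v', hvm.symm, hvm'.symm, hvv, rfl⟩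
    rw [← this]
    apply Finset.card_le_card
    intro t
    simp only [mem_insert, mem_singleton, mem_filter]
    have := h.madj hu
    have := h.mS hu
    grind
  obtain ⟨a, b, c, hab, hac, hbc, hy3⟩ := nb3 h.cub y
  rw [dg_eq hab hac hbc hy3] at h1
  intro t ht
  by_contra hcon
  rw [← mem_erase.trans and_comm] at hcon
  rcases (hy3 t).1 ht with rfl | rfl | rfl <;> · rw [if_neg hcon] at h1; split_ifs at h1 <;> omega

/-- F2 -/
theorem F2 {u v : V} (hu : u ∈ S) (hv : v ∈ S) (huv : G.Adj u v) (hvm : v ≠ m u) :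
    ∃ z, z ∉ S ∧ ¬ G.Adj z u ∧ ¬ G.Adj z v ∧ (∀ s ∈ S, G.Adj z s → s = m u ∨ s = m v) := by
  have e1 := h.madj hu
  have e2 := h.madj hv
  obtain ⟨z, h1, h2, h3, h4, h5, h6⟩ := h.ex1 (a := u) (b := v) hu hv huv.ne' hvm huv (by tauto) (by tauto)
  refine ⟨z, ?_, h3, h4, ?_⟩
  · intro hz
    have := e1.symm
    have := e2.symm
    rcases h6 hz with rfl | rfl | rfl | rfl <;> tauto
  · intro s hs hzs
    rcases h5 s hs hzs with rfl | rfl | rfl | rfl <;> tauto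

/-- private-free vertex with extra edge: the mate has no private -/
theorem npm {u v : V} (hu : u ∈ S) (hnp : NP G S u) (hv : v ∈ S) (huv : G.Adj u v) (hvm : v ≠ m u) :
    NP G S (m u) := by
  intro x hx hxm
  obtain ⟨s, hs, h1, h2, h3⟩ := h.F1a hu hnp hv huv hvm hx hxm
  exact ⟨s, hs, h1, h3⟩

/-- ... and the mate is a leaf -/
theorem leafm {u v : V} (hu : u ∈ S) (hnp : NP G S u) (hv : v ∈ S) (huv : G.Adj u v) (hvm : v ≠ m u) :
    ∀ t ∈ S, G.Adj (m u) t → t = u := by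
  by_contra hcon
  push Not at hcon
  obtain ⟨t, ht, hut, htu⟩ := hcon
  have hmu := h.mS hu
  have hmm := h.mm hu
  have hnp' := h.npm hu hnp hv huv hvm
  obtain ⟨z, h1, h2⟩ := h.exch0 hu
  have := huv.ne
  have := hut.ne
  by_cases hz : z ∈ S
  · rcases h2 hz with rfl | rfl
    · rcases h1 v hv huv with rfl | rfl <;> tauto
    · rcases h1 t ht hut with rfl | rfl <;> tauto
  · obtain ⟨s, hs, hzs⟩ := h.dom z hz
    rcases h1 s hs hzs with rfl | rfl
    · obtain ⟨s', q1, q2, q3, q4⟩ := h.F1a hmu hnp' ht hut (by rwa [hmm]) hz (by rwa [hmm])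
      rw [hmm] at q4
      have := h1 s' q1 q2
      tauto
    · obtain ⟨s', q1, q2, q3, q4⟩ := h.F1a hu hnp hv huv hvm hz hzs
      have := h1 s' q1 q2
      tauto

end Opt
end
end PDom

open Finset
set_option linter.unusedSectionVars false
set_option linter.unusedVariables false
set_option linter.unusedSimpArgs false
namespace PDom
section
variable {V : Type*} [Fintype V] [DecidableEq V] {G : SimpleGraph V} [DecidableRel G.Adj]
  {S : Finset V} {m : V → V}

/-- vertices of D-pairs -/
def isD (G : SimpleGraph V) (S : Finset V) (m : V → V) (u : V) : Prop :=
  u ∈ S ∧ NP G S u ∧ NP G S (m u)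

/-- vertices of A-pairs -/
def isA (G : SimpleGraph V) (S : Finset V) (m : V → V) (u : V) : Prop :=
  u ∈ S ∧ ∃ x xb, x ≠ xb ∧ (Pv G S u x ∨ Pv G S (m u) x) ∧ (Pv G S u xb ∨ Pv G S (m u) xb)

/-- vertices of BC-pairs -/
def isBC (G : SimpleGraph V) (S : Finset V) (m : V → V) (u : V) : Prop :=
  u ∈ S ∧ ¬ isD G S m u ∧ ¬ isA G S m u

/-- exceptional BC-pairs -/
def exc (G : SimpleGraph V) (S : Finset V) (m : V → V) (t : V) : Prop :=
  ∃ z, z ∉ S ∧ (G.Adj z t ∨ G.Adj z (m t)) ∧ ∃ a b, a ≠ b ∧ isBC G S m a ∧ isBC G S m b ∧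
    ∀ s ∈ S, G.Adj z s ↔ s = a ∨ s = b

/-- `x` is a trigger of the T-rule, with payer `w` -/
def payer (G : SimpleGraph V) (S : Finset V) (m : V → V) (x w : V) : Prop :=
  ∃ u, isD G S m u ∧ isD G S m w ∧ w ≠ u ∧ w ≠ m u ∧ (∀ t ∈ S, G.Adj x t ↔ t = u ∨ t = m u ∨ t = w) ∧
    ((∃ v ∈ S, v ≠ u ∧ v ≠ m u ∧ (G.Adj u v ∨ G.Adj (m u) v)) ∨
      ∃ y, y ∉ S ∧ y ≠ x ∧ ∀ t ∈ S, G.Adj y t ↔ t = u ∨ t = m u ∨ t = m w)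

open Classical in
/-- weight sent to non-D vertices -/
noncomputable def gw (G : SimpleGraph V) (S : Finset V) (m : V → V) (t : V) : ℚ :=
  if isA G S m t then -1/4 else if exc G S m t then 0 else 1/6

open Classical in
/-- weight of an edge from `x ∉ S` to `s ∈ S` -/
noncomputable def wt (G : SimpleGraph V) (S : Finset V) (m : V → V) (x s : V) : ℚ :=
  if ∀ t ∈ S, G.Adj x t → ¬ isD G S m t then 1 / ((S.filter (fun t => G.Adj x t)).card : ℚ)
  else if isD G S m s then
    if payer G S m x s then 1/4
    else if ∃ w, payer G S m x w then 3/8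
    else (1 - ∑ t ∈ S.filter (fun t => G.Adj x t ∧ ¬ isD G S m t), gw G S m t) /
      ((S.filter (fun t => G.Adj x t ∧ isD G S m t)).card : ℚ)
  else gw G S m s

open Classical in
/-- charge received from outside -/
noncomputable def ch (G : SimpleGraph V) (S : Finset V) (m : V → V) (s : V) : ℚ :=
  ∑ x ∈ univ.filter (fun x => x ∉ S ∧ G.Adj s x), wt G S m x s

open Classical in
/-- `t` gives to `s` -/
noncomputable def give (G : SimpleGraph V) (S : Finset V) (m : V → V) (t s : V) : ℚ :=
  if isA G S m t ∧ ¬ isA G S m s then 1/4 else if isD G S m t ∧ isBC G S m s then 1/6 else 0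

open Classical in
/-- transfer from `t` to `s` -/
noncomputable def tr (G : SimpleGraph V) (S : Finset V) (m : V → V) (s t : V) : ℚ :=
  give G S m t s - give G S m s t +
    if isD G S m s ∧ isD G S m t then
      (ch G S m t + ch G S m (m t) - ch G S m s - ch G S m (m s)) / 2 else 0

/-- total contribution of `t` to `s` -/
noncomputable def ctr (G : SimpleGraph V) (S : Finset V) (m : V → V) (s t : V) : ℚ :=
  if t ∈ S then tr G S m s t else wt G S m t s

open Classical in
/-- final charge -/
noncomputable def fin (G : SimpleGraph V) (S : Finset V) (m : V → V) (s : V) : ℚ :=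
  ∑ t ∈ univ.filter (fun t => G.Adj s t ∧ t ≠ m s), ctr G S m s t

theorem tr_anti (s t : V) : tr G S m s t = - tr G S m t s := by
  unfold tr
  by_cases h1 : isD G S m s ∧ isD G S m t
  · rw [if_pos h1, if_pos h1.symm]; ring
  · rw [if_neg h1, if_neg (fun h => h1 h.symm)]; ring

theorem isA_iff_m (h : Opt G S m) {u : V} (hu : u ∈ S) : isA G S m (m u) ↔ isA G S m u := by
  unfold isA
  rw [h.mm hu]
  have := h.mS hu
  simp only [hu, this, true_and]
  constructor
  · rintro ⟨x, x', a, b, c⟩; exact ⟨x, x', a, b.symm, c.symm⟩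
  · rintro ⟨x, x', a, b, c⟩; exact ⟨x, x', a, b.symm, c.symm⟩

theorem isD_iff_m (h : Opt G S m) {u : V} (hu : u ∈ S) : isD G S m (m u) ↔ isD G S m u := by
  unfold isD
  rw [h.mm hu]
  have := h.mS hu
  tauto

theorem isBC_iff_m (h : Opt G S m) {u : V} (hu : u ∈ S) : isBC G S m (m u) ↔ isBC G S m u := by
  unfold isBC
  rw [isA_iff_m h hu, isD_iff_m h hu]
  have := h.mS hu
  tauto

theorem isD_m (h : Opt G S m) {u : V} (hu : isD G S m u) : isD G S m (m u) :=
  (isD_iff_m h hu.1).2 hu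

theorem not_A_of_D {u : V} (hu : isD G S m u) : ¬ isA G S m u := by
  rintro ⟨_, x, x', _, hx, _⟩
  rcases hx with hx | hx
  · exact (not_NP.2 ⟨x, hx⟩) hu.2.1
  · exact (not_NP.2 ⟨x, hx⟩) hu.2.2

theorem wt_sum (h : Opt G S m) {x : V} (hx : x ∉ S) :
    ∑ s ∈ S.filter (fun s => G.Adj x s), wt G S m x s = 1 := by
  classical
  by_cases h1 : ∀ t ∈ S, G.Adj x t → ¬ isD G S m t
  · have : ∀ s ∈ S.filter (fun s => G.Adj x s), wt G S m x s =
        1 / ((S.filter (fun t => G.Adj x t)).card : ℚ) := by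
      intro s _; unfold wt; rw [if_pos h1]; congr
    rw [Finset.sum_congr rfl this, Finset.sum_const, nsmul_eq_mul]
    obtain ⟨u, hu, hxu⟩ := h.dom x hx
    have h0 : 0 < (S.filter (fun t => G.Adj x t)).card :=
      Finset.card_pos.2 ⟨u, by simp [hu, hxu]⟩
    have : ((S.filter (fun t => G.Adj x t)).card : ℚ) ≠ 0 := by positivity
    field_simp
  · by_cases h2 : ∃ w, payer G S m x w
    · obtain ⟨w, hw⟩ := h2
      obtain ⟨u, hu, hw', hwu, hwu', hN, _⟩ := id hw
      have hmu := isD_m h hu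
      have e3 := h.mne hu.1
      have e4 := h.mm hu.1
      have hf : S.filter (fun s => G.Adj x s) = {u, m u, w} := by
        ext t
        simp only [mem_filter, mem_insert, mem_singleton]
        constructor
        · rintro ⟨a, b⟩; exact (hN t a).1 b
        · intro ht
          have : t ∈ S := by rcases ht with rfl | rfl | rfl; exacts [hu.1, hmu.1, hw'.1]
          exact ⟨this, (hN t this).2 ht⟩
      have huq : ∀ w', payer G S m x w' → w' = w := by
        rintro w' ⟨u', hu', hw'', hwu'', hwu''', hN', _⟩
        have a1 := (hN u' hu'.1).1 ((hN' u' hu'.1).2 (by simp))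
        have a2 := (hN (m u') (isD_m h hu').1).1 ((hN' (m u') (isD_m h hu').1).2 (by simp))
        have a3 := (hN w' hw''.1).1 ((hN' w' hw''.1).2 (by simp))
        have a4 := h.mm hu'.1
        have a5 := h.mne hu'.1
        grind
      rw [hf, Finset.sum_insert (by simp [e3.symm, hwu.symm]), Finset.sum_insert (by simp [hwu'.symm]),
        Finset.sum_singleton]
      unfold wt
      simp only [if_neg h1, if_pos hu, if_pos hmu, if_pos hw', if_pos hw,
        if_pos (show ∃ w, payer G S m x w from ⟨w, hw⟩),
        if_neg (show ¬ payer G S m x u from fun hh => hwu (huq u hh).symm),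
        if_neg (show ¬ payer G S m x (m u) from fun hh => hwu' (huq _ hh).symm)]
      norm_num
    · have hnp : ∀ s, ¬ payer G S m x s := fun s hs => h2 ⟨s, hs⟩
      rw [← Finset.sum_filter_add_sum_filter_not _ (fun s => isD G S m s), Finset.filter_filter,
        Finset.filter_filter]
      have e1 : ∀ s ∈ S.filter (fun t => G.Adj x t ∧ isD G S m t), wt G S m x s =
          (1 - ∑ t ∈ S.filter (fun t => G.Adj x t ∧ ¬ isD G S m t), gw G S m t) /
      ((S.filter (fun t => G.Adj x t ∧ isD G S m t)).card : ℚ) := by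
        intro s hs
        simp only [mem_filter] at hs
        unfold wt
        rw [if_neg h1, if_pos hs.2.2, if_neg (hnp s), if_neg h2]; congr
      have e2 : ∀ s ∈ S.filter (fun t => G.Adj x t ∧ ¬ isD G S m t), wt G S m x s = gw G S m s := by
        intro s hs
        simp only [mem_filter] at hs
        unfold wt
        rw [if_neg h1, if_neg hs.2.2]
      rw [Finset.sum_congr rfl e1, Finset.sum_congr rfl e2, Finset.sum_const, nsmul_eq_mul]
      push Not at h1
      obtain ⟨u, hu, hxu, hud⟩ := h1
      have h0 : 0 < (S.filter (fun t => G.Adj x t ∧ isD G S m t)).card :=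
        Finset.card_pos.2 ⟨u, by simp [hu, hxu, hud]⟩
      have : ((S.filter (fun t => G.Adj x t ∧ isD G S m t)).card : ℚ) ≠ 0 := by positivity
      field_simp
      ring

theorem main_sum (h : Opt G S m) (hp : ∀ s ∈ S, 3/2 ≤ fin G S m s + fin G S m (m s)) :
    7 * S.card ≤ 4 * Fintype.card V := by
  classical
  have h1 : ∑ s ∈ S, fin G S m (m s) = ∑ s ∈ S, fin G S m s := by
    apply Finset.sum_bij (fun s _ => m s)
    · intro s hs; exact h.mS hs
    · intro a ha b hb hab; rw [← h.mm ha, ← h.mm hb, hab]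
    · intro b hb; exact ⟨m b, h.mS hb, h.mm hb⟩
    · intro s hs; rfl
  have h2 : ∑ s ∈ S, fin G S m s = ((univ \ S).card : ℚ) := by
    have h3 : ∀ s ∈ S, fin G S m s = (∑ t ∈ S, if G.Adj s t ∧ t ≠ m s then tr G S m s t else 0) +
        ∑ x ∈ univ \ S, if G.Adj x s then wt G S m x s else 0 := by
      intro s hs
      unfold fin
      rw [← Finset.sum_filter, ← Finset.sum_filter,
        ← Finset.sum_filter_add_sum_filter_not _ (fun t => t ∈ S)]
      congr 1
      · apply Finset.sum_congr
        · ext t; simp only [mem_filter, mem_univ, true_and]; tauto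
        · intro t ht; simp only [mem_filter] at ht; unfold ctr; rw [if_pos ht.1]
      · apply Finset.sum_congr
        · ext t; simp only [mem_filter, mem_univ, true_and, mem_sdiff]
          have := h.mS hs
          have := G.adj_comm s t
          grind
        · intro t ht; simp only [mem_filter, mem_sdiff, mem_univ, true_and] at ht
          unfold ctr; rw [if_neg ht.1]
    rw [Finset.sum_congr rfl h3, Finset.sum_add_distrib]
    have h4 : ∑ s ∈ S, (∑ t ∈ S, if G.Adj s t ∧ t ≠ m s then tr G S m s t else 0) = 0 := by
      have h5 : ∑ s ∈ S, (∑ t ∈ S, if G.Adj s t ∧ t ≠ m s then tr G S m s t else 0) =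
          - ∑ s ∈ S, (∑ t ∈ S, if G.Adj s t ∧ t ≠ m s then tr G S m s t else 0) := by
        conv_lhs => rw [Finset.sum_comm]
        rw [← Finset.sum_neg_distrib]
        apply Finset.sum_congr rfl
        intro t ht
        rw [← Finset.sum_neg_distrib]
        apply Finset.sum_congr rfl
        intro s hs
        have e : (G.Adj s t ∧ t ≠ m s) ↔ (G.Adj t s ∧ s ≠ m t) := by
          have := h.mm hs
          have := h.mm ht
          have := G.adj_comm s t
          grind
        by_cases hh : G.Adj s t ∧ t ≠ m s
        · rw [if_pos hh, if_pos (e.1 hh), tr_anti]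
        · rw [if_neg hh, if_neg (fun x => hh (e.2 x))]; simp
      linarith
    rw [h4, Finset.sum_comm, zero_add]
    rw [Finset.sum_congr rfl (g := fun _ => (1 : ℚ))]
    · simp
    · intro x hx
      rw [← Finset.sum_filter]
      exact wt_sum h (by simpa using hx)
  have h5 : ∑ s ∈ S, (3/2 : ℚ) ≤ ∑ s ∈ S, (fin G S m s + fin G S m (m s)) := Finset.sum_le_sum hp
  rw [Finset.sum_add_distrib, h1, h2, Finset.sum_const, nsmul_eq_mul] at h5
  have h6 : (univ \ S).card + S.card = Fintype.card V := by
    rw [Finset.card_sdiff_of_subset (Finset.subset_univ S)]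
    have := Finset.card_le_card (Finset.subset_univ S)
    simp at *
    omega
  have h7 : ((univ \ S).card : ℚ) = Fintype.card V - S.card := by
    rw [← h6]; push_cast; ring
  rw [h7] at h5
  have : (7 : ℚ) * S.card ≤ 4 * Fintype.card V := by linarith
  exact_mod_cast this

theorem fin_eq {s a b : V} (h1 : m s ≠ a) (h2 : m s ≠ b) (h3 : a ≠ b)
    (hN : ∀ t, G.Adj s t ↔ t = m s ∨ t = a ∨ t = b) : fin G S m s = ctr G S m s a + ctr G S m s b := by
  classical
  unfold fin
  rw [← Finset.sum_pair h3]
  apply Finset.sum_congr _ (fun _ _ => rfl)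
  ext t; simp only [mem_filter, mem_univ, true_and, mem_insert, mem_singleton, hN]
  grind

end
end PDom

open Finset
set_option linter.unusedSectionVars false
set_option linter.unusedVariables false
set_option linter.unusedSimpArgs false
namespace PDom
section
variable {V : Type*} [Fintype V] [DecidableEq V] {G : SimpleGraph V} [DecidableRel G.Adj]
  {S : Finset V} {m : V → V}

theorem gw_le (t : V) : gw G S m t ≤ 1/6 := by
  unfold gw; split_ifs <;> norm_num
theorem gw_ge (t : V) : -1/4 ≤ gw G S m t := by
  unfold gw; split_ifs <;> norm_num
theorem gw_A {t : V} (ht : isA G S m t) : gw G S m t = -1/4 := by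
  unfold gw; rw [if_pos ht]
theorem gw_exc {t : V} (ht : ¬ isA G S m t) (h : exc G S m t) : gw G S m t = 0 := by
  unfold gw; rw [if_neg ht, if_pos h]
theorem gw_BC {t : V} (ht : ¬ isA G S m t) : 0 ≤ gw G S m t := by
  unfold gw; rw [if_neg ht]; split_ifs <;> norm_num
theorem gw_BC' {t : V} (ht : ¬ isA G S m t) (h : ¬ exc G S m t) : gw G S m t = 1/6 := by
  unfold gw; rw [if_neg ht, if_neg h]

theorem payer_N {x w : V} (hp : payer G S m x w) (h : Opt G S m) :
    ∃ u ∈ S, m u ∈ S ∧ w ∈ S ∧ u ≠ m u ∧ w ≠ u ∧ w ≠ m u ∧ G.Adj x u ∧ G.Adj x (m u) ∧ G.Adj x w ∧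
     (∀ t ∈ S, G.Adj x t → t = u ∨ t = m u ∨ t = w) ∧ isD G S m u ∧ isD G S m (m u) ∧ isD G S m w := by
  obtain ⟨u, hu, hw', hwu, hwu', hN, _⟩ := hp
  have hmu := isD_m h hu
  exact ⟨u, hu.1, hmu.1, hw'.1, (h.mne hu.1).symm, hwu, hwu', (hN u hu.1).2 (by simp),
    (hN _ hmu.1).2 (by simp), (hN w hw'.1).2 (by simp), fun t ht => (hN t ht).1, hu, hmu, hw'⟩

open Classical in
/-- the D part of the weight formula -/
noncomputable def kap (G : SimpleGraph V) (S : Finset V) (m : V → V) (b : V) : ℚ :=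
  if isD G S m b then 1 else 0
open Classical in
/-- the non-D part of the weight formula -/
noncomputable def phi (G : SimpleGraph V) (S : Finset V) (m : V → V) (b : V) : ℚ :=
  if b ∈ S ∧ ¬ isD G S m b then gw G S m b else 0

theorem kap_D {b : V} (hb : isD G S m b) : kap G S m b = 1 := by unfold kap; rw [if_pos hb]
theorem kap_nD {b : V} (hb : ¬ isD G S m b) : kap G S m b = 0 := by unfold kap; rw [if_neg hb]
theorem kap_nn (b : V) : 0 ≤ kap G S m b := by unfold kap; split_ifs <;> norm_num
theorem kap_le (b : V) : kap G S m b ≤ 1 := by unfold kap; split_ifs <;> norm_num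
theorem phi_D {b : V} (hb : isD G S m b) : phi G S m b = 0 := by
  unfold phi; rw [if_neg (fun h => h.2 hb)]
theorem phi_ext {b : V} (hb : b ∉ S) : phi G S m b = 0 := by
  unfold phi; rw [if_neg (fun h => hb h.1)]
theorem phi_nD {b : V} (hb : ¬ isD G S m b) (hS : b ∈ S) : phi G S m b = gw G S m b := by
  unfold phi; rw [if_pos ⟨hS, hb⟩]
theorem phi_le (b : V) : phi G S m b ≤ 1/6 := by
  unfold phi; split_ifs
  · exact gw_le b
  · norm_num
theorem kap_ext {b : V} (hb : b ∉ S) : kap G S m b = 0 := kap_nD (fun h => hb h.1)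

theorem wt_formula (h : Opt G S m) {x s b c : V} (hs : isD G S m s) (hsb : s ≠ b) (hsc : s ≠ c) (hbc : b ≠ c)
    (hN : ∀ t, G.Adj x t ↔ t = s ∨ t = b ∨ t = c) (hp : ∀ w, ¬ payer G S m x w) :
    wt G S m x s = (1 - (phi G S m b + phi G S m c)) / (1 + kap G S m b + kap G S m c) := by
  classical
  unfold wt
  rw [if_neg (by push Not; exact ⟨s, hs.1, (hN s).2 (by simp), hs⟩), if_pos hs, if_neg (hp s),
    if_neg (by push Not; exact hp)]
  congr 1
  · congr 1
    have : S.filter (fun t => G.Adj x t ∧ ¬ isD G S m t) =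
        ({b, c} : Finset V).filter (fun t => t ∈ S ∧ ¬ isD G S m t) := by
      ext t; simp only [mem_filter, mem_insert, mem_singleton, hN]; grind
    trans ∑ t ∈ S.filter (fun t => G.Adj x t ∧ ¬ isD G S m t), gw G S m t
    · congr
    rw [this, Finset.sum_filter, Finset.sum_pair hbc]
    unfold phi; congr
  · trans ((S.filter (fun t => G.Adj x t ∧ isD G S m t)).card : ℚ)
    · congr
    have : S.filter (fun t => G.Adj x t ∧ isD G S m t) =
        ({s, b, c} : Finset V).filter (fun t => isD G S m t) := by
      ext t; simp only [mem_filter, mem_insert, mem_singleton, hN]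
      have : isD G S m t → t ∈ S := fun h => h.1
      grind
    rw [this, Finset.card_filter, Finset.sum_insert (by simp [hsb, hsc]), Finset.sum_pair hbc, if_pos hs]
    unfold kap
    push_cast
    ring

theorem wt_payer {x s : V} (hp : payer G S m x s) : wt G S m x s = 1/4 := by
  obtain ⟨u, hu, hw', hwu, hwu', hN, _⟩ := id hp
  unfold wt
  rw [if_neg (by push Not; exact ⟨s, hw'.1, (hN s hw'.1).2 (by simp), hw'⟩), if_pos hw', if_pos hp]

theorem wt_recv {x s w : V} (hs : isD G S m s) (hsx : G.Adj x s) (hp : payer G S m x w) (hsw : s ≠ w)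
    (h : Opt G S m) : wt G S m x s = 3/8 := by
  have hns : ¬ payer G S m x s := by
    intro hp'
    obtain ⟨u, q1, q2, q3, q4, q5, q6, q7, q8, q9, q10, q11, q12, q13⟩ := payer_N hp h
    obtain ⟨u', p1, p2, p3, p4, p5, p6, p7, p8, p9, p10, p11, p12, p13⟩ := payer_N hp' h
    have := h.mm q1
    have := h.mm p1
    have := q10 u' p1 p7
    have := q10 _ p2 p8
    have := q10 _ p3 p9
    grind
  unfold wt
  rw [if_neg (by push Not; exact ⟨s, hs.1, hsx, hs⟩), if_pos hs, if_neg hns, if_pos ⟨w, hp⟩]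

section bounds
variable (h : Opt G S m) {x s : V} (hs : isD G S m s) (hxs : G.Adj x s)
include h hs hxs

theorem wD_third (hnp : ¬ payer G S m x s) : 1/3 ≤ wt G S m x s := by
  by_cases hp : ∃ w, payer G S m x w
  · obtain ⟨w, hw⟩ := hp
    have : s ≠ w := by rintro rfl; exact hnp hw
    rw [wt_recv hs hxs hw this h]; norm_num
  · push Not at hp
    obtain ⟨b, c, h1, h2, h3, h4⟩ := nb3' h.cub hxs
    rw [wt_formula h hs h1 h2 h3 h4 hp]
    have := kap_nn (G := G) (S := S) (m := m) b
    have := kap_nn (G := G) (S := S) (m := m) c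
    rw [le_div_iff₀ (by linarith)]
    by_cases hb : isD G S m b <;> by_cases hc : isD G S m c <;>
      simp only [hb, hc, kap_D, kap_nD, phi_D, not_false_eq_true] <;>
      linarith [phi_le (G := G) (S := S) (m := m) b, phi_le (G := G) (S := S) (m := m) c]

theorem wD_low : 1/4 ≤ wt G S m x s := by
  by_cases hp : payer G S m x s
  · rw [wt_payer hp]
  · linarith [wD_third h hs hxs hp]

/-- at most one other D neighbour -/
theorem wD_512 {t : V} (ht : t ∈ S) (hxt : G.Adj x t) (htD : ¬ isD G S m t) : 5/12 ≤ wt G S m x s := by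
  have hst : s ≠ t := by rintro rfl; exact htD hs
  have hp : ∀ w, ¬ payer G S m x w := by
    intro w hw
    obtain ⟨u, q1, q2, q3, q4, q5, q6, q7, q8, q9, q10, q11, q12, q13⟩ := payer_N hw h
    rcases q10 t ht hxt with rfl | rfl | rfl <;> tauto
  obtain ⟨c, h1, h2, h4⟩ := nb3'' h.cub hxs hxt hst
  rw [wt_formula h hs hst h1 h2 h4 hp, kap_nD htD]
  have := kap_nn (G := G) (S := S) (m := m) c
  rw [le_div_iff₀ (by linarith)]
  by_cases hc : isD G S m c <;>
      simp only [hc, kap_D, kap_nD, phi_D, not_false_eq_true] <;>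
      linarith [phi_le (G := G) (S := S) (m := m) t, phi_le (G := G) (S := S) (m := m) c]

theorem wD_A {t : V} (ht : isA G S m t) (hxt : G.Adj x t) : 5/8 ≤ wt G S m x s := by
  have htD : ¬ isD G S m t := fun hh => not_A_of_D hh ht
  have hst : s ≠ t := by rintro rfl; exact htD hs
  have hp : ∀ w, ¬ payer G S m x w := by
    intro w hw
    obtain ⟨u, q1, q2, q3, q4, q5, q6, q7, q8, q9, q10, q11, q12, q13⟩ := payer_N hw h
    rcases q10 t ht.1 hxt with rfl | rfl | rfl <;> tauto
  obtain ⟨c, h1, h2, h4⟩ := nb3'' h.cub hxs hxt hst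
  rw [wt_formula h hs hst h1 h2 h4 hp, kap_nD htD, phi_nD htD ht.1, gw_A ht]
  have := kap_nn (G := G) (S := S) (m := m) c
  rw [le_div_iff₀ (by linarith)]
  by_cases hc : isD G S m c <;>
      simp only [hc, kap_D, kap_nD, phi_D, not_false_eq_true] <;>
      linarith [phi_le (G := G) (S := S) (m := m) t, phi_le (G := G) (S := S) (m := m) c]

theorem wD_noD (hno : ∀ t, isD G S m t → G.Adj x t → t = s) : 2/3 ≤ wt G S m x s := by
  have hp : ∀ w, ¬ payer G S m x w := by
    intro w hw
    obtain ⟨u, q1, q2, q3, q4, q5, q6, q7, q8, q9, q10, q11, q12, q13⟩ := payer_N hw h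
    have a1 := hno _ q11 q7
    have a2 := hno _ q12 q8
    exact q4 (a1.trans a2.symm)
  obtain ⟨b, c, h1, h2, h3, h4⟩ := nb3' h.cub hxs
  rw [wt_formula h hs h1 h2 h3 h4 hp, kap_nD (fun hh => h1 (hno _ hh ((h4 b).2 (by simp))).symm),
    kap_nD (fun hh => h2 (hno _ hh ((h4 c).2 (by simp))).symm)]
  linarith [phi_le (G := G) (S := S) (m := m) b, phi_le (G := G) (S := S) (m := m) c]

/-- at most one other neighbour in `S` -/
theorem wD_two {t : V} (hno : ∀ r ∈ S, G.Adj x r → r = s ∨ r = t) : 1/2 ≤ wt G S m x s := by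
  have hp : ∀ w, ¬ payer G S m x w := by
    intro w hw
    obtain ⟨u, q1, q2, q3, q4, q5, q6, q7, q8, q9, q10, q11, q12, q13⟩ := payer_N hw h
    have a1 := hno _ q1 q7
    have a2 := hno _ q2 q8
    have a3 := hno _ q3 q9
    grind
  obtain ⟨b, c, h1, h2, h3, h4⟩ := nb3' h.cub hxs
  rw [wt_formula h hs h1 h2 h3 h4 hp]
  have hbc : b ∉ S ∨ c ∉ S := by
    have := hno b
    have := hno c
    grind
  have := kap_nn (G := G) (S := S) (m := m) b
  have := kap_nn (G := G) (S := S) (m := m) c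
  rw [le_div_iff₀ (by linarith)]
  rcases hbc with hb | hc
  · rw [kap_ext hb, phi_ext hb]
    by_cases hc : isD G S m c <;>
      simp only [hc, kap_D, kap_nD, phi_D, not_false_eq_true] <;>
      linarith [phi_le (G := G) (S := S) (m := m) c]
  · rw [kap_ext hc, phi_ext hc]
    by_cases hc : isD G S m b <;>
      simp only [hc, kap_D, kap_nD, phi_D, not_false_eq_true] <;>
      linarith [phi_le (G := G) (S := S) (m := m) b]

theorem wD_two_noD {t : V} (hno : ∀ r ∈ S, G.Adj x r → r = s ∨ r = t) (ht : ¬ isD G S m t) :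
    5/6 ≤ wt G S m x s := by
  have hp : ∀ w, ¬ payer G S m x w := by
    intro w hw
    obtain ⟨u, q1, q2, q3, q4, q5, q6, q7, q8, q9, q10, q11, q12, q13⟩ := payer_N hw h
    have a1 := hno _ q1 q7
    have a2 := hno _ q2 q8
    have a3 := hno _ q3 q9
    grind
  obtain ⟨b, c, h1, h2, h3, h4⟩ := nb3' h.cub hxs
  have nD : ∀ r, s ≠ r → G.Adj x r → ¬ isD G S m r := by
    intro r hr hxr hrD
    rcases hno r hrD.1 hxr with rfl | rfl <;> tauto
  rw [wt_formula h hs h1 h2 h3 h4 hp, kap_nD (nD b h1 ((h4 b).2 (by simp))),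
    kap_nD (nD c h2 ((h4 c).2 (by simp)))]
  have hbc : b ∉ S ∨ c ∉ S := by
    have := hno b
    have := hno c
    grind
  rcases hbc with hb | hc
  · rw [phi_ext hb]; linarith [phi_le (G := G) (S := S) (m := m) c]
  · rw [phi_ext hc]; linarith [phi_le (G := G) (S := S) (m := m) b]

end bounds

/-- non-D lower bounds -/
theorem wt_nD {x s : V} (hs : ¬ isD G S m s) : 0 ≤ wt G S m x s ∨ wt G S m x s = gw G S m s := by
  unfold wt
  by_cases h1 : ∀ t ∈ S, G.Adj x t → ¬ isD G S m t
  · rw [if_pos h1]; left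
    positivity
  · rw [if_neg h1, if_neg hs]; right; rfl

theorem wt_A_ge {x s : V} (hs : ¬ isD G S m s) : -1/4 ≤ wt G S m x s := by
  rcases wt_nD (G := G) (S := S) (m := m) (x := x) hs with h | h
  · linarith
  · rw [h]; exact gw_ge s

theorem wt_BC_nn {x s : V} (hs : ¬ isD G S m s) (ha : ¬ isA G S m s) : 0 ≤ wt G S m x s := by
  rcases wt_nD (G := G) (S := S) (m := m) (x := x) hs with h | h
  · linarith
  · rw [h]; exact gw_BC ha

theorem wt_BC_ge (h : Opt G S m) {x s : V} (hs : ¬ isD G S m s) (ha : ¬ isA G S m s) (he : ¬ exc G S m s)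
    (hS : s ∈ S) (hxs : G.Adj x s) : 1/6 ≤ wt G S m x s := by
  classical
  unfold wt
  by_cases h1 : ∀ t ∈ S, G.Adj x t → ¬ isD G S m t
  · rw [if_pos h1]
    have e : ((S.filter (fun t => G.Adj x t)).card : ℚ) ≤ 3 := by
      have : (S.filter (fun t => G.Adj x t)).card ≤ 3 := by
        rw [← h.cub x, ← G.card_neighborFinset_eq_degree]
        apply Finset.card_le_card
        intro t; simp
      exact_mod_cast this
    have e' : (0:ℚ) < ((S.filter (fun t => G.Adj x t)).card : ℚ) := by
      have : 0 < (S.filter (fun t => G.Adj x t)).card := Finset.card_pos.2 ⟨s, by simp [hS, hxs]⟩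
      exact_mod_cast this
    have : (1:ℚ)/6 ≤ 1 / ((S.filter (fun t => G.Adj x t)).card : ℚ) := by
      rw [div_le_div_iff₀ (by norm_num) e']; linarith
    convert this
  · rw [if_neg h1, if_neg hs, gw_BC' ha he]

theorem wt_Pv {x s : V} (hS : s ∈ S) (hs : ¬ isD G S m s) (hx : Pv G S s x) : wt G S m x s = 1 := by
  classical
  unfold wt
  rw [if_pos (by intro t ht hxt; rw [hx.2.2 t ht hxt]; exact hs)]
  have : S.filter (fun t => G.Adj x t) = {s} := by
    ext t; simp only [mem_filter, mem_singleton]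
    constructor
    · rintro ⟨a, b⟩; exact hx.2.2 t a b
    · rintro rfl; exact ⟨hS, hx.2.1⟩
  trans 1 / ((S.filter (fun t => G.Adj x t)).card : ℚ)
  · congr
  · rw [this]; simp

theorem wt_exc {x s a b : V} (hab : a ≠ b) (ha : ¬ isD G S m a) (hb : ¬ isD G S m b) (haS : a ∈ S) (hbS : b ∈ S)
    (hN : ∀ t ∈ S, G.Adj x t ↔ t = a ∨ t = b) : wt G S m x s = 1/2 := by
  classical
  unfold wt
  rw [if_pos (by intro t ht hxt; rcases (hN t ht).1 hxt with rfl | rfl <;> assumption)]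
  have : S.filter (fun t => G.Adj x t) = {a, b} := by
    ext t; simp only [mem_filter, mem_singleton, mem_insert]
    constructor
    · rintro ⟨a, b⟩; exact (hN t a).1 b
    · rintro (rfl | rfl)
      · exact ⟨haS, (hN _ haS).2 (by simp)⟩
      · exact ⟨hbS, (hN _ hbS).2 (by simp)⟩
  trans 1 / ((S.filter (fun t => G.Adj x t)).card : ℚ)
  · congr
  · rw [this, Finset.card_pair hab]; norm_num

end
end PDom

open Finset
set_option linter.unusedSectionVars false
set_option linter.unusedVariables false
set_option linter.unusedSimpArgs false
namespace PDom
section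
variable {V : Type*} [Fintype V] [DecidableEq V] {G : SimpleGraph V} [DecidableRel G.Adj]
  {S : Finset V} {m : V → V}

theorem ctr_ext {s t : V} (ht : t ∉ S) : ctr G S m s t = wt G S m t s := by unfold ctr; rw [if_neg ht]
theorem ctr_int {s t : V} (ht : t ∈ S) : ctr G S m s t = tr G S m s t := by unfold ctr; rw [if_pos ht]

theorem give_nn (t s : V) : 0 ≤ give G S m t s := by unfold give; split_ifs <;> norm_num
theorem give_le (t s : V) : give G S m t s ≤ 1/4 := by unfold give; split_ifs <;> norm_num

theorem tr_nD {s t : V} (h : ¬ (isD G S m s ∧ isD G S m t)) :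
    tr G S m s t = give G S m t s - give G S m s t := by unfold tr; rw [if_neg h, add_zero]

theorem ctr_A_ge {s t : V} (hs : isA G S m s) : -1/4 ≤ ctr G S m s t := by
  have hD : ¬ isD G S m s := fun hh => not_A_of_D hh hs
  unfold ctr
  split_ifs
  · rw [tr_nD (by tauto)]
    linarith [give_nn (G := G) (S := S) (m := m) t s, give_le (G := G) (S := S) (m := m) s t]
  · exact wt_A_ge hD

theorem ctr_Pv {x s : V} (hS : s ∈ S) (hs : ¬ isD G S m s) (hx : Pv G S s x) : ctr G S m s x = 1 := by
  rw [ctr_ext hx.1, wt_Pv hS hs hx]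

theorem slots (h : Opt G S m) {s : V} (hs : s ∈ S) : ∃ a b, m s ≠ a ∧ m s ≠ b ∧ a ≠ b ∧
    ∀ t, G.Adj s t ↔ t = m s ∨ t = a ∨ t = b := nb3' h.cub (h.madj hs)

theorem pairA (h : Opt G S m) {u : V} (hu : isA G S m u) : 3/2 ≤ fin G S m u + fin G S m (m u) := by
  have hS := hu.1
  have hS' := h.mS hS
  have hu' := (isA_iff_m h hS).2 hu
  have hD : ¬ isD G S m u := fun hh => not_A_of_D hh hu
  have hD' : ¬ isD G S m (m u) := fun hh => not_A_of_D hh hu'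
  obtain ⟨a, b, h1, h2, h3, h4⟩ := slots h hS
  obtain ⟨c, d, k1, k2, k3, k4⟩ := slots h hS'
  rw [fin_eq h1 h2 h3 h4, fin_eq k1 k2 k3 k4]
  obtain ⟨x, x', hne, hx, hx'⟩ := hu.2
  have ga := ctr_A_ge (t := a) hu
  have gb := ctr_A_ge (t := b) hu
  have gc := ctr_A_ge (t := c) hu'
  have gd := ctr_A_ge (t := d) hu'
  have key : ∀ y, Pv G S u y → (y = a ∧ ctr G S m u a = 1) ∨ (y = b ∧ ctr G S m u b = 1) := by
    intro y hy
    rcases (h4 y).1 hy.2.1.symm with rfl | rfl | rfl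
    · exact absurd hS' hy.1
    · left; exact ⟨rfl, ctr_Pv hS hD hy⟩
    · right; exact ⟨rfl, ctr_Pv hS hD hy⟩
  have key' : ∀ y, Pv G S (m u) y → (y = c ∧ ctr G S m (m u) c = 1) ∨ (y = d ∧ ctr G S m (m u) d = 1) := by
    intro y hy
    rcases (k4 y).1 hy.2.1.symm with rfl | rfl | rfl
    · rw [h.mm hS] at hy; exact absurd hS hy.1
    · left; exact ⟨rfl, ctr_Pv hS' hD' hy⟩
    · right; exact ⟨rfl, ctr_Pv hS' hD' hy⟩
  rcases hx with hx | hx <;> rcases hx' with hx' | hx'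
  · rcases key x hx with ⟨e1, e2⟩ | ⟨e1, e2⟩ <;> rcases key x' hx' with ⟨f1, f2⟩ | ⟨f1, f2⟩ <;>
      first | linarith | exact absurd (e1.trans f1.symm) hne
  · rcases key x hx with ⟨e1, e2⟩ | ⟨e1, e2⟩ <;> rcases key' x' hx' with ⟨f1, f2⟩ | ⟨f1, f2⟩ <;> linarith
  · rcases key' x hx with ⟨e1, e2⟩ | ⟨e1, e2⟩ <;> rcases key x' hx' with ⟨f1, f2⟩ | ⟨f1, f2⟩ <;> linarith
  · rcases key' x hx with ⟨e1, e2⟩ | ⟨e1, e2⟩ <;> rcases key' x' hx' with ⟨f1, f2⟩ | ⟨f1, f2⟩ <;>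
      first | linarith | exact absurd (e1.trans f1.symm) hne

/-- a vertex with a private neighbour whose mate has none -/
def isB (G : SimpleGraph V) (S : Finset V) (m : V → V) (u : V) : Prop :=
  isBC G S m u ∧ NP G S (m u)

theorem B_or_C (h : Opt G S m) {u : V} (hu : isBC G S m u) :
    (NP G S (m u) ∧ ∃ x, Pv G S u x) ∨ (NP G S u ∧ ∃ x, Pv G S (m u) x) := by
  obtain ⟨hS, hD, hA⟩ := hu
  by_cases h1 : NP G S u
  · right
    refine ⟨h1, ?_⟩
    rw [← not_NP]
    intro h2
    exact hD ⟨hS, h1, h2⟩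
  · left
    rw [not_NP] at h1
    obtain ⟨x, hx⟩ := h1
    refine ⟨?_, x, hx⟩
    by_contra h2
    rw [not_NP] at h2
    obtain ⟨y, hy⟩ := h2
    refine hA ⟨hS, x, y, ?_, Or.inl hx, Or.inr hy⟩
    rintro rfl
    have := h.mne hS
    exact this (hx.2.2 _ (h.mS hS) hy.2.1)

/-- the C-vertex is a leaf -/
theorem C_leaf (h : Opt G S m) {u x : V} (hS : u ∈ S) (hnp : NP G S u) (hx : Pv G S (m u) x) :
    ∀ t ∈ S, G.Adj u t → t = m u := by
  intro t ht hut
  by_contra hne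
  obtain ⟨s, hs, q1, q2, q3⟩ := h.F1a hS hnp ht hut hne hx.1 hx.2.1
  exact q3 (hx.2.2 s hs q1)

theorem ctr_BC_nn (h : Opt G S m) {s t : V} (hs : isBC G S m s) (hst : G.Adj s t) (hne : t ≠ m s) :
    0 ≤ ctr G S m s t := by
  unfold ctr
  split_ifs with ht
  · rw [tr_nD (by have := hs.2.1; tauto)]
    have : give G S m s t = 0 := by
      unfold give; rw [if_neg (by have := hs.2.2; tauto), if_neg (by have := hs.2.1; tauto)]
    rw [this]
    linarith [give_nn (G := G) (S := S) (m := m) t s]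
  · exact wt_BC_nn hs.2.1 hs.2.2

/-- the B-vertex version -/
theorem pairB (h : Opt G S m) {u x : V} (hu : isBC G S m u) (hnp : NP G S (m u)) (hx : Pv G S u x) :
    3/2 ≤ fin G S m u + fin G S m (m u) := by
  have hS := hu.1
  have hS' := h.mS hS
  have hmm := h.mm hS
  have hu' := (isBC_iff_m h hS).2 hu
  have hleaf : ∀ t ∈ S, G.Adj (m u) t → t = u := by
    have := C_leaf h (x := x) hS' hnp (by rwa [hmm])
    rwa [hmm] at this
  have hux := hx.2.1.symm
  have hmx : m u ≠ x := by rintro rfl; exact hx.1 hS'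
  obtain ⟨b, h2, h3, h4⟩ := nb3'' h.cub (h.madj hS) hux hmx
  obtain ⟨c, d, k1, k2, k3, k4⟩ := slots h hS'
  rw [fin_eq hmx h2 h3 h4, fin_eq k1 k2 k3 k4, ctr_Pv hS hu.2.1 hx]
  rw [hmm] at k1 k2 k4
  have hcS : c ∉ S := fun hh => k1 (hleaf c hh ((k4 c).2 (by simp))).symm
  have hdS : d ∉ S := fun hh => k2 (hleaf d hh ((k4 d).2 (by simp))).symm
  have hub : G.Adj u b := (h4 b).2 (by simp)
  have gb := ctr_BC_nn h hu hub h2.symm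
  have huc : G.Adj (m u) c := (k4 c).2 (by simp)
  have hud : G.Adj (m u) d := (k4 d).2 (by simp)
  have gc := ctr_BC_nn h hu' huc (by rw [hmm]; exact k1.symm)
  have gd := ctr_BC_nn h hu' hud (by rw [hmm]; exact k2.symm)
  by_cases he : exc G S m u
  · obtain ⟨z, hz, hzu, a', b', q1, q2, q3, q4⟩ := he
    have hw : ∀ s, wt G S m z s = 1/2 := fun s => wt_exc q1 q2.2.1 q3.2.1 q2.1 q3.1 q4
    rcases hzu with hzu | hzu
    · rcases (h4 z).1 hzu.symm with rfl | rfl | rfl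
      · exact absurd hS' hz
      · exfalso
        have e1 := hx.2.2 a' q2.1 ((q4 a' q2.1).2 (by simp))
        have e2 := hx.2.2 b' q3.1 ((q4 b' q3.1).2 (by simp))
        exact q1 (e1.trans e2.symm)
      · rw [ctr_ext hz, hw]; linarith
    · rcases (k4 z).1 hzu.symm with rfl | rfl | rfl
      · exact absurd hS hz
      · rw [ctr_ext hz, hw]; linarith
      · rw [ctr_ext hz, hw]; linarith
  · have he' : ¬ exc G S m (m u) := by
      rintro ⟨z, hz, hzu, hh⟩
      rw [hmm] at hzu
      exact he ⟨z, hz, hzu.symm, hh⟩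
    have gc' : 1/6 ≤ ctr G S m (m u) c := by
      rw [ctr_ext hcS]; exact wt_BC_ge h hu'.2.1 hu'.2.2 he' hS' huc.symm
    have gd' : 1/6 ≤ ctr G S m (m u) d := by
      rw [ctr_ext hdS]; exact wt_BC_ge h hu'.2.1 hu'.2.2 he' hS' hud.symm
    have gb' : 1/6 ≤ ctr G S m u b := by
      by_cases hb : b ∈ S
      · rw [ctr_int hb, tr_nD (by have := hu.2.1; tauto)]
        have : give G S m u b = 0 := by
          unfold give; rw [if_neg (by have := hu.2.2; tauto), if_neg (by have := hu.2.1; tauto)]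
        rw [this]
        by_cases hbA : isA G S m b
        · unfold give; rw [if_pos ⟨hbA, hu.2.2⟩]; norm_num
        · by_cases hbD : isD G S m b
          · unfold give; rw [if_neg (by tauto), if_pos ⟨hbD, hu⟩]; norm_num
          · exfalso
            have hbBC : isBC G S m b := ⟨hb, hbD, hbA⟩
            obtain ⟨z, z1, z2, z3, z4⟩ := h.F2 hS hb hub h2.symm
            rcases B_or_C h hbBC with ⟨n1, y, hy⟩ | ⟨n1, y, hy⟩
            · apply he
              have hmb := h.mS hb
              have : G.Adj z (m u) ∧ G.Adj z (m b) := by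
                obtain ⟨s, hs, hzs⟩ := h.dom z z1
                rcases z4 s hs hzs with rfl | rfl
                · obtain ⟨s', e1, e2, e3⟩ := hnp z z1 hzs
                  rcases z4 s' e1 e2 with rfl | rfl <;> tauto
                · obtain ⟨s', e1, e2, e3⟩ := n1 z z1 hzs
                  rcases z4 s' e1 e2 with rfl | rfl <;> tauto
              refine ⟨z, z1, Or.inr this.1, m u, m b, ?_, hu', (isBC_iff_m h hb).2 hbBC, ?_⟩
              · intro e
                have := h.mm hb
                rw [← e, hmm] at this
                exact hub.ne this
              · intro s hs
                constructor
                · exact z4 s hs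
                · rintro (rfl | rfl) <;> tauto
            · have := C_leaf h hb n1 hy u hS hub.symm
              rw [this, h.mm hb] at h2
              exact h2 rfl
      · rw [ctr_ext hb]; exact wt_BC_ge h hu.2.1 hu.2.2 he hS hub.symm
    linarith

theorem pairBC (h : Opt G S m) {u : V} (hu : isBC G S m u) :
    3/2 ≤ fin G S m u + fin G S m (m u) := by
  rcases B_or_C h hu with ⟨n1, x, hx⟩ | ⟨n1, x, hx⟩
  · exact pairB h hu n1 hx
  · have := pairB h (x := x) ((isBC_iff_m h hu.1).2 hu) (by rwa [h.mm hu.1]) hx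
    rw [h.mm hu.1] at this
    linarith

end
end PDom

open Finset
set_option linter.unusedSectionVars false
set_option linter.unusedVariables false
set_option linter.unusedSimpArgs false
namespace PDom
section
variable {V : Type*} [Fintype V] [DecidableEq V] {G : SimpleGraph V} [DecidableRel G.Adj]
  {S : Finset V} {m : V → V}

theorem wD_one (h : Opt G S m) {x s w : V} (hs : isD G S m s) (hxs : G.Adj x s)
    (hno : ∀ t, isD G S m t → G.Adj x t → t = s ∨ t = w) : 5/12 ≤ wt G S m x s := by
  have hp : ∀ w, ¬ payer G S m x w := by
    intro w hw
    obtain ⟨u, q1, q2, q3, q4, q5, q6, q7, q8, q9, q10, q11, q12, q13⟩ := payer_N hw h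
    have a1 := hno _ q11 q7
    have a2 := hno _ q12 q8
    have a3 := hno _ q13 q9
    grind
  obtain ⟨b, c, h1, h2, h3, h4⟩ := nb3' h.cub hxs
  rw [wt_formula h hs h1 h2 h3 h4 hp]
  have := kap_nn (G := G) (S := S) (m := m) b
  have := kap_nn (G := G) (S := S) (m := m) c
  have hbc : ¬ isD G S m b ∨ ¬ isD G S m c := by
    have := hno b
    have := hno c
    grind
  rw [le_div_iff₀ (by linarith)]
  by_cases hb : isD G S m b <;> by_cases hc : isD G S m c <;>
      simp only [hb, hc, kap_D, kap_nD, phi_D, not_false_eq_true] <;>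
      first | tauto | linarith [phi_le (G := G) (S := S) (m := m) b, phi_le (G := G) (S := S) (m := m) c]

theorem tr_DA {u v : V} (hu : isD G S m u) (hv : isA G S m v) : tr G S m u v = 1/4 := by
  have h1 : ¬ isA G S m u := not_A_of_D hu
  have h2 : ¬ isD G S m v := fun hh => not_A_of_D hh hv
  rw [tr_nD (by tauto)]
  unfold give
  rw [if_pos ⟨hv, h1⟩, if_neg (by tauto), if_neg (by rintro ⟨_, h⟩; exact h.2.2 hv)]; norm_num

theorem tr_DB {u v : V} (hu : isD G S m u) (hv : isBC G S m v) : tr G S m u v = -1/6 := by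
  have h1 : ¬ isA G S m u := not_A_of_D hu
  have h2 := hv.2.1
  have h3 := hv.2.2
  rw [tr_nD (by tauto)]
  unfold give
  rw [if_neg (by tauto), if_neg (by tauto), if_neg (by tauto), if_pos ⟨hu, hv⟩]; norm_num

/-- D(3,1) -/
theorem pairD31 (h : Opt G S m) {u v v' : V} (hu : isD G S m u) (hv : v ∈ S) (hv' : v' ∈ S)
    (h1 : m u ≠ v) (h2 : m u ≠ v') (h3 : v ≠ v') (hN : ∀ t, G.Adj u t ↔ t = m u ∨ t = v ∨ t = v') :
    3/2 ≤ fin G S m u + fin G S m (m u) := by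
  have hS := hu.1
  have hS' := h.mS hS
  have hmm := h.mm hS
  have hu' := isD_m h hu
  have huv : G.Adj u v := (hN v).2 (by simp)
  have huv' : G.Adj u v' := (hN v').2 (by simp)
  have hleaf := h.leafm hS hu.2.1 hv huv h1.symm
  obtain ⟨c, d, k1, k2, k3, k4⟩ := slots h hS'
  rw [fin_eq h1 h2 h3 hN, fin_eq k1 k2 k3 k4]
  rw [hmm] at k1 k2 k4
  have hcS : c ∉ S := fun hh => k1 (hleaf c hh ((k4 c).2 (by simp))).symm
  have hdS : d ∉ S := fun hh => k2 (hleaf d hh ((k4 d).2 (by simp))).symm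
  have huc : G.Adj (m u) c := (k4 c).2 (by simp)
  have hud : G.Adj (m u) d := (k4 d).2 (by simp)
  have full : ∀ y, y ∉ S → G.Adj y (m u) → ∀ t, G.Adj y t → t ∈ S ∧ t ≠ u := fun y hy hyu =>
    h.F1b hS hu.2.1 hv huv h1.symm hv' huv' h2.symm h3 hy hyu
  have full3 : ∀ y, y ∉ S → G.Adj y (m u) → ∀ q, ∃ t ∈ S, G.Adj y t ∧ t ≠ m u ∧ t ≠ q := by
    intro y hy hyu q
    obtain ⟨a, b, e1, e2, e3, e4⟩ := nb3' h.cub hyu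
    have f1 := full y hy hyu a ((e4 a).2 (by simp))
    have f2 := full y hy hyu b ((e4 b).2 (by simp))
    by_cases hq : a = q
    · exact ⟨b, f2.1, (e4 b).2 (by simp), e2.symm, by rw [← hq]; exact e3.symm⟩
    · exact ⟨a, f1.1, (e4 a).2 (by simp), e1.symm, hq⟩
  have hA : ∀ v, v ∈ S → G.Adj u v → m u ≠ v → isA G S m v := by
    intro v hv huv hne
    obtain ⟨z, z1, z2, z3, z4⟩ := h.F2 hS hv huv hne.symm
    have hmv := h.mS hv
    have hz : ¬ G.Adj z (m u) := by
      intro hz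
      obtain ⟨t, t1, t2, t3, t4⟩ := full3 z z1 hz (m v)
      have := z4 t t1 t2
      tauto
    have hpv : Pv G S (m v) z := by
      obtain ⟨s, hs, hzs⟩ := h.dom z z1
      have : ∀ s ∈ S, G.Adj z s → s = m v := by
        intro s hs hzs
        rcases z4 s hs hzs with rfl | rfl
        · exact absurd hzs hz
        · rfl
      exact ⟨z1, this s hs hzs ▸ hzs, this⟩
    have hnv : ¬ NP G S v := by
      intro hnp
      have := h.npm hv hnp hS huv.symm (by rintro rfl; rw [h.mm hv] at hne; exact hne rfl)
      exact not_NP.2 ⟨z, hpv⟩ this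
    obtain ⟨y, hy⟩ := not_NP.1 hnv
    refine ⟨hv, y, z, ?_, Or.inl hy, Or.inr hpv⟩
    rintro rfl
    exact h.mne hv (hy.2.2 _ hmv hpv.2.1)
  have vA := hA v hv huv h1
  have vA' := hA v' hv' huv' h2
  have hno : ∀ x, x ∉ S → G.Adj (m u) x → ∀ w, isD G S m w → G.Adj x w → w = m u := by
    intro x hx hux w hw hxw
    by_contra hne
    have hwu : w ≠ u := (full x hx hux.symm w hxw).2
    obtain ⟨z, z1, z2, z3, z4, z5, z6⟩ := h.ex1 (a := x) (b := w) hS hw.1 hwu hne hxw (by tauto) (by tauto)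
    have hmw := h.madj hw.1
    by_cases hz : z ∈ S
    · rcases z6 hz with rfl | rfl | rfl | rfl
      · rcases z5 v hv huv with rfl | rfl | rfl | rfl
        · exact huv.ne rfl
        · exact h1 rfl
        · exact not_A_of_D hw vA
        · exact not_A_of_D (isD_m h hw) vA
      · exact z3 hux
      · exact z2 rfl
      · exact z4 hmw.symm
    · have hzu : ¬ G.Adj z u := by
        intro hzu
        rcases (hN z).1 hzu.symm with rfl | rfl | rfl <;> tauto
      have hzm : ¬ G.Adj z (m u) := by
        intro hzm
        obtain ⟨t, t1, t2, t3, t4⟩ := full3 z hz hzm (m w)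
        rcases z5 t t1 t2 with rfl | rfl | rfl | rfl <;> tauto
      have := hw.2.2
      obtain ⟨s, hs, hzs⟩ := h.dom z hz
      rcases z5 s hs hzs with rfl | rfl | rfl | rfl
      · tauto
      · tauto
      · tauto
      · obtain ⟨s', q1, q2, q3⟩ := this z hz hzs
        rcases z5 s' q1 q2 with rfl | rfl | rfl | rfl <;> tauto
  have gc : 2/3 ≤ ctr G S m (m u) c := by
    rw [ctr_ext hcS]; exact wD_noD h hu' huc.symm (fun t ht hct => hno c hcS huc t ht hct)
  have gd : 2/3 ≤ ctr G S m (m u) d := by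
    rw [ctr_ext hdS]; exact wD_noD h hu' hud.symm (fun t ht hct => hno d hdS hud t ht hct)
  rw [ctr_int hv, ctr_int hv', tr_DA hu vA, tr_DA hu vA']
  linarith

/-- exchange for D(2,1) -/
theorem D21ex (h : Opt G S m) {u v y x w : V} (hu : isD G S m u) (hv : v ∈ S)
    (h1 : m u ≠ v) (hN : ∀ t, G.Adj u t ↔ t = m u ∨ t = v ∨ t = y)
    (hx : x ∉ S) (hux : G.Adj (m u) x) (hw : w ∈ S) (hxw : G.Adj x w) (hwu : w ≠ u) (hwu' : w ≠ m u)
    (hwv : w ≠ v) (hwv' : m w ≠ v) (hnp : NP G S (m w)) :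
    ∃ z, z ∉ S ∧ z ≠ x ∧ ¬ G.Adj z x ∧ ¬ G.Adj z w ∧ G.Adj z (m w) ∧ (G.Adj z u ∨ G.Adj z (m u)) ∧
      ∀ s ∈ S, G.Adj z s → s = u ∨ s = m u ∨ s = m w := by
  have hS := hu.1
  have huv : G.Adj u v := (hN v).2 (by simp)
  obtain ⟨z, z1, z2, z3, z4, z5, z6⟩ := h.ex1 (a := x) (b := w) hS hw hwu hwu' hxw (by tauto) (by tauto)
  have hmw := h.madj hw
  have hz : z ∉ S := by
    intro hz
    rcases z6 hz with rfl | rfl | rfl | rfl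
    · rcases z5 v hv huv with rfl | rfl | rfl | rfl
      · exact huv.ne rfl
      all_goals tauto
    · exact z3 hux
    · exact z2 rfl
    · exact z4 hmw.symm
  have z5' : ∀ s ∈ S, G.Adj z s → s = u ∨ s = m u ∨ s = m w := by
    intro s hs hzs
    rcases z5 s hs hzs with rfl | rfl | rfl | rfl <;> tauto
  have hm : G.Adj z (m u) → G.Adj z (m w) := by
    intro hzm
    obtain ⟨s, hs, q1, q2, q3⟩ := h.F1a hS hu.2.1 hv huv h1.symm hz hzm
    rcases z5' s hs q1 with rfl | rfl | rfl <;> tauto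
  have hm2 : G.Adj z u → G.Adj z (m w) := by
    intro hzm
    obtain ⟨s, hs, q1, q2⟩ := hu.2.1 z hz hzm
    rcases z5' s hs q1 with rfl | rfl | rfl <;> tauto
  have hzw : G.Adj z (m w) := by
    obtain ⟨s, hs, hzs⟩ := h.dom z hz
    rcases z5' s hs hzs with rfl | rfl | rfl <;> tauto
  refine ⟨z, hz, z1, z3, z4, hzw, ?_, z5'⟩
  obtain ⟨s, hs, q1, q2⟩ := hnp z hz hzw
  rcases z5' s hs q1 with rfl | rfl | rfl <;> tauto

/-- D(2,1) with an A-neighbour, non-triangle -/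
theorem D21A_nt (h : Opt G S m) {u v y c d : V} (hu : isD G S m u) (hv : isA G S m v)
    (h1 : m u ≠ v) (h2 : m u ≠ y) (h3 : v ≠ y) (hN : ∀ t, G.Adj u t ↔ t = m u ∨ t = v ∨ t = y)
    (hy : y ∉ S) (hc : c ∉ S) (hd : d ∉ S) (k1 : u ≠ c) (k2 : u ≠ d) (k3 : c ≠ d)
    (k4 : ∀ t, G.Adj (m u) t ↔ t = u ∨ t = c ∨ t = d) (hyc : y ≠ c) (hyd : y ≠ d) :
    5/4 ≤ wt G S m y u + wt G S m c (m u) + wt G S m d (m u) := by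
  have hu' := isD_m h hu
  have huc : G.Adj (m u) c := (k4 c).2 (by simp)
  have hud : G.Adj (m u) d := (k4 d).2 (by simp)
  have huy : G.Adj u y := (hN y).2 (by simp)
  have huv : G.Adj u v := (hN v).2 (by simp)
  have ly := wD_low h hu huy.symm
  have lc := wD_low h hu' huc.symm
  have ld := wD_low h hu' hud.symm
  -- the exchange
  have k40 := k4
  have key : ∀ x x', x ∉ S → G.Adj (m u) x → x ≠ y →
      (∀ t, G.Adj (m u) t ↔ t = u ∨ t = x ∨ t = x') → ∀ w, isD G S m w → G.Adj x w → w ≠ m u →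
      (G.Adj y (m w) ∧ ∀ s ∈ S, G.Adj y s → s = u ∨ s = m w) ∨
      (G.Adj x' (m w) ∧ ∀ s ∈ S, G.Adj x' s → s = m u ∨ s = m w) := by
    intro x x' hx hux hxy k4 w hw hxw hne
    have hxu : ¬ G.Adj x u := fun hh => by
      rcases (hN x).1 hh.symm with rfl | rfl | rfl
      · exact hx hu'.1
      · exact hx hv.1
      · exact hxy rfl
    have hwu : w ≠ u := by rintro rfl; exact hxu hxw
    obtain ⟨z, z1, z2, z3, z4, z5, z6, z7⟩ := D21ex h hu hv.1 h1 hN hx hux hw.1 hxw hwu hne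
      (by rintro rfl; exact not_A_of_D hw hv) (by rintro rfl; exact not_A_of_D (isD_m h hw) hv) hw.2.2
    by_cases hzu : G.Adj z u
    · left
      have : z = y := by
        rcases (hN z).1 hzu.symm with rfl | rfl | rfl
        · exact absurd hu'.1 z1
        · exact absurd hv.1 z1
        · rfl
      subst this
      refine ⟨z5, fun s hs hzs => ?_⟩
      rcases z7 s hs hzs with rfl | rfl | rfl
      · simp
      · exfalso
        rcases (k4 z).1 hzs.symm with rfl | rfl | rfl
        · exact hzu.ne rfl
        · exact z2 rfl
        · rcases (k40 _).1 hzs.symm with e | e | e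
          · exact hzu.ne e
          · exact hyc e
          · exact hyd e
      · simp
    · right
      have hzm : G.Adj z (m u) := by tauto
      have : z = x' := by
        rcases (k4 z).1 hzm.symm with rfl | rfl | rfl
        · exact absurd hu.1 z1
        · exact absurd rfl z2
        · rfl
      subst this
      refine ⟨z5, fun s hs hzs => ?_⟩
      rcases z7 s hs hzs with rfl | rfl | rfl <;> tauto
  have keyc := key c d hc huc hyc.symm k4
  have keyd := key d c hd hud hyd.symm (fun t => by rw [k4]; tauto)
  by_cases dc : ∀ w, isD G S m w → G.Adj c w → w = m u
  · have e1 := wD_noD h hu' huc.symm dc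
    by_cases dd : ∀ w, isD G S m w → G.Adj d w → w = m u
    · have e2 := wD_noD h hu' hud.symm dd
      linarith
    · push Not at dd
      obtain ⟨w, w1, w2, w3⟩ := dd
      rcases keyd w w1 w2 w3 with ⟨q1, q2⟩ | ⟨q1, q2⟩
      · have e2 := wD_two h hu huy.symm q2
        linarith
      · exfalso
        have := dc _ (isD_m h w1) q1
        have := h.mm w1.1
        have := h.mm hu.1
        have hdu : G.Adj d u := by grind
        rcases (hN d).1 hdu.symm with rfl | rfl | rfl
        · exact hd hu'.1
        · exact hd hv.1
        · exact hyd rfl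
  · push Not at dc
    obtain ⟨w, w1, w2, w3⟩ := dc
    rcases keyc w w1 w2 w3 with ⟨q1, q2⟩ | ⟨q1, q2⟩
    · have ey := wD_two h hu huy.symm q2
      by_cases dd : ∀ w, isD G S m w → G.Adj d w → w = m u
      · have e2 := wD_noD h hu' hud.symm dd
        linarith
      · by_cases dx : ∃ w', isD G S m w' ∧ ((G.Adj c w' ∧ w' ≠ m u ∧ ∀ s ∈ S, G.Adj d s → s = m u ∨ s = m w') ∨
            (G.Adj d w' ∧ w' ≠ m u ∧ ∀ s ∈ S, G.Adj c s → s = m u ∨ s = m w'))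
        · obtain ⟨w', w1', ⟨a1, a2, a3⟩ | ⟨a1, a2, a3⟩⟩ := dx
          · have := wD_two h hu' hud.symm a3
            linarith
          · have := wD_two h hu' huc.symm a3
            linarith
        · push Not at dx
          have uniq : ∀ w', isD G S m w' → (G.Adj c w' ∨ G.Adj d w') → w' = m u ∨ w' = w := by
            intro w' hw' hcd
            by_contra hcon
            push Not at hcon
            have : G.Adj y (m w') := by
              rcases hcd with hh | hh
              · rcases keyc w' hw' hh hcon.1 with ⟨b1, b2⟩ | ⟨b1, b2⟩
                · exact b1
                · obtain ⟨s, s1, s2, s3, s4⟩ := (dx w' hw').1 hh hcon.1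
                  have := b2 s s1 s2
                  tauto
              · rcases keyd w' hw' hh hcon.1 with ⟨b1, b2⟩ | ⟨b1, b2⟩
                · exact b1
                · obtain ⟨s, s1, s2, s3, s4⟩ := (dx w' hw').2 hh hcon.1
                  have := b2 s s1 s2
                  tauto
            have e1 := q2 _ (isD_m h hw').1 this
            have e2 := h.mm hw'.1
            have e3 := h.mm w1.1
            have e4 := h.mm hu.1
            grind
          have e1 := wD_one h hu' huc.symm (fun t ht hct => uniq t ht (Or.inl hct))
          have e2 := wD_one h hu' hud.symm (fun t ht hct => uniq t ht (Or.inr hct))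
          linarith
    · have ed := wD_two h hu' hud.symm q2
      have hmw := isD_m h w1
      have hmm := h.mm w1.1
      have : m w ≠ m u := by
        intro e
        have e4 := h.mm hu.1
        have hcu : G.Adj c u := by grind
        rcases (hN c).1 hcu.symm with rfl | rfl | rfl
        · exact hc hu'.1
        · exact hc hv.1
        · exact hyc rfl
      rcases keyd (m w) hmw q1 this with ⟨b1, b2⟩ | ⟨b1, b2⟩
      · have := wD_two h hu huy.symm b2
        linarith
      · have := wD_two h hu' huc.symm b2
        linarith

/-- D(2,1) with an A-neighbour, triangle -/
theorem D21A_t (h : Opt G S m) {u v y c : V} (hu : isD G S m u) (hv : isA G S m v)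
    (h1 : m u ≠ v) (h2 : m u ≠ y) (h3 : v ≠ y) (hN : ∀ t, G.Adj u t ↔ t = m u ∨ t = v ∨ t = y)
    (hy : y ∉ S) (hc : c ∉ S) (k1 : u ≠ c) (k2 : u ≠ y) (k3 : c ≠ y)
    (k4 : ∀ t, G.Adj (m u) t ↔ t = u ∨ t = c ∨ t = y) :
    5/4 ≤ wt G S m y u + wt G S m c (m u) + wt G S m y (m u) := by
  have hu' := isD_m h hu
  have huc : G.Adj (m u) c := (k4 c).2 (by simp)
  have huy' : G.Adj (m u) y := (k4 y).2 (by simp)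
  have huy : G.Adj u y := (hN y).2 (by simp)
  have huv : G.Adj u v := (hN v).2 (by simp)
  have lc := wD_low h hu' huc.symm
  have hcu : ¬ G.Adj c u := fun hh => by
      rcases (hN c).1 hh.symm with rfl | rfl | rfl
      · exact hc hu'.1
      · exact hc hv.1
      · exact k3 rfl
  obtain ⟨w, hw, hyw, hwu, hwu'⟩ := h.F1a hu.1 hu.2.1 hv.1 huv h1.symm hy huy'.symm
  have hYN := nb3''' h.cub huy.symm huy'.symm hyw (h.mne hu.1).symm hwu.symm hwu'.symm
  by_cases wA : isA G S m w
  · have := wD_A h hu huy.symm wA hyw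
    have := wD_A h hu' huy'.symm wA hyw
    linarith
  by_cases wD : isD G S m w
  · obtain ⟨z, z1, z2, z3, z4, z5, z6, z7⟩ := D21ex h hu hv.1 h1 hN hy huy' hw hyw hwu hwu'
      (by rintro rfl; exact not_A_of_D wD hv) (by rintro rfl; exact not_A_of_D (isD_m h wD) hv) wD.2.2
    have hzu : ¬ G.Adj z u := by
      intro hzu
      rcases (hN z).1 hzu.symm with rfl | rfl | rfl
      · exact z1 hu'.1
      · exact z1 hv.1
      · exact z2 rfl
    have hzm : G.Adj z (m u) := by tauto
    have : z = c := by
        rcases (k4 z).1 hzm.symm with rfl | rfl | rfl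
        · exact absurd hu.1 z1
        · rfl
        · exact absurd rfl z2
    subst this
    have e1 := wD_two h hu' huc.symm (t := m w) (fun s hs hzs => by
      rcases z7 s hs hzs with rfl | rfl | rfl <;> tauto)
    have hp : payer G S m y w := ⟨u, hu, wD, hwu, hwu', fun t ht => hYN t,
      Or.inl ⟨v, hv.1, huv.ne', h1.symm, Or.inl huv⟩⟩
    rw [wt_recv hu huy.symm hp hwu.symm h, wt_recv hu' huy'.symm hp hwu'.symm h]
    linarith
  · have e1 := wD_512 h hu huy.symm hw hyw wD
    have e2 := wD_512 h hu' huy'.symm hw hyw wD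
    have e3 := wD_noD h hu' huc.symm (by
      intro t ht hct
      by_contra hne
      obtain ⟨z, z1, z2, z3, z4, z5, z6, z7⟩ := D21ex h hu hv.1 h1 hN hc huc ht.1 hct
        (by rintro rfl; exact hcu hct) hne
        (by rintro rfl; exact not_A_of_D ht hv) (by rintro rfl; exact not_A_of_D (isD_m h ht) hv) ht.2.2
      have hzy : z = y := by
        rcases z6 with hzu | hzu
        · rcases (hN z).1 hzu.symm with rfl | rfl | rfl
          · exact absurd hu'.1 z1
          · exact absurd hv.1 z1
          · rfl
        · rcases (k4 z).1 hzu.symm with rfl | rfl | rfl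
          · exact absurd hu.1 z1
          · exact absurd rfl z2
          · rfl
      subst hzy
      have htD := isD_m h ht
      rcases (hYN _).1 z5 with e | e | e
      · have := h.mm ht.1
        have := h.mm hu.1
        grind
      · have := h.mm ht.1
        have := h.mm hu.1
        have : t = u := by grind
        subst this
        exact hcu hct
      · rw [e] at htD; exact wD htD)
    linarith

/-- D(2,1) with a BC-neighbour -/
theorem D21B (h : Opt G S m) {u v y c d : V} (hu : isD G S m u) (hv : isBC G S m v)
    (h1 : m u ≠ v) (h2 : m u ≠ y) (h3 : v ≠ y) (hN : ∀ t, G.Adj u t ↔ t = m u ∨ t = v ∨ t = y)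
    (hy : y ∉ S) (hc : c ∉ S) (hd : d ∉ S) (k1 : u ≠ c) (k2 : u ≠ d) (k3 : c ≠ d)
    (k4 : ∀ t, G.Adj (m u) t ↔ t = u ∨ t = c ∨ t = d)
    (hcv : G.Adj c (m v)) (hcN : ∀ s ∈ S, G.Adj c s → s = m u ∨ s = m v) :
    5/3 ≤ wt G S m y u + wt G S m c (m u) + wt G S m d (m u) := by
  have hu' := isD_m h hu
  have hmv := h.mS hv.1
  have hvBC := (isBC_iff_m h hv.1).2 hv
  have huc : G.Adj (m u) c := (k4 c).2 (by simp)
  have hud : G.Adj (m u) d := (k4 d).2 (by simp)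
  have huy : G.Adj u y := (hN y).2 (by simp)
  have huv : G.Adj u v := (hN v).2 (by simp)
  have ly := wD_low h hu huy.symm
  have ec := wD_two_noD h hu' huc.symm hcN hvBC.2.1
  have key : ∀ w, isD G S m w → G.Adj d w → w ≠ m u → w ≠ u →
      y ≠ d ∧ G.Adj y (m w) ∧ ∀ s ∈ S, G.Adj y s → s = u ∨ s = m w := by
    intro w hw hdw hwu' hwu
    obtain ⟨z, z1, z2, z3, z4, z5, z6, z7⟩ := D21ex h hu hv.1 h1 hN hd hud hw.1 hdw
        hwu hwu' (by rintro rfl; exact hv.2.1 hw) (by rintro rfl; exact hv.2.1 (isD_m h hw)) hw.2.2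
    have hzc : z ≠ c := by
      rintro rfl
      rcases hcN _ (isD_m h hw).1 z5 with e | e
      · have := h.mm hw.1
        have := h.mm hu.1
        grind
      · exact hvBC.2.1 (e ▸ isD_m h hw)
    have hzm : ¬ G.Adj z (m u) := by
      intro hzu
      rcases (k4 z).1 hzu.symm with rfl | rfl | rfl
      · exact absurd hu.1 z1
      · exact absurd rfl hzc
      · exact z2 rfl
    have hzy : z = y := by
      have hzu : G.Adj z u := by tauto
      rcases (hN z).1 hzu.symm with rfl | rfl | rfl
      · exact absurd hu'.1 z1
      · exact absurd hv.1 z1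
      · rfl
    subst hzy
    refine ⟨z2, z5, fun s hs hzs => ?_⟩
    rcases z7 s hs hzs with rfl | rfl | rfl <;> tauto
  by_cases hyd : y = d
  · subst hyd
    obtain ⟨w, hw, hyw, hwu, hwu'⟩ := h.F1a hu.1 hu.2.1 hv.1 huv h1.symm hy hud.symm
    have wD : ¬ isD G S m w := fun hh => (key w hh hyw hwu' hwu).1 rfl
    have e1 := wD_512 h hu huy.symm hw hyw wD
    have e2 := wD_512 h hu' hud.symm hw hyw wD
    linarith
  · have hdu : ¬ G.Adj d u := fun hh => by
      rcases (hN d).1 hh.symm with rfl | rfl | rfl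
      · exact hd hu'.1
      · exact hd hv.1
      · exact hyd rfl
    by_cases dd : ∀ w, isD G S m w → G.Adj d w → w = m u
    · have e2 := wD_noD h hu' hud.symm dd
      linarith
    · push Not at dd
      obtain ⟨w, w1, w2, w3⟩ := dd
      obtain ⟨q1, q2, q3⟩ := key w w1 w2 w3 (by rintro rfl; exact hdu w2)
      have e1 := wD_two h hu huy.symm q3
      have e2 := wD_one h hu' hud.symm (w := w) (by
        intro t ht hdt
        by_contra hcon
        push Not at hcon
        have hh := (key t ht hdt hcon.1 (by rintro rfl; exact hdu hdt)).2.1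
        have e1 := q3 _ (isD_m h ht).1 hh
        have e2 := h.mm ht.1
        have e3 := h.mm w1.1
        have e4 := h.mm hu.1
        grind)
      linarith

/-- D(2,1), unlinked -/
theorem pairD21 (h : Opt G S m) {u v y : V} (hu : isD G S m u) (hv : v ∈ S) (hvD : ¬ isD G S m v)
    (h1 : m u ≠ v) (h2 : m u ≠ y) (h3 : v ≠ y) (hN : ∀ t, G.Adj u t ↔ t = m u ∨ t = v ∨ t = y)
    (hy : y ∉ S) : 3/2 ≤ fin G S m u + fin G S m (m u) := by
  have hS := hu.1
  have hS' := h.mS hS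
  have hmm := h.mm hS
  have hu' := isD_m h hu
  have huv : G.Adj u v := (hN v).2 (by simp)
  have huy : G.Adj u y := (hN y).2 (by simp)
  have hleaf := h.leafm hS hu.2.1 hv huv h1.symm
  obtain ⟨c, d, k1, k2, k3, k4⟩ := slots h hS'
  rw [fin_eq h1 h2 h3 hN, fin_eq k1 k2 k3 k4]
  rw [hmm] at k1 k2 k4
  have hcS : c ∉ S := fun hh => k1 (hleaf c hh ((k4 c).2 (by simp))).symm
  have hdS : d ∉ S := fun hh => k2 (hleaf d hh ((k4 d).2 (by simp))).symm
  have k4' : ∀ t, G.Adj (m u) t ↔ t = u ∨ t = d ∨ t = c := fun t => by rw [k4]; tauto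
  rw [ctr_int hv, ctr_ext hy, ctr_ext hcS, ctr_ext hdS]
  by_cases hvA : isA G S m v
  · rw [tr_DA hu hvA]
    by_cases hyc : y = c
    · subst hyc
      have := D21A_t h hu hvA h1 h2 h3 hN hy hdS k2 k1 k3.symm k4'
      linarith
    · by_cases hyd : y = d
      · subst hyd
        have := D21A_t h hu hvA h1 h2 h3 hN hy hcS k1 k2 k3 k4
        linarith
      · have := D21A_nt h hu hvA h1 h2 h3 hN hy hcS hdS k1 k2 k3 k4 hyc hyd
        linarith
  · have hvBC : isBC G S m v := ⟨hv, hvD, hvA⟩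
    rw [tr_DB hu hvBC]
    have hmv := h.mS hv
    have hnpv : NP G S (m v) := by
      rcases B_or_C h hvBC with ⟨n1, x, hx⟩ | ⟨n1, x, hx⟩
      · exact n1
      · have := C_leaf h hv n1 hx u hS huv.symm
        rw [this, h.mm hv] at h1
        exact absurd rfl h1
    obtain ⟨z, z1, z2, z3, z4⟩ := h.F2 hS hv huv h1.symm
    have hz : G.Adj z (m u) ∧ G.Adj z (m v) := by
      obtain ⟨s, hs, hzs⟩ := h.dom z z1
      rcases z4 s hs hzs with rfl | rfl
      · obtain ⟨s', e1, e2, e3⟩ := hu.2.2 z z1 hzs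
        rcases z4 s' e1 e2 with rfl | rfl <;> tauto
      · obtain ⟨s', e1, e2, e3⟩ := hnpv z z1 hzs
        rcases z4 s' e1 e2 with rfl | rfl <;> tauto
    rcases (k4 z).1 hz.1.symm with rfl | rfl | rfl
    · exact absurd hS z1
    · have := D21B h hu hvBC h1 h2 h3 hN hy hcS hdS k1 k2 k3 k4 hz.2 z4
      linarith
    · have := D21B h hu hvBC h1 h2 h3 hN hy hdS hcS k2 k1 k3.symm k4' hz.2 z4
      linarith

end
end PDom

open Finset
set_option linter.unusedSectionVars false
set_option linter.unusedVariables false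
set_option linter.unusedSimpArgs false
namespace PDom
section
variable {V : Type*} [Fintype V] [DecidableEq V] {G : SimpleGraph V} [DecidableRel G.Adj]
  {S : Finset V} {m : V → V}


theorem dg_le1 {T : Finset V} {x k : V} (hk : ∀ t ∈ T, G.Adj x t → t = k) : dg G T x ≤ 1 := by
  unfold dg
  rw [← Finset.card_singleton k]
  apply Finset.card_le_card
  intro t; simp only [mem_filter, mem_singleton]; tauto
theorem dg_ge1 {T : Finset V} {x k : V} (hk : k ∈ T) (hx : G.Adj x k) : 1 ≤ dg G T x := by
  unfold dg
  rw [← Finset.card_singleton k]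
  apply Finset.card_le_card
  intro t; simp only [mem_filter, mem_singleton]; rintro rfl; tauto

/-- adjacency indicator -/
def io (G : SimpleGraph V) [DecidableRel G.Adj] (x y : V) : ℕ := if G.Adj x y then 1 else 0
theorem io1 {x y : V} (h : G.Adj x y) : io G x y = 1 := by unfold io; rw [if_pos h]
theorem io0 {x y : V} (h : ¬ G.Adj x y) : io G x y = 0 := by unfold io; rw [if_neg h]

theorem lam2 {B : Finset V} {a b : V} (ha : a ∉ B) (hb : b ∉ B) (hab : a ≠ b) :
    lam G (insert b (insert a B)) = lam G B + 2 * (dg G B a + dg G B b + io G b a) := by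
  rw [lam_insert _ _ (by simp [hb, hab.symm]), lam_insert _ _ ha, dg_insert _ _ _ ha]
  unfold io; ring
theorem lam3 {B : Finset V} {a b c : V} (ha : a ∉ B) (hb : b ∉ B) (hc : c ∉ B) (hab : a ≠ b) (hac : a ≠ c)
    (hbc : b ≠ c) :
    lam G (insert c (insert b (insert a B))) =
      lam G B + 2 * (dg G B a + dg G B b + dg G B c + io G b a + io G c a + io G c b) := by
  rw [lam_insert _ _ (by simp [hc, hac.symm, hbc.symm]), lam2 ha hb hab,
    dg_insert _ _ _ (by simp [hb, hab.symm]), dg_insert _ _ _ ha]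
  unfold io; ring
theorem lam4 {B : Finset V} {a b c d : V} (ha : a ∉ B) (hb : b ∉ B) (hc : c ∉ B) (hd : d ∉ B) (hab : a ≠ b)
    (hac : a ≠ c) (hbc : b ≠ c) (had : a ≠ d) (hbd : b ≠ d) (hcd : c ≠ d) :
    lam G (insert d (insert c (insert b (insert a B)))) =
      lam G B + 2 * (dg G B a + dg G B b + dg G B c + dg G B d + io G b a + io G c a + io G c b
        + io G d a + io G d b + io G d c) := by
  rw [lam_insert _ _ (by simp [hd, had.symm, hbd.symm, hcd.symm]), lam3 ha hb hc hab hac hbc,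
    dg_insert _ _ _ (by simp [hc, hac.symm, hbc.symm]),
    dg_insert _ _ _ (by simp [hb, hab.symm]), dg_insert _ _ _ ha]
  unfold io; ring

/-- the matching on four pairs -/
def sw4 (a b c d e f i j : V) (v : V) : V := if v = a then b else if v = b then a else
  if v = c then d else if v = d then c else if v = e then f else if v = f then e else if v = i then j else i

theorem swm4 {a b c d e f i j : V} (hab : G.Adj a b) (hcd : G.Adj c d) (hef : G.Adj e f) (hij : G.Adj i j)
    (hn : [a, b, c, d, e, f, i, j].Nodup) :
    IsMatchingOn G {a, b, c, d, e, f, i, j} (sw4 a b c d e f i j) := by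
  have := hab.ne
  have := hab.symm
  have := hcd.ne
  have := hcd.symm
  have := hef.ne
  have := hef.symm
  have := hij.ne
  have := hij.symm
  simp only [List.nodup_cons, List.mem_cons, List.not_mem_nil, or_false, not_or] at hn
  intro v hv
  simp only [mem_insert, mem_singleton] at hv
  rcases hv with rfl | rfl | rfl | rfl | rfl | rfl | rfl | rfl <;> simp [sw4, *] <;> grind

namespace Opt
variable (h : Opt G S m)
include h

/-- shift exchange with two pairs -/
theorem lx2 {k l a b : V} (hk : k ∈ S) (hl : l ∈ S) (hlk : l ≠ k) (hlk' : l ≠ m k) (ha : a ∉ S) (hb : b ∉ S)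
    (hab : a ≠ b) (hka : G.Adj k a) (hlb : G.Adj l b)
    (hdom : ∀ x, x ∉ S → x ≠ a → x ≠ b → ¬ G.Adj x k → ¬ G.Adj x l → ¬ G.Adj x a → ¬ G.Adj x b →
      (∀ s ∈ S, G.Adj x s → s = m k ∨ s = m l) → False) :
    dg G (S \ {m k, m l}) (m k) + dg G (S \ {m k, m l}) (m l) + io G (m l) (m k) ≤
    dg G (S \ {m k, m l}) a + dg G (S \ {m k, m l}) b + io G b a := by
  have k1 := h.mS hk
  have k2 := h.mm hk
  have k3 := h.mne hk
  have k4 := h.madj hk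
  have l1 := h.mS hl
  have l2 := h.mm hl
  have l3 := h.mne hl
  have l4 := h.madj hl
  have hn : [k, m k, l, m l].Nodup := by
    simp only [List.nodup_cons, List.mem_cons, List.not_mem_nil, or_false, not_or]
    grind
  have hn' : [k, a, l, b].Nodup := by
    simp only [List.nodup_cons, List.mem_cons, List.not_mem_nil, or_false, not_or]
    grind
  have hx := h.lexch {k, m k, l, m l} {k, a, l, b} (sw2 k a l b) (by simp [*])
    (swm2 hka hlb (by grind) (by grind) (by grind) hab) (by
      simp only [mem_insert, mem_singleton]; rintro t (rfl | rfl | rfl | rfl) <;> tauto)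
    (by rw [card_four hn, card_four hn']) (by
      intro x x1 x2 x3 x4
      simp only [mem_insert, mem_singleton, not_or, forall_eq_or_imp, forall_eq] at x1 x2 x3 x4
      obtain ⟨p1, p2, p3, p4⟩ := x1
      obtain ⟨q1, q2, q3, q4⟩ := x2
      by_cases hxS : x ∈ S
      · rcases x4 hxS with rfl | rfl | rfl | rfl
        · exact p1 rfl
        · exact q1 k4.symm
        · exact p3 rfl
        · exact q3 l4.symm
      · refine hdom x hxS p2 p4 q1 q3 q2 q4 (fun s hs hxs => ?_)
        rcases x3 s hs hxs with rfl | rfl | rfl | rfl <;> tauto)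
  have e1 : S = insert (m l) (insert (m k) (S \ {m k, m l})) := by
    ext t; simp only [mem_sdiff, mem_insert, mem_singleton]; grind
  have e2 : (S \ {k, m k, l, m l}) ∪ {k, a, l, b} = insert b (insert a (S \ {m k, m l})) := by
    ext t; simp only [mem_sdiff, mem_insert, mem_singleton, mem_union]; grind
  rw [e2, lam2 (by simp [ha]) (by simp [hb]) hab] at hx
  conv at hx => lhs; rw [e1, lam2 (by simp) (by simp) (by grind)]
  omega

/-- shift exchange with three pairs -/
theorem lx3 {k l n a b c : V} (hk : k ∈ S) (hl : l ∈ S) (hn : n ∈ S) (hlk : l ≠ k) (hlk' : l ≠ m k)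
    (hnk : n ≠ k) (hnk' : n ≠ m k) (hnl : n ≠ l) (hnl' : n ≠ m l)
    (ha : a ∉ S) (hb : b ∉ S) (hc : c ∉ S)
    (hab : a ≠ b) (hac : a ≠ c) (hbc : b ≠ c) (hka : G.Adj k a) (hlb : G.Adj l b) (hnc : G.Adj n c)
    (hdom : ∀ x, x ∉ S → x ≠ a → x ≠ b → x ≠ c → ¬ G.Adj x k → ¬ G.Adj x l → ¬ G.Adj x n →
      ¬ G.Adj x a → ¬ G.Adj x b → ¬ G.Adj x c →
      (∀ s ∈ S, G.Adj x s → s = m k ∨ s = m l ∨ s = m n) → False) :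
    dg G (S \ {m k, m l, m n}) (m k) + dg G (S \ {m k, m l, m n}) (m l) + dg G (S \ {m k, m l, m n}) (m n)
      + io G (m l) (m k) + io G (m n) (m k) + io G (m n) (m l) ≤
    dg G (S \ {m k, m l, m n}) a + dg G (S \ {m k, m l, m n}) b + dg G (S \ {m k, m l, m n}) c
      + io G b a + io G c a + io G c b := by
  have k1 := h.mS hk
  have k2 := h.mm hk
  have k3 := h.mne hk
  have k4 := h.madj hk
  have l1 := h.mS hl
  have l2 := h.mm hl
  have l3 := h.mne hl
  have l4 := h.madj hl
  have n1 := h.mS hn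
  have n2 := h.mm hn
  have n3 := h.mne hn
  have n4 := h.madj hn
  have hno : [k, m k, l, m l, n, m n].Nodup := by
    simp only [List.nodup_cons, List.mem_cons, List.not_mem_nil, or_false, not_or]
    grind
  have hno' : [k, a, l, b, n, c].Nodup := by
    simp only [List.nodup_cons, List.mem_cons, List.not_mem_nil, or_false, not_or]
    grind
  have hx := h.lexch {k, m k, l, m l, n, m n} {k, a, l, b, n, c} (sw3 k a l b n c) (by simp [*])
    (swm3 hka hlb hnc hno') (by
      simp only [mem_insert, mem_singleton]; rintro t (rfl | rfl | rfl | rfl | rfl | rfl) <;> tauto)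
    (by rw [card_six hno, card_six hno']) (by
      intro x x1 x2 x3 x4
      simp only [mem_insert, mem_singleton, not_or, forall_eq_or_imp, forall_eq] at x1 x2 x3 x4
      obtain ⟨p1, p2, p3, p4, p5, p6⟩ := x1
      obtain ⟨q1, q2, q3, q4, q5, q6⟩ := x2
      by_cases hxS : x ∈ S
      · rcases x4 hxS with rfl | rfl | rfl | rfl | rfl | rfl
        · exact p1 rfl
        · exact q1 k4.symm
        · exact p3 rfl
        · exact q3 l4.symm
        · exact p5 rfl
        · exact q5 n4.symm
      · refine hdom x hxS p2 p4 p6 q1 q3 q5 q2 q4 q6 (fun s hs hxs => ?_)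
        rcases x3 s hs hxs with rfl | rfl | rfl | rfl | rfl | rfl <;> tauto)
  have e1 : S = insert (m n) (insert (m l) (insert (m k) (S \ {m k, m l, m n}))) := by
    ext t; simp only [mem_sdiff, mem_insert, mem_singleton]; grind
  have e2 : (S \ {k, m k, l, m l, n, m n}) ∪ {k, a, l, b, n, c} =
      insert c (insert b (insert a (S \ {m k, m l, m n}))) := by
    ext t; simp only [mem_sdiff, mem_insert, mem_singleton, mem_union]; grind
  rw [e2, lam3 (by simp [ha]) (by simp [hb]) (by simp [hc]) hab hac hbc] at hx
  conv at hx => lhs; rw [e1, lam3 (by simp) (by simp) (by simp) (by grind) (by grind) (by grind)]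
  omega

set_option maxHeartbeats 1000000 in
/-- shift exchange with four pairs -/
theorem lx4 {k l n o a b c d : V} (hk : k ∈ S) (hl : l ∈ S) (hn : n ∈ S) (ho : o ∈ S)
    (hno : [k, m k, l, m l, n, m n, o, m o].Nodup)
    (ha : a ∉ S) (hb : b ∉ S) (hc : c ∉ S) (hd : d ∉ S) (hn4 : [a, b, c, d].Nodup)
    (hka : G.Adj k a) (hlb : G.Adj l b) (hnc : G.Adj n c) (hod : G.Adj o d)
    (hdom : ∀ x, x ∉ S → x ≠ a → x ≠ b → x ≠ c → x ≠ d → ¬ G.Adj x k → ¬ G.Adj x l → ¬ G.Adj x n →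
      ¬ G.Adj x o → ¬ G.Adj x a → ¬ G.Adj x b → ¬ G.Adj x c → ¬ G.Adj x d → 
      (∀ s ∈ S, G.Adj x s → s = m k ∨ s = m l ∨ s = m n ∨ s = m o) → False) :
    dg G (S \ {m k, m l, m n, m o}) (m k) + dg G (S \ {m k, m l, m n, m o}) (m l)
      + dg G (S \ {m k, m l, m n, m o}) (m n) + dg G (S \ {m k, m l, m n, m o}) (m o)
      + io G (m l) (m k) + io G (m n) (m k) + io G (m n) (m l)
      + io G (m o) (m k) + io G (m o) (m l) + io G (m o) (m n) ≤
    dg G (S \ {m k, m l, m n, m o}) a + dg G (S \ {m k, m l, m n, m o}) b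
      + dg G (S \ {m k, m l, m n, m o}) c + dg G (S \ {m k, m l, m n, m o}) d
      + io G b a + io G c a + io G c b + io G d a + io G d b + io G d c := by
  have k1 := h.mS hk
  have k2 := h.mm hk
  have k4 := h.madj hk
  have l1 := h.mS hl
  have l2 := h.mm hl
  have l4 := h.madj hl
  have n1 := h.mS hn
  have n2 := h.mm hn
  have n4 := h.madj hn
  have o1 := h.mS ho
  have o2 := h.mm ho
  have o4 := h.madj ho
  have hno0 := hno
  simp only [List.nodup_cons, List.mem_cons, List.not_mem_nil, or_false, not_or] at hno hn4
  have hno' : [k, a, l, b, n, c, o, d].Nodup := by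
    clear hdom hno0
    simp only [List.nodup_cons, List.mem_cons, List.not_mem_nil, or_false, not_or]
    have q : ∀ s ∈ S, ∀ t, t ∉ S → s ≠ t := fun s hs t ht e => ht (e ▸ hs)
    refine ⟨⟨?_, ?_, ?_, ?_, ?_, ?_, ?_⟩, ⟨?_, ?_, ?_, ?_, ?_, ?_⟩, ⟨?_, ?_, ?_, ?_, ?_⟩, ⟨?_, ?_, ?_, ?_⟩,
      ⟨?_, ?_, ?_⟩, ⟨?_, ?_⟩, ?_, ?_, ?_⟩ <;>
    first | exact q _ (by assumption) _ (by assumption) | exact (q _ (by assumption) _ (by assumption)).symm | tauto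
  have hx := h.lexch {k, m k, l, m l, n, m n, o, m o} {k, a, l, b, n, c, o, d} (sw4 k a l b n c o d)
    (by simp [*])
    (swm4 hka hlb hnc hod hno') (by
      simp only [mem_insert, mem_singleton]; rintro t (rfl | rfl | rfl | rfl | rfl | rfl | rfl | rfl) <;> tauto)
    (by rw [card_eight hno0, card_eight hno']) (by
      intro x x1 x2 x3 x4
      simp only [mem_insert, mem_singleton, not_or, forall_eq_or_imp, forall_eq] at x1 x2 x3 x4
      obtain ⟨p1, p2, p3, p4, p5, p6, p7, p8⟩ := x1
      obtain ⟨q1, q2, q3, q4, q5, q6, q7, q8⟩ := x2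
      by_cases hxS : x ∈ S
      · rcases x4 hxS with rfl | rfl | rfl | rfl | rfl | rfl | rfl | rfl
        · exact p1 rfl
        · exact q1 k4.symm
        · exact p3 rfl
        · exact q3 l4.symm
        · exact p5 rfl
        · exact q5 n4.symm
        · exact p7 rfl
        · exact q7 o4.symm
      · refine hdom x hxS p2 p4 p6 p8 q1 q3 q5 q7 q2 q4 q6 q8 (fun s hs hxs => ?_)
        rcases x3 s hs hxs with rfl | rfl | rfl | rfl | rfl | rfl | rfl | rfl <;> tauto)
  have e1 : S = insert (m o) (insert (m n) (insert (m l) (insert (m k) (S \ {m k, m l, m n, m o})))) := by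
    clear hdom hno0 hx hno'
    ext t; simp only [mem_sdiff, mem_insert, mem_singleton]; grind
  have e2 : (S \ {k, m k, l, m l, n, m n, o, m o}) ∪ {k, a, l, b, n, c, o, d} =
      insert d (insert c (insert b (insert a (S \ {m k, m l, m n, m o})))) := by
    clear hdom hno0 hx hno' e1
    ext t; simp only [mem_sdiff, mem_insert, mem_singleton, mem_union]; grind
  rw [e2, lam4 (by simp [ha]) (by simp [hb]) (by simp [hc]) (by simp [hd]) (by tauto) (by tauto) (by tauto)
    (by tauto) (by tauto) (by tauto)] at hx
  conv at hx => lhs; rw [e1, lam4 (by simp) (by simp) (by simp) (by simp) (by tauto) (by tauto) (by tauto)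
    (by tauto) (by tauto) (by tauto)]
  omega

end Opt
end
end PDom

open Finset
set_option linter.unusedSectionVars false
set_option linter.unusedVariables false
set_option linter.unusedSimpArgs false
namespace PDom
section
variable {V : Type*} [Fintype V] [DecidableEq V] {G : SimpleGraph V} [DecidableRel G.Adj]
  {S : Finset V} {m : V → V}


/-- the local structure of two linked D-pairs -/
structure Lnk (G : SimpleGraph V) (S : Finset V) (m : V → V) (u v z o1 o2 o3 o4 : V) : Prop where
  uD : isD G S m u
  vD : isD G S m v
  hvm : v ≠ m u
  zS : z ∉ S
  zN : ∀ s ∈ S, G.Adj z s ↔ s = m u ∨ s = m v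
  Nu : ∀ t, G.Adj u t ↔ t = m u ∨ t = v ∨ t = o2
  Nmu : ∀ t, G.Adj (m u) t ↔ t = u ∨ t = z ∨ t = o1
  Nv : ∀ t, G.Adj v t ↔ t = m v ∨ t = u ∨ t = o3
  Nmv : ∀ t, G.Adj (m v) t ↔ t = v ∨ t = z ∨ t = o4
  s1 : o1 ∉ S
  s2 : o2 ∉ S
  s3 : o3 ∉ S
  s4 : o4 ∉ S
  z1 : o1 ≠ z
  z4 : o4 ≠ z

/-- derived facts -/
structure LF (G : SimpleGraph V) (S : Finset V) (m : V → V) (u v z o1 o2 o3 o4 : V) : Prop where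
  a1 : u ∈ S
  a2 : m u ∈ S
  a3 : v ∈ S
  a4 : m v ∈ S
  b1 : m (m u) = u
  b2 : m (m v) = v
  c1 : u ≠ m u
  c2 : v ≠ m v
  c3 : u ≠ v
  c4 : u ≠ m v
  c5 : m u ≠ v
  c6 : m u ≠ m v
  x1 : ∀ x, G.Adj x u ↔ x = m u ∨ x = v ∨ x = o2
  x2 : ∀ x, G.Adj x (m u) ↔ x = u ∨ x = z ∨ x = o1
  x3 : ∀ x, G.Adj x v ↔ x = m v ∨ x = u ∨ x = o3
  x4 : ∀ x, G.Adj x (m v) ↔ x = v ∨ x = z ∨ x = o4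
  z2 : o2 ≠ z
  z3 : o3 ≠ z
  umD : isD G S m (m u)
  vmD : isD G S m (m v)

variable {u v z o1 o2 o3 o4 : V}

theorem Lnk.symm (h : Opt G S m) (hL : Lnk G S m u v z o1 o2 o3 o4) : Lnk G S m v u z o4 o3 o2 o1 where
  uD := hL.vD
  vD := hL.uD
  hvm := by
    intro hh
    have := hL.hvm
    rw [hh, h.mm hL.vD.1] at this
    exact this rfl
  zS := hL.zS
  zN := fun s hs => (hL.zN s hs).trans or_comm
  Nu := hL.Nv
  Nmu := hL.Nmv
  Nv := hL.Nu
  Nmv := hL.Nmu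
  s1 := hL.s4
  s2 := hL.s3
  s3 := hL.s2
  s4 := hL.s1
  z1 := hL.z4
  z4 := hL.z1

theorem Lnk.f (h : Opt G S m) (hL : Lnk G S m u v z o1 o2 o3 o4) : LF G S m u v z o1 o2 o3 o4 := by
  have a1 := hL.uD.1
  have a3 := hL.vD.1
  have a2 := h.mS a1
  have a4 := h.mS a3
  have b1 := h.mm a1
  have b2 := h.mm a3
  have c1 := (h.mne a1).symm
  have c2 := (h.mne a3).symm
  have uv : G.Adj u v := (hL.Nu v).2 (by simp)
  have c5 := hL.hvm.symm
  have c4 : u ≠ m v := (hL.symm h).hvm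
  have c6 : m u ≠ m v := by intro hh; apply uv.ne; rw [← b1, hh, b2]
  refine ⟨a1, a2, a3, a4, b1, b2, c1, c2, uv.ne, c4, c5, c6, fun x => (G.adj_comm _ _).trans (hL.Nu x),
    fun x => (G.adj_comm _ _).trans (hL.Nmu x), fun x => (G.adj_comm _ _).trans (hL.Nv x),
    fun x => (G.adj_comm _ _).trans (hL.Nmv x), ?_, ?_, isD_m h hL.uD, isD_m h hL.vD⟩
  · rintro rfl
    have := (hL.zN u a1).1 ((hL.Nu o2).2 (by simp)).symm
    tauto
  · rintro rfl
    have := (hL.zN v a3).1 ((hL.Nv o3).2 (by simp)).symm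
    tauto

theorem Lnk.e1 (h : Opt G S m) (hL : Lnk G S m u v z o1 o2 o3 o4) {w : V} (hw : w ∈ S) (w1 : w ≠ u) (w2 : w ≠ m u)
    (w3 : w ≠ v) (w4 : w ≠ m v) (hnp : NP G S (m w)) (hxw : G.Adj o1 w) :
    o2 ≠ o1 ∧ ¬ G.Adj o2 o1 ∧ o2 ≠ o3 ∧ o2 ≠ o4 ∧ ¬ G.Adj o2 w ∧ ∀ s ∈ S, G.Adj o2 s ↔ s = u ∨ s = m w := by
  obtain ⟨a1, a2, a3, a4, b1, b2, c1, c2, c3, c4, c5, c6, x1, x2, x3, x4, z2, z3, umD, vmD⟩ := hL.f h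
  obtain ⟨uD, vD, hvm, zS, zN, Nu, Nmu, Nv, Nmv, s1, s2, s3, s4, z1, z4⟩ := hL
  have mw := h.mS hw
  have mww := h.mm hw
  have wa := h.madj hw
  obtain ⟨x, p1, p2, p3, p4, q1, q2, q3, q4, r1, r2⟩ := h.ex2 (a := v) (b := m v) (a' := o1) (b' := w) a1 a3 hw
    c3.symm hvm w1 w2 w3 w4 (h.madj a3) hxw (by rintro rfl; tauto) w3.symm (by rintro rfl; tauto) w4.symm
    (by tauto) (by tauto) (by tauto) (by tauto)
  have hxS : x ∉ S := by
    intro hx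
    rcases r2 hx with rfl | rfl | rfl | rfl | rfl | rfl
    · exact q1 ((Nu _).2 (by simp))
    · exact q3 ((Nmu _).2 (by simp))
    · exact p1 rfl
    · exact p2 rfl
    · exact p4 rfl
    · exact q4 wa.symm
  have n2 : ¬ G.Adj x (m u) := by
    intro hx
    rcases (x2 x).1 hx with rfl | rfl | rfl
    · exact hxS a1
    · exact q2 ((zN _ a4).2 (by simp))
    · exact p3 rfl
  have hN : ∀ s ∈ S, G.Adj x s → s = u ∨ s = m w := by
    intro s hs hxs
    rcases r1 s hs hxs with rfl | rfl | rfl | rfl | rfl | rfl <;> first | exact absurd hxs (by assumption) | simp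
  have hxu : G.Adj x u := by
    obtain ⟨s, hs, hxs⟩ := h.dom x hxS
    rcases hN s hs hxs with rfl | rfl
    · exact hxs
    · obtain ⟨t, ht, k1, k2⟩ := hnp x hxS hxs
      rcases hN t ht k1 with rfl | rfl
      · exact k1
      · exact absurd rfl k2
  have hxw' : G.Adj x (m w) := by
    obtain ⟨t, ht, k1, k2⟩ := uD.2.1 x hxS hxu
    rcases hN t ht k1 with rfl | rfl
    · exact absurd rfl k2
    · exact k1
  have hx2 : x = o2 := by
    rcases (x1 x).1 hxu with rfl | rfl | rfl
    · exact absurd a2 hxS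
    · exact absurd a3 hxS
    · rfl
  subst hx2
  refine ⟨p3, q3, ?_, ?_, q4, fun s hs => ⟨hN s hs, ?_⟩⟩
  · rintro rfl; exact q1 ((x3 _).2 (by simp))
  · rintro rfl; exact q2 ((x4 _).2 (by simp))
  · rintro (rfl | rfl) <;> assumption

theorem Lnk.e2 (h : Opt G S m) (hL : Lnk G S m u v z o1 o2 o3 o4) {w : V} (hw : w ∈ S) (w1 : w ≠ u) (w2 : w ≠ m u)
    (w3 : w ≠ v) (w4 : w ≠ m v) (hnp : NP G S (m w)) (hxw : G.Adj o2 w) :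
    ∃ x, x ∉ S ∧ (x = o1 ∨ x = o3) ∧ x ≠ o2 ∧ x ≠ o4 ∧ ¬ G.Adj x z ∧ ¬ G.Adj x o2 ∧ ¬ G.Adj x w ∧
      ∀ s ∈ S, G.Adj x s → s = m u ∨ s = v ∨ s = m w := by
  obtain ⟨a1, a2, a3, a4, b1, b2, c1, c2, c3, c4, c5, c6, x1, x2, x3, x4, z2, z3, umD, vmD⟩ := hL.f h
  obtain ⟨uD, vD, hvm, zS, zN, Nu, Nmu, Nv, Nmv, s1, s2, s3, s4, z1, z4⟩ := hL
  have mw := h.mS hw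
  have mww := h.mm hw
  have wa := h.madj hw
  obtain ⟨x, p1, p2, p3, p4, q1, q2, q3, q4, r1, r2⟩ := h.ex2 (a := m v) (b := z) (a' := o2) (b' := w) a1 a3 hw
    c3.symm hvm w1 w2 w3 w4 ((Nmv z).2 (by simp)) hxw (by rintro rfl; tauto) w4.symm z2.symm (by rintro rfl; tauto)
    (by tauto) (by tauto) (by tauto) (by tauto)
  have hxS : x ∉ S := by
    intro hx
    rcases r2 hx with rfl | rfl | rfl | rfl | rfl | rfl
    · exact q3 ((Nu _).2 (by simp))
    · exact q2 ((Nmu _).2 (by simp))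
    · exact q1 ((Nv _).2 (by simp))
    · exact p1 rfl
    · exact p4 rfl
    · exact q4 wa.symm
  have n2 : ¬ G.Adj x u := by
    intro hx
    rcases (x1 x).1 hx with rfl | rfl | rfl
    · exact hxS a2
    · exact hxS a3
    · exact p3 rfl
  have hN : ∀ s ∈ S, G.Adj x s → s = m u ∨ s = v ∨ s = m w := by
    intro s hs hxs
    rcases r1 s hs hxs with rfl | rfl | rfl | rfl | rfl | rfl <;> first | exact absurd hxs (by assumption) | simp
  refine ⟨x, hxS, ?_, p3, ?_, q2, q3, q4, hN⟩
  · have : G.Adj x (m u) ∨ G.Adj x v := by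
      obtain ⟨s, hs, hxs⟩ := h.dom x hxS
      rcases hN s hs hxs with rfl | rfl | rfl
      · exact Or.inl hxs
      · exact Or.inr hxs
      · obtain ⟨t, ht, k1, k2⟩ := hnp x hxS hxs
        rcases hN t ht k1 with rfl | rfl | rfl
        · exact Or.inl k1
        · exact Or.inr k1
        · exact absurd rfl k2
    rcases this with hx | hx
    · rcases (x2 x).1 hx with rfl | rfl | rfl
      · exact absurd a1 hxS
      · exact absurd ((x4 _).2 (by simp)) q1
      · exact Or.inl rfl
    · rcases (x3 x).1 hx with rfl | rfl | rfl
      · exact absurd a4 hxS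
      · exact absurd a1 hxS
      · exact Or.inr rfl
  · rintro rfl; exact q1 ((x4 _).2 (by simp))

end
end PDom

open Finset
set_option linter.unusedSectionVars false
set_option linter.unusedVariables false
set_option linter.unusedSimpArgs false
namespace PDom
section
variable {V : Type*} [Fintype V] [DecidableEq V] {G : SimpleGraph V} [DecidableRel G.Adj]
  {S : Finset V} {m : V → V}


theorem dg_ge2 {T : Finset V} {x k l : V} (hk : k ∈ T) (hl : l ∈ T) (hkl : k ≠ l) (hx : G.Adj x k) (hx' : G.Adj x l) :
    2 ≤ dg G T x := by
  unfold dg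
  rw [← Finset.card_pair hkl]
  apply Finset.card_le_card
  intro t; simp only [mem_filter, mem_insert, mem_singleton]; rintro (rfl | rfl) <;> tauto
theorem dg_le2 {T : Finset V} {x k l : V} (hk : ∀ t ∈ T, G.Adj x t → t = k ∨ t = l) : dg G T x ≤ 2 := by
  unfold dg
  refine le_trans (Finset.card_le_card (t := {k, l}) ?_) (Finset.card_le_two)
  intro t; simp only [mem_filter, mem_insert, mem_singleton]; intro ht; exact hk t ht.1 ht.2

theorem mne1 (h : Opt G S m) {w u : V} (hw : w ∈ S) (hne : w ≠ m u) : m w ≠ u := by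
  rintro rfl; exact hne (h.mm hw).symm
theorem mne2 (h : Opt G S m) {w u : V} (hw : w ∈ S) (hu : u ∈ S) (hne : w ≠ u) : m w ≠ m u := by
  intro hh; apply hne; rw [← h.mm hw, hh, h.mm hu]

variable {u v z o1 o2 o3 o4 : V}

theorem Lnk.lemM (h : Opt G S m) (hL : Lnk G S m u v z o1 o2 o3 o4) {w : V} (hw : w ∈ S) (w1 : w ≠ u) (w2 : w ≠ m u)
    (w3 : w ≠ v) (w4 : w ≠ m v) (hnp : NP G S (m w)) (h3w : G.Adj o3 w) (h34 : o3 ≠ o4)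
    (h34' : ¬ G.Adj o3 o4) (hN3 : ∀ s ∈ S, G.Adj o3 s → s = v ∨ s = w)
    (hN4 : ∀ s ∈ S, G.Adj o4 s → s = m v ∨ s = v ∨ s = m w) : False := by
  obtain ⟨a1, a2, a3, a4, b1, b2, c1, c2, c3, c4, c5, c6, x1, x2, x3, x4, z2, z3, umD, vmD⟩ := hL.f h
  obtain ⟨uD, vD, hvm, zS, zN, Nu, Nmu, Nv, Nmv, s1, s2, s3, s4, z1, z4⟩ := hL
  have mw := h.mS hw
  have mww := h.mm hw
  have wa := h.madj hw
  have k1 := mne1 h hw w4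
  have k2 := mne2 h hw a3 w3
  have hx := h.lx2 (k := m v) (l := w) (a := o4) (b := o3) a4 hw w4 (by rw [b2]; exact w3) s4 s3 h34.symm
    ((Nmv _).2 (by simp)) h3w.symm (by
      rw [b2]
      intro x xS p1 p2 q1 q2 q3 q4 r
      have : ∀ s ∈ S, G.Adj x s → s = m w := by
        intro s hs hxs
        rcases r s hs hxs with rfl | rfl
        · rcases (x3 x).1 hxs with rfl | rfl | rfl
          · exact absurd a4 xS
          · exact absurd a1 xS
          · exact absurd rfl p2
        · rfl
      obtain ⟨s, hs, hxs⟩ := h.dom x xS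
      have e := this s hs hxs
      subst e
      obtain ⟨t, ht, k1, k2⟩ := hnp x xS hxs
      exact k2 (this t ht k1))
  rw [b2, io0 h34'] at hx
  have d1 : 2 ≤ dg G (S \ {v, m w}) v := dg_ge2 (k := m v) (l := u) (by simp [a4, c2.symm, k2.symm])
    (by simp only [mem_sdiff, mem_insert, mem_singleton, not_or]; exact ⟨a1, c3, fun e => w2 (by rw [e, mww])⟩) c4.symm ((Nv _).2 (by simp)) ((Nv _).2 (by simp))
  have d2 : 1 ≤ dg G (S \ {v, m w}) (m w) := dg_ge1 (k := w) (by simp [hw, w3, (h.mne hw).symm]) wa.symm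
  have d3 : dg G (S \ {v, m w}) o4 ≤ 1 := dg_le1 (k := m v) (by
    simp only [mem_sdiff, mem_insert, mem_singleton, not_or]
    intro t ht hadj
    rcases hN4 t ht.1 hadj with e | e | e
    · exact e
    · exact absurd e ht.2.1
    · exact absurd e ht.2.2)
  have d4 : dg G (S \ {v, m w}) o3 ≤ 1 := dg_le1 (k := w) (by
    simp only [mem_sdiff, mem_insert, mem_singleton, not_or]
    intro t ht hadj
    rcases hN3 t ht.1 hadj with e | e
    · exact absurd e ht.2.1
    · exact e)
  omega

theorem Lnk.ladder1 (h : Opt G S m) (hL : Lnk G S m u v z o1 o2 o3 o4) {w : V} (hw : isD G S m w) (w1 : w ≠ u)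
    (w2 : w ≠ m u) (w3 : w ≠ v) (w4 : w ≠ m v) (hN2 : ∀ s ∈ S, G.Adj o2 s ↔ s = u ∨ s = m w)
    (hN3 : ∀ s ∈ S, G.Adj o3 s ↔ s = v ∨ s = w) (hin : G.Adj o2 o3 ∨ G.Adj o2 z) : False := by
  have hL' := hL
  obtain ⟨a1, a2, a3, a4, b1, b2, c1, c2, c3, c4, c5, c6, x1, x2, x3, x4, z2, z3, umD, vmD⟩ := hL.f h
  obtain ⟨uD, vD, hvm, zS, zN, Nu, Nmu, Nv, Nmv, s1, s2, s3, s4, z1, z4⟩ := hL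
  have mw := h.mS hw.1
  have mww := h.mm hw.1
  have wa := h.madj hw.1
  have h3w : G.Adj o3 w := (hN3 w hw.1).2 (by simp)
  obtain ⟨x, p1, p2, p3, p4, q1, q2, q3, q4, r1, r2⟩ := h.ex2 (a := m u) (b := z) (a' := o3) (b' := w) a1 a3 hw.1
    c3.symm hvm w1 w2 w3 w4 ((Nmu z).2 (by simp)) h3w (by rintro rfl; exact s3 a2) w2.symm z3.symm
    (by rintro rfl; exact zS hw.1)
    (by tauto) (fun e => absurd e zS) (fun e => absurd e s3) (by tauto)
  have hxS : x ∉ S := by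
    intro hx
    rcases r2 hx with rfl | rfl | rfl | rfl | rfl | rfl
    · exact q1 ((Nu _).2 (by simp))
    · exact p1 rfl
    · exact q3 ((Nv _).2 (by simp))
    · exact q2 ((Nmv _).2 (by simp))
    · exact p4 rfl
    · exact q4 wa.symm
  have hN : ∀ s ∈ S, G.Adj x s → s = m v ∨ s = m w := by
    intro s hs hxs
    rcases r1 s hs hxs with rfl | rfl | rfl | rfl | rfl | rfl
    · rcases (x1 x).1 hxs with rfl | rfl | rfl
      · exact absurd a2 hxS
      · exact absurd a3 hxS
      · rcases hin with e | e
        · exact absurd e q3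
        · exact absurd e q2
    · exact absurd hxs q1
    · rcases (x3 x).1 hxs with rfl | rfl | rfl
      · exact absurd a4 hxS
      · exact absurd a1 hxS
      · exact absurd rfl p3
    · exact Or.inl rfl
    · exact absurd hxs q4
    · exact Or.inr rfl
  have hxv : G.Adj x (m v) := by
    obtain ⟨s, hs, hxs⟩ := h.dom x hxS
    rcases hN s hs hxs with rfl | rfl
    · exact hxs
    · obtain ⟨t, ht, k1, k2⟩ := hw.2.2 x hxS hxs
      rcases hN t ht k1 with rfl | rfl
      · exact k1
      · exact absurd rfl k2
  have hx4 : x = o4 := by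
    rcases (x4 x).1 hxv with rfl | rfl | rfl
    · exact absurd a3 hxS
    · exact absurd rfl p2
    · rfl
  subst hx4
  exact hL'.lemM h hw.1 w1 w2 w3 w4 hw.2.2 h3w p3.symm (fun e => q3 e.symm) (fun s hs => (hN3 s hs).1)
    (fun s hs hh => by rcases hN s hs hh with e | e <;> simp [e])

theorem Lnk.ladder (h : Opt G S m) (hL : Lnk G S m u v z o1 o2 o3 o4) {w : V} (hw : isD G S m w) (w1 : w ≠ u)
    (w2 : w ≠ m u) (w3 : w ≠ v) (w4 : w ≠ m v) (hN2 : ∀ s ∈ S, G.Adj o2 s ↔ s = u ∨ s = m w)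
    (hN3 : ∀ s ∈ S, G.Adj o3 s ↔ s = v ∨ s = w) : False := by
  have hL' := hL
  obtain ⟨a1, a2, a3, a4, b1, b2, c1, c2, c3, c4, c5, c6, x1, x2, x3, x4, z2, z3, umD, vmD⟩ := hL.f h
  have mw := h.mS hw.1
  have mww := h.mm hw.1
  have wa := h.madj hw.1
  have m1 := mne1 h hw.1 w2
  have m2 := mne2 h hw.1 a1 w1
  have m3 := mne1 h hw.1 w4
  have m4 := mne2 h hw.1 a3 w3
  have i1 : ¬ G.Adj o2 o3 := fun e => hL.ladder1 h hw w1 w2 w3 w4 hN2 hN3 (Or.inl e)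
  have i2 : ¬ G.Adj o2 z := fun e => hL.ladder1 h hw w1 w2 w3 w4 hN2 hN3 (Or.inr e)
  have i3 : ¬ G.Adj o3 z := fun e => (hL.symm h).ladder1 h (isD_m h hw) m3 m4 m1 m2 (by rwa [mww]) hN2 (Or.inr e)
  obtain ⟨uD, vD, hvm, zS, zN, Nu, Nmu, Nv, Nmv, s1, s2, s3, s4, z1, z4⟩ := hL
  have h3w : G.Adj o3 w := (hN3 w hw.1).2 (by simp)
  have hx := h.lx3 (k := u) (l := m v) (n := w) (a := o2) (b := z) (c := o3) a1 a4 hw.1 c4.symm c6.symm w1 w2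
    w4 (by rw [b2]; exact w3) s2 zS s3 z2 (by rintro rfl; have := (hN3 u a1).1 ((x1 _).2 (by simp)); tauto) z3.symm
    ((Nu _).2 (by simp)) ((Nmv _).2 (by simp)) h3w.symm (by
      rw [b2]
      intro x xS p1 p2 p3 q1 q2 q3 r1 r2 r3 r
      have hN : ∀ s ∈ S, G.Adj x s → s = m u ∨ s = m w := by
        intro s hs hxs
        rcases r s hs hxs with rfl | rfl | rfl
        · exact Or.inl rfl
        · rcases (x3 x).1 hxs with rfl | rfl | rfl
          · exact absurd a4 xS
          · exact absurd a1 xS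
          · exact absurd rfl p3
        · exact Or.inr rfl
      have hxu : G.Adj x (m u) := by
        obtain ⟨s, hs, hxs⟩ := h.dom x xS
        rcases hN s hs hxs with rfl | rfl
        · exact hxs
        · obtain ⟨t, ht, k1, k2⟩ := hw.2.2 x xS hxs
          rcases hN t ht k1 with rfl | rfl
          · exact k1
          · exact absurd rfl k2
      have hxw : G.Adj x (m w) := by
        obtain ⟨t, ht, k1, k2⟩ := uD.2.2 x xS hxu
        rcases hN t ht k1 with rfl | rfl
        · exact absurd rfl k2
        · exact k1
      have hx1 : x = o1 := by
        rcases (x2 x).1 hxu with rfl | rfl | rfl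
        · exact absurd a1 xS
        · exact absurd rfl p2
        · rfl
      subst hx1
      have := (hL'.e1 h mw m1 m2 m3 m4 (by rw [mww]; exact hw.2.1) hxw).2.2.2.2.2
      rw [mww] at this
      rcases (hN2 w hw.1).1 ((this w hw.1).2 (by simp)) with e | e
      · exact w1 e
      · exact wa.ne e)
  rw [b2, io0 (fun e => i2 e.symm), io0 (fun e => i1 e.symm), io0 i3] at hx
  have d1 : 2 ≤ dg G (S \ {m u, v, m w}) v := dg_ge2 (k := m v) (l := u) (by simp [a4, c2.symm, m4.symm, c6.symm])
    (by simp [a1, c1, c3, m1.symm]) c4.symm ((Nv _).2 (by simp)) ((Nv _).2 (by simp))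
  have d2 : 1 ≤ dg G (S \ {m u, v, m w}) (m w) := dg_ge1 (k := w) (by simp [hw.1, w2, w3, (h.mne hw.1).symm]) wa.symm
  have d3 : 1 ≤ dg G (S \ {m u, v, m w}) (m u) := dg_ge1 (k := u) (by simp [a1, c1, c3, m1.symm]) ((Nmu _).2 (by simp))
  have d4 : dg G (S \ {m u, v, m w}) o2 ≤ 1 := dg_le1 (k := u) (by
    simp only [mem_sdiff, mem_insert, mem_singleton, not_or]
    intro t ht hadj
    rcases (hN2 t ht.1).1 hadj with e | e
    · exact e
    · exact absurd e ht.2.2.2)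
  have d5 : dg G (S \ {m u, v, m w}) z ≤ 1 := dg_le1 (k := m v) (by
    simp only [mem_sdiff, mem_insert, mem_singleton, not_or]
    intro t ht hadj
    rcases (zN t ht.1).1 hadj with e | e
    · exact absurd e ht.2.1
    · exact e)
  have d6 : dg G (S \ {m u, v, m w}) o3 ≤ 1 := dg_le1 (k := w) (by
    simp only [mem_sdiff, mem_insert, mem_singleton, not_or]
    intro t ht hadj
    rcases (hN3 t ht.1).1 hadj with e | e
    · exact absurd e ht.2.2.1
    · exact e)
  omega

end
end PDom

open Finset
set_option linter.unusedSectionVars false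
set_option linter.unusedVariables false
set_option linter.unusedSimpArgs false
namespace PDom
section
variable {V : Type*} [Fintype V] [DecidableEq V] {G : SimpleGraph V} [DecidableRel G.Adj]
  {S : Finset V} {m : V → V}


theorem dom1 (h : Opt G S m) {x a : V} (hx : x ∉ S) (hN : ∀ s ∈ S, G.Adj x s → s = a) (ha : NP G S a) : False := by
  obtain ⟨s, hs, hxs⟩ := h.dom x hx
  have e := hN s hs hxs
  subst e
  obtain ⟨t, ht, k1, k2⟩ := ha x hx hxs
  exact k2 (hN t ht k1)
theorem dom2 (h : Opt G S m) {x a b : V} (hx : x ∉ S) (hN : ∀ s ∈ S, G.Adj x s → s = a ∨ s = b) (ha : NP G S a)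
    (hb : NP G S b) : G.Adj x a ∧ G.Adj x b := by
  constructor
  · by_contra hh
    exact dom1 h hx (fun s hs hxs => by
      rcases hN s hs hxs with rfl | rfl
      · exact absurd hxs hh
      · rfl) hb
  · by_contra hh
    exact dom1 h hx (fun s hs hxs => by
      rcases hN s hs hxs with rfl | rfl
      · rfl
      · exact absurd hxs hh) ha

theorem Pv_uniq {g p x : V} (hg : g ∈ S) (hnA : ¬ isA G S m g) (hp : Pv G S (m g) p) (hx : Pv G S (m g) x) : x = p := by
  by_contra hne
  exact hnA ⟨hg, x, p, hne, Or.inr hx, Or.inr hp⟩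

/-- vertices g of A, or of type C with non-weak mate -/
def isC (G : SimpleGraph V) (S : Finset V) (m : V → V) (g p : V) : Prop :=
  g ∈ S ∧ NP G S g ∧ ¬ isA G S m g ∧ Pv G S (m g) p
theorem isC.notD {g p : V} (hg : isC G S m g p) : ¬ isD G S m g := fun hh => not_NP.2 ⟨p, hg.2.2.2⟩ hh.2.2
theorem isC.isBC {g p : V} (hg : isC G S m g p) : isBC G S m g := ⟨hg.1, hg.notD, hg.2.2.1⟩
theorem CorA (h : Opt G S m) {g : V} (hg : g ∈ S) (hw : ¬ NP G S (m g)) : isA G S m g ∨ ∃ p, isC G S m g p := by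
  by_cases hA : isA G S m g
  · exact Or.inl hA
  · right
    rcases B_or_C h ⟨hg, fun hh => hw hh.2.2, hA⟩ with ⟨h1, _⟩ | ⟨h1, p, hp⟩
    · exact absurd h1 hw
    · exact ⟨p, hg, h1, hA, hp⟩

theorem wD_exc (h : Opt G S m) {x s t : V} (hs : isD G S m s) (hxs : G.Adj x s) (ht : t ∈ S) (hxt : G.Adj x t)
    (htD : ¬ isD G S m t) (htA : ¬ isA G S m t) (he : exc G S m t) : 1/2 ≤ wt G S m x s := by
  have hst : s ≠ t := by rintro rfl; exact htD hs
  have hp : ∀ w, ¬ payer G S m x w := by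
    intro w hw
    obtain ⟨u, q1, q2, q3, q4, q5, q6, q7, q8, q9, q10, q11, q12, q13⟩ := payer_N hw h
    rcases q10 t ht hxt with rfl | rfl | rfl <;> tauto
  obtain ⟨c, h1, h2, h4⟩ := nb3'' h.cub hxs hxt hst
  rw [wt_formula h hs hst h1 h2 h4 hp, kap_nD htD, phi_nD htD ht, gw_exc htA he]
  by_cases hc : isD G S m c
  · rw [kap_D hc, phi_D hc]; norm_num
  · rw [kap_nD hc]; have := phi_le (G := G) (S := S) (m := m) c
    rw [le_div_iff₀ (by norm_num)]; linarith

/-- what a payer looks like -/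
theorem payerX (h : Opt G S m) {x w : V} (hx : x ∉ S) (hp : payer G S m x w) :
    ∃ q, isD G S m q ∧ w ≠ q ∧ w ≠ m q ∧ isD G S m w ∧ (∀ t ∈ S, G.Adj x t ↔ t = q ∨ t = m q ∨ t = w) ∧
     (G.Adj q w ∨ G.Adj q (m w) ∨ ∃ x', x' ∉ S ∧ x' ≠ x ∧ G.Adj x' (m w) ∧ (G.Adj x' q ∨ G.Adj x' (m q)) ∧
       ∀ s ∈ S, G.Adj x' s → s = q ∨ s = m q ∨ s = m w) := by
  obtain ⟨q, hq, hw, n1, n2, hN, hh⟩ := hp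
  have qS := hq.1
  have q'S := h.mS qS
  have qq := h.mm qS
  have xq : G.Adj x q := (hN q qS).2 (by simp)
  have xq' : G.Adj x (m q) := (hN _ q'S).2 (by simp)
  have xw : G.Adj x w := (hN _ hw.1).2 (by simp)
  rcases hh with ⟨v, vS, v1, v2, hv | hv⟩ | ⟨y, yS, y1, y2⟩
  · refine ⟨q, hq, n1, n2, hw, hN, ?_⟩
    by_cases e1 : w = v
    · subst e1; exact Or.inl hv
    by_cases e2 : m w = v
    · subst e2; exact Or.inr (Or.inl hv)
    right; right
    have := nb3''' h.cub (h.madj qS) hv xq.symm v2.symm (by rintro e; rw [← e] at hx; exact hx q'S)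
      (by rintro e; rw [← e] at hx; exact hx vS)
    obtain ⟨z, z1, z2, z3, z4, z5, z6, z7⟩ := D21ex h hq vS v2.symm this hx xq'.symm hw.1 xw n1 n2 e1 e2 hw.2.2
    exact ⟨z, z1, z2, z5, z6, z7⟩
  · refine ⟨m q, isD_m h hq, n2, by rwa [qq], hw, fun t ht => by rw [hN t ht, qq]; tauto, ?_⟩
    by_cases e1 : w = v
    · subst e1; exact Or.inl hv
    by_cases e2 : m w = v
    · subst e2; exact Or.inr (Or.inl hv)
    right; right
    have := nb3''' h.cub (h.madj q'S) hv xq'.symm (by rw [qq]; exact v1.symm) (by rw [qq]; rintro e; rw [← e] at hx; exact hx qS)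
      (by rintro e; rw [← e] at hx; exact hx vS)
    obtain ⟨z, z1, z2, z3, z4, z5, z6, z7⟩ := D21ex h (isD_m h hq) vS (by rw [qq]; exact v1.symm) this hx
      (by rw [qq]; exact xq.symm) hw.1 xw n2 (by rwa [qq]) e1 e2 hw.2.2
    exact ⟨z, z1, z2, z5, z6, z7⟩
  · refine ⟨q, hq, n1, n2, hw, hN, Or.inr (Or.inr ⟨y, yS, y1, (y2 _ (h.mS hw.1)).2 (by simp),
      Or.inl ((y2 _ qS).2 (by simp)), fun s hs => (y2 s hs).1⟩)⟩

variable {u v z o1 o2 o3 o4 : V}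

theorem Lnk.y (h : Opt G S m) (hL : Lnk G S m u v z o1 o2 o3 o4) {x : V} (hx : x ∉ S) :
    (G.Adj x u ↔ x = o2) ∧ (G.Adj x (m u) ↔ x = z ∨ x = o1) ∧ (G.Adj x v ↔ x = o3) ∧
    (G.Adj x (m v) ↔ x = z ∨ x = o4) := by
  have f := hL.f h
  have n1 : x ≠ u := fun e => hx (e ▸ f.a1)
  have n2 : x ≠ m u := fun e => hx (e ▸ f.a2)
  have n3 : x ≠ v := fun e => hx (e ▸ f.a3)
  have n4 : x ≠ m v := fun e => hx (e ▸ f.a4)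
  rw [f.x1, f.x2, f.x3, f.x4]
  simp [n1, n2, n3, n4]

theorem Lnk.adj (hL : Lnk G S m u v z o1 o2 o3 o4) : G.Adj o1 (m u) ∧ G.Adj o2 u ∧ G.Adj o3 v ∧ G.Adj o4 (m v) :=
  ⟨((hL.Nmu _).2 (by simp)).symm, ((hL.Nu _).2 (by simp)).symm, ((hL.Nv _).2 (by simp)).symm,
    ((hL.Nmv _).2 (by simp)).symm⟩

/-- triple coincidence 2 = 3 = 4 -/
theorem Lnk.t1 (h : Opt G S m) (hL : Lnk G S m u v z o1 o2 o3 o4) (e3 : o3 = o2) (e4 : o4 = o2) : False := by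
  subst e3
  subst e4
  have hL' := hL
  obtain ⟨a1, a2, a3, a4, b1, b2, c1, c2, c3, c4, c5, c6, x1, x2, x3, x4, z2, z3, umD, vmD⟩ := hL.f h
  obtain ⟨j1, j2, j3, j4⟩ := hL.adj
  obtain ⟨uD, vD, hvm, zS, zN, Nu, Nmu, Nv, Nmv, s1, s2, s3, s4, z1, z4⟩ := hL
  have full := nb3''' h.cub j2 j3 j4 c3 c4 c2
  have hx := h.lx2 (k := m u) (l := v) (a := z) (b := o4) a2 a3 c5.symm (by rw [b1]; exact c3.symm) zS s2 z2.symm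
    ((Nmu _).2 (by simp)) j3.symm (by
      rw [b1]
      intro x xS p1 p2 q1 q2 q3 q4 r
      obtain ⟨y1, y2, y3, y4⟩ := hL'.y h xS
      obtain ⟨s, hs, hxs⟩ := h.dom x xS
      rcases r s hs hxs with rfl | rfl
      · exact p2 (y1.1 hxs)
      · rcases y4.1 hxs with e | e
        · exact p1 e
        · exact p2 e)
  rw [b1, io0 (x := o4) (y := z) (fun e => by
    rcases (full z).1 e with e | e | e
    · exact zS (e ▸ a1)
    · exact zS (e ▸ a3)
    · exact zS (e ▸ a4))] at hx
  have d1 : 2 ≤ dg G (S \ {u, m v}) u := dg_ge2 (k := m u) (l := v) (by simp [a2, c1.symm, c6])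
    (by simp [a3, c3.symm, c2]) c5 ((Nu _).2 (by simp)) ((Nu _).2 (by simp))
  have d2 : 1 ≤ dg G (S \ {u, m v}) (m v) := dg_ge1 (k := v) (by simp [a3, c3.symm, c2]) ((Nmv _).2 (by simp))
  have d3 : dg G (S \ {u, m v}) z ≤ 1 := dg_le1 (k := m u) (by
    simp only [mem_sdiff, mem_insert, mem_singleton, not_or]
    intro t ht hadj
    rcases (zN t ht.1).1 hadj with e | e
    · exact e
    · exact absurd e ht.2.2)
  have d4 : dg G (S \ {u, m v}) o4 ≤ 1 := dg_le1 (k := v) (by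
    simp only [mem_sdiff, mem_insert, mem_singleton, not_or]
    intro t ht hadj
    rcases (full t).1 hadj with e | e | e
    · exact absurd e ht.2.1
    · exact e
    · exact absurd e ht.2.2)
  omega

/-- triple coincidence 1 = 3 = 4 -/
theorem Lnk.t2 (h : Opt G S m) (hL : Lnk G S m u v z o1 o2 o3 o4) (e3 : o3 = o1) (e4 : o4 = o1) : False := by
  subst e3
  subst e4
  have hL' := hL
  obtain ⟨a1, a2, a3, a4, b1, b2, c1, c2, c3, c4, c5, c6, x1, x2, x3, x4, z2, z3, umD, vmD⟩ := hL.f h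
  obtain ⟨j1, j2, j3, j4⟩ := hL.adj
  obtain ⟨uD, vD, hvm, zS, zN, Nu, Nmu, Nv, Nmv, s1, s2, s3, s4, z1, z4⟩ := hL
  obtain ⟨x, p1, p2, q1, q2, r1, r2⟩ := h.ex1 (a := m u) (b := o4) a1 a3 c3.symm hvm j1.symm (by tauto)
    (fun e => absurd e s3)
  have hxS : x ∉ S := by
    intro hx
    rcases r2 hx with rfl | rfl | rfl | rfl
    · exact q1 ((Nu _).2 (by simp))
    · exact p1 rfl
    · exact q2 j3.symm
    · exact q2 j4.symm
  obtain ⟨y1, y2, y3, y4⟩ := hL'.y h hxS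
  refine dom1 h hxS (a := u) (fun s hs hxs => ?_) uD.2.1
  rcases r1 s hs hxs with rfl | rfl | rfl | rfl
  · rfl
  · exact absurd hxs q1
  · exact absurd (y3.1 hxs) p2
  · rcases y4.1 hxs with e | e
    · exact absurd (y2.2 (Or.inl e)) q1
    · exact absurd e p2

theorem Lnk.nC (h : Opt G S m) (hL : Lnk G S m u v z o1 o2 o3 o4) {x w : V} (hx : x ∉ S) (hxz : x ≠ z) (hxw : G.Adj x w) :
    (x ≠ o2 → w ≠ u) ∧ (x ≠ o1 → w ≠ m u) ∧ (x ≠ o3 → w ≠ v) ∧ (x ≠ o4 → w ≠ m v) := by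
  obtain ⟨y1, y2, y3, y4⟩ := hL.y h hx
  refine ⟨?_, ?_, ?_, ?_⟩ <;> rintro hne rfl
  · exact hne (y1.1 hxw)
  · rcases y2.1 hxw with e | e
    · exact hxz e
    · exact hne e
  · exact hne (y3.1 hxw)
  · rcases y4.1 hxw with e | e
    · exact hxz e
    · exact hne e

/-- `o2` is not paying from a pair outside unless `o1` sees it -/
theorem Lnk.nopay (h : Opt G S m) (hL : Lnk G S m u v z o1 o2 o3 o4) (e1 : o2 ≠ o1) (e3 : o2 ≠ o3) (e4 : o2 ≠ o4)
    (hp : payer G S m o2 u) : ∃ q, isD G S m q ∧ G.Adj o1 q ∧ q ≠ m u ∧ ∀ s ∈ S, G.Adj o1 s → s = q ∨ s = m q ∨ s = m u := by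
  obtain ⟨a1, a2, a3, a4, b1, b2, c1, c2, c3, c4, c5, c6, x1, x2, x3, x4, z2, z3, umD, vmD⟩ := hL.f h
  obtain ⟨q, hq, n1, n2, _, hN, hh⟩ := payerX h hL.s2 hp
  have qS := hq.1
  have q'S := h.mS qS
  have qq := h.mm qS
  have xq : G.Adj o2 q := (hN q qS).2 (by simp)
  have xq' : G.Adj o2 (m q) := (hN _ q'S).2 (by simp)
  obtain ⟨k1, k2, k3, k4⟩ := hL.nC h hL.s2 z2 xq
  obtain ⟨k1', k2', k3', k4'⟩ := hL.nC h hL.s2 z2 xq'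
  replace k2 := k2 e1
  replace k2' := k2' e1
  replace k3 := k3 e3
  replace k4 := k4 e4
  replace k4' := k4' e4
  rcases hh with hh | hh | ⟨x, xS, xne, xu, xq, xN⟩
  · rcases (x1 q).1 hh with e | e | e
    · exact absurd e k2
    · exact absurd e k3
    · exact absurd (e ▸ qS) hL.s2
  · rcases (x2 q).1 hh with e | e | e
    · exact absurd e.symm n1
    · exact absurd (e ▸ qS) hL.zS
    · exact absurd (e ▸ qS) hL.s1
  · have hx1 : x = o1 := by
      rcases (x2 x).1 xu with rfl | rfl | rfl
      · exact absurd a1 xS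
      · exfalso
        rcases xq with e | e
        · rcases (hL.zN _ qS).1 e with e | e
          · exact k2 e
          · exact k4 e
        · rcases (hL.zN _ q'S).1 e with e | e
          · exact k2' e
          · exact k4' e
      · rfl
    subst hx1
    rcases xq with e | e
    · exact ⟨q, hq, e, k2, xN⟩
    · exact ⟨m q, isD_m h hq, e, k2', fun s hs hh => by rw [qq]; rcases xN s hs hh with e | e | e <;> simp [e]⟩

theorem Lnk.half (h : Opt G S m) (hL : Lnk G S m u v z o1 o2 o3 o4) (e12 : o1 ≠ o2) (e13 : o1 ≠ o3) (e14 : o1 ≠ o4)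
    (e23 : o2 ≠ o3) (e24 : o2 ≠ o4) : 1 ≤ wt G S m o1 (m u) + wt G S m o2 u := by
  obtain ⟨a1, a2, a3, a4, b1, b2, c1, c2, c3, c4, c5, c6, x1, x2, x3, x4, z2, z3, umD, vmD⟩ := hL.f h
  obtain ⟨j1, j2, j3, j4⟩ := hL.adj
  by_cases hD : ∀ t, isD G S m t → G.Adj o1 t → t = m u
  · have w1 := wD_noD h umD j1 hD
    have w2 := wD_third h hL.uD j2 (fun hp => by
      obtain ⟨q, q1, q2, q3, q4⟩ := hL.nopay h e12.symm e23 e24 hp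
      exact q3 (hD q q1 q2))
    linarith
  · push Not at hD
    obtain ⟨w, hw, ow, wu⟩ := hD
    obtain ⟨k1, k2, k3, k4⟩ := hL.nC h hL.s1 hL.z1 ow
    replace k1 := k1 e12
    replace k3 := k3 e13
    replace k4 := k4 e14
    have mw := h.mS hw.1
    have mww := h.mm hw.1
    have hN2 := (hL.e1 h hw.1 k1 wu k3 k4 hw.2.2 ow).2.2.2.2.2
    obtain ⟨x, xS, xo, xne, xne', xz, x2', xw, xN⟩ := hL.e2 h mw (mne1 h hw.1 wu) (mne2 h hw.1 a1 k1) (mne1 h hw.1 k4)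
      (mne2 h hw.1 a3 k3) (by rw [mww]; exact hw.2.1) ((hN2 _ mw).2 (by simp))
    rw [mww] at xN
    rcases xo with rfl | rfl
    · have w1 := wD_two h umD j1 (t := w) (fun r hr hxr => by
        rcases xN r hr hxr with e | e | e
        · exact Or.inl e
        · subst e; exact absurd (((hL.y h hL.s1).2.2.1).1 hxr) e13
        · exact Or.inr e)
      have w2 := wD_two h hL.uD j2 (t := m w) (fun r hr => (hN2 r hr).1)
      linarith
    · exfalso
      have hN : ∀ s ∈ S, G.Adj x s → s = v ∨ s = w := fun s hs hxs => by
        rcases xN s hs hxs with e | e | e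
        · subst e
          rcases ((hL.y h hL.s3).2.1).1 hxs with e | e
          · exact absurd e z3
          · exact absurd e.symm e13
        · exact Or.inl e
        · exact Or.inr e
      have := dom2 h xS hN hL.vD.2.1 hw.2.1
      exact hL.ladder h hw k1 wu k3 k4 hN2 (fun s hs => ⟨hN s hs, by rintro (rfl | rfl); exacts [this.1, this.2]⟩)

theorem Lnk.halfweak (h : Opt G S m) (hL : Lnk G S m u v z o1 o2 o3 o4) (e12 : o1 ≠ o2) (e13 : o1 ≠ o3) (e14 : o1 ≠ o4) :
    3/4 ≤ wt G S m o1 (m u) + wt G S m o2 u := by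
  obtain ⟨a1, a2, a3, a4, b1, b2, c1, c2, c3, c4, c5, c6, x1, x2, x3, x4, z2, z3, umD, vmD⟩ := hL.f h
  obtain ⟨j1, j2, j3, j4⟩ := hL.adj
  by_cases hD : ∀ t, isD G S m t → G.Adj o1 t → t = m u
  · have w1 := wD_noD h umD j1 hD
    have w2 := wD_low h hL.uD j2
    linarith
  · push Not at hD
    obtain ⟨w, hw, ow, wu⟩ := hD
    obtain ⟨k1, k2, k3, k4⟩ := hL.nC h hL.s1 hL.z1 ow
    have hN2 := (hL.e1 h hw.1 (k1 e12) wu (k3 e13) (k4 e14) hw.2.2 ow).2.2.2.2.2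
    have w2 := wD_two h hL.uD j2 (t := m w) (fun r hr => (hN2 r hr).1)
    have w1 := wD_low h umD j1
    linarith

theorem Lnk.c23 (h : Opt G S m) (hL : Lnk G S m u v z o1 o2 o3 o4) (e23 : o3 = o2) (e12 : o1 ≠ o2) (e14 : o1 ≠ o4) 
    (e24 : o2 ≠ o4) : 1 ≤ wt G S m o1 (m u) + wt G S m o2 u := by
  obtain ⟨a1, a2, a3, a4, b1, b2, c1, c2, c3, c4, c5, c6, x1, x2, x3, x4, z2, z3, umD, vmD⟩ := hL.f h
  obtain ⟨j1, j2, j3, j4⟩ := hL.adj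
  have hD : ∀ t, isD G S m t → G.Adj o1 t → t = m u := by
    intro w hw ow
    by_contra wu
    obtain ⟨k1, k2, k3, k4⟩ := hL.nC h hL.s1 hL.z1 ow
    exact (hL.e1 h hw.1 (k1 e12) wu (k3 (by rw [e23]; exact e12)) (k4 e14) hw.2.2 ow).2.2.1 e23.symm
  have w1 := wD_noD h umD j1 hD
  have w2 := wD_third h hL.uD j2 (fun hp => by
    obtain ⟨q, hq, n1, n2, _, hN, _⟩ := payerX h hL.s2 hp
    have : G.Adj o2 (m v) := by
      rw [e23] at j3
      have qq := h.mm hq.1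
      rcases (hN v a3).1 j3 with e | e | e
      · rw [e]; exact (hN _ (h.mS hq.1)).2 (by simp)
      · rw [e, qq]; exact (hN _ hq.1).2 (by simp)
      · exact absurd e.symm c3
    rcases ((hL.y h hL.s2).2.2.2).1 this with e | e
    · exact z2 e
    · exact e24 e)
  linarith

theorem Lnk.c14 (h : Opt G S m) (hL : Lnk G S m u v z o1 o2 o3 o4) (e14 : o4 = o1) (e12 : o1 ≠ o2) (e13 : o1 ≠ o3)
    (e23 : o2 ≠ o3) : 1 ≤ wt G S m o1 (m u) + wt G S m o2 u := by
  obtain ⟨a1, a2, a3, a4, b1, b2, c1, c2, c3, c4, c5, c6, x1, x2, x3, x4, z2, z3, umD, vmD⟩ := hL.f h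
  obtain ⟨j1, j2, j3, j4⟩ := hL.adj
  have hD : ∀ t, isD G S m t → G.Adj o2 t → t = u := by
    intro w hw ow
    by_contra wu
    obtain ⟨k1, k2, k3, k4⟩ := hL.nC h hL.s2 z2 ow
    replace k2 := k2 e12.symm
    replace k3 := k3 e23
    replace k4 := k4 (by rw [e14]; exact e12.symm)
    have mw := h.mS hw.1
    have mww := h.mm hw.1
    obtain ⟨x, xS, xo, xne, xne', xz, x2', xw, xN⟩ := hL.e2 h hw.1 wu k2 k3 k4 hw.2.2 ow
    rcases xo with rfl | rfl
    · exact xne' e14.symm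
    have hN : ∀ s ∈ S, G.Adj x s → s = v ∨ s = m w := fun s hs hxs => by
        rcases xN s hs hxs with e | e | e
        · subst e
          rcases ((hL.y h hL.s3).2.1).1 hxs with e | e
          · exact absurd e z3
          · exact absurd e.symm e13
        · exact Or.inl e
        · exact Or.inr e
    obtain ⟨d1, d2⟩ := dom2 h xS hN hL.vD.2.1 hw.2.2
    obtain ⟨x', xS', xo, xne2, xne2', _, _, _, xN2⟩ := (hL.symm h).e2 h mw (mne1 h hw.1 k4)
      (mne2 h hw.1 a3 k3)  (mne1 h hw.1 k2) (mne2 h hw.1 a1 wu) (by rw [mww]; exact hw.2.1) d2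
    rcases xo with rfl | rfl
    · exact xne2' e14
    rw [mww] at xN2
    have hN2 : ∀ s ∈ S, G.Adj x' s → s = u ∨ s = w := fun s hs hxs => by
        rcases xN2 s hs hxs with e | e | e
        · subst e
          rcases ((hL.y h hL.s2).2.2.2).1 hxs with e | e
          · exact absurd e z2
          · exact absurd (e14 ▸ e).symm e12
        · exact Or.inl e
        · exact Or.inr e
    exact hL.ladder h (isD_m h hw) (mne1 h hw.1 k2) (mne2 h hw.1 a1 wu) (mne1 h hw.1 k4) (mne2 h hw.1 a3 k3)
      (fun s hs => ⟨by rw [mww]; exact hN2 s hs, by rw [mww]; rintro (rfl | rfl); exacts [j2, ow]⟩)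
      (fun s hs => ⟨hN s hs, by rintro (rfl | rfl); exacts [d1, d2]⟩)
  have w1 := wD_noD h hL.uD j2 hD
  have w2 := wD_third h umD j1 (fun hp => by
    obtain ⟨q, hq, n1, n2, _, hN, _⟩ := payerX h hL.s1 hp
    have : G.Adj o1 v := by
      rw [e14] at j4
      have qq := h.mm hq.1
      rcases (hN _ a4).1 j4 with e | e | e
      · rw [← b2, e]; exact (hN _ (h.mS hq.1)).2 (by simp)
      · rw [← b2, e, qq]; exact (hN _ hq.1).2 (by simp)
      · exact absurd e.symm c6
    exact e13 (((hL.y h hL.s1).2.2.1).1 this))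
  linarith

end
end PDom

open Finset
set_option linter.unusedSectionVars false
set_option linter.unusedVariables false
set_option linter.unusedSimpArgs false
namespace PDom
section
variable {V : Type*} [Fintype V] [DecidableEq V] {G : SimpleGraph V} [DecidableRel G.Adj]
  {S : Finset V} {m : V → V}

variable {u v z o1 o2 o3 o4 : V}

theorem isC.mgS (h : Opt G S m) {g p : V} (hg : isC G S m g p) : m g ∈ S ∧ m (m g) = g ∧ G.Adj g (m g) ∧ g ≠ m g ∧
    p ∉ S ∧ G.Adj p (m g) ∧ ∀ s ∈ S, G.Adj p s → s = m g :=
  ⟨h.mS hg.1, h.mm hg.1, h.madj hg.1, (h.mne hg.1).symm, hg.2.2.2.1, hg.2.2.2.2.1, hg.2.2.2.2.2⟩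

theorem Lnk.c12 (h : Opt G S m) (hL : Lnk G S m u v z o1 o2 o3 o4) (e12 : o2 = o1) (e13 : o1 ≠ o3) (e14 : o1 ≠ o4) :
    5/4 ≤ wt G S m o1 (m u) + wt G S m o2 u := by
  have hL' := hL
  obtain ⟨a1, a2, a3, a4, b1, b2, c1, c2, c3, c4, c5, c6, x1, x2, x3, x4, z2, z3, umD, vmD⟩ := hL.f h
  obtain ⟨j1, j2, j3, j4⟩ := hL.adj
  obtain ⟨uD, vD, hvm, zS, zN, Nu, Nmu, Nv, Nmv, s1, s2, s3, s4, z1, z4⟩ := hL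
  rw [e12] at j2
  obtain ⟨g, gS, og, gu, gu'⟩ := h.F1a a1 uD.2.1 a3 ((Nu _).2 (by simp)) hvm s1 j1
  obtain ⟨k1, k2, k3, k4⟩ := hL'.nC h s1 z1 og
  replace k3 := k3 e13
  replace k4 := k4 e14
  have hweak : ¬ NP G S (m g) := fun hw => (hL'.e1 h gS gu gu' k3 k4 hw og).1 e12
  rcases CorA h gS hweak with hA | ⟨p, hC⟩
  · have w1 := wD_A h umD j1 hA og
    have w2 := wD_A h uD j2 hA og
    rw [e12]
    linarith
  · exfalso
    obtain ⟨gS', mg, ga, gm, pS, pg, pN⟩ := hC.mgS h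
    have full := nb3''' h.cub j1 j2 og c1.symm gu'.symm gu.symm
    have hx := h.lx2 (k := m u) (l := m g) (a := o1) (b := p) a2 gS' (mne2 h gS a1 gu) (by rw [b1]; exact mne1 h gS gu') s1 pS
      (by rintro rfl; exact mne1 h gS gu' (pN u a1 j2).symm) j1.symm pg.symm (by
        rw [b1, mg]
        intro x xS p1 p2 q1 q2 q3 q4 r
        obtain ⟨y1, y2, y3, y4⟩ := hL'.y h xS
        refine dom1 h xS (a := g) (fun s hs hxs => ?_) hC.2.1
        rcases r s hs hxs with rfl | rfl
        · exact absurd ((y1.1 hxs).trans e12) p1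
        · rfl)
    rw [b1, mg, io0 (x := p) (y := o1) (fun e => by
      rcases (full p).1 e.symm with e | e | e
      · exact pS (e ▸ a2)
      · exact pS (e ▸ a1)
      · exact pS (e ▸ gS))] at hx
    have d1 : 2 ≤ dg G (S \ {u, g}) u := dg_ge2 (k := m u) (l := v) (by simp [a2, c1.symm, gu'.symm])
      (by simp [a3, c3.symm, k3.symm]) c5 ((Nu _).2 (by simp)) ((Nu _).2 (by simp))
    have d2 : 1 ≤ dg G (S \ {u, g}) g := dg_ge1 (k := m g) (by simp [gS', gm.symm, mne1 h gS gu']) ga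
    have d3 : dg G (S \ {u, g}) o1 ≤ 1 := dg_le1 (k := m u) (by
      simp only [mem_sdiff, mem_insert, mem_singleton, not_or]
      intro t ht hadj
      rcases (full t).1 hadj with e | e | e
      · exact e
      · exact absurd e ht.2.1
      · exact absurd e ht.2.2)
    have d4 : dg G (S \ {u, g}) p ≤ 1 := dg_le1 (k := m g) (fun t ht hadj => pN t (mem_sdiff.1 ht).1 hadj)
    omega

theorem Lnk.c13 (h : Opt G S m) (hL : Lnk G S m u v z o1 o2 o3 o4) (e13 : o3 = o1) (e12 : o1 ≠ o2) (e14 : o1 ≠ o4)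
    (e24 : o2 ≠ o4) : 2 ≤ wt G S m o1 (m u) + wt G S m o2 u + wt G S m o3 v + wt G S m o4 (m v) := by
  have hL' := hL
  obtain ⟨a1, a2, a3, a4, b1, b2, c1, c2, c3, c4, c5, c6, x1, x2, x3, x4, z2, z3, umD, vmD⟩ := hL.f h
  obtain ⟨j1, j2, j3, j4⟩ := hL.adj
  obtain ⟨uD, vD, hvm, zS, zN, Nu, Nmu, Nv, Nmv, s1, s2, s3, s4, z1, z4⟩ := hL
  rw [e13] at j3
  have hD4 : ∀ t, isD G S m t → G.Adj o4 t → t = m v := by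
    intro w hw ow
    by_contra wu
    obtain ⟨k1, k2, k3, k4⟩ := hL'.nC h s4 z4 ow
    exact ((hL'.symm h).e1 h hw.1 (k3 (by rw [e13]; exact e14.symm)) wu (k1 e24.symm) (k2 e14.symm) hw.2.2 ow).2.2.2.1 e13
  have w4 := wD_noD h vmD j4 hD4
  obtain ⟨g, g1, g2, full⟩ := nb3'' h.cub j1 j3 c5
  have og : G.Adj o1 g := (full g).2 (by simp)
  obtain ⟨k1, k2, k3, k4⟩ := hL'.nC h s1 z1 og
  replace k1 := k1 e12
  replace k4 := k4 e14
  by_cases gS : g ∈ S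
  swap
  · have hN : ∀ r ∈ S, G.Adj o1 r → r = m u ∨ r = v := fun r hr hh => by
      rcases (full r).1 hh with e | e | e
      · exact Or.inl e
      · exact Or.inr e
      · exact absurd (e ▸ hr) gS
    have w1 := wD_two h umD j1 hN
    have w3 := wD_two h vD j3 (fun r hr hh => (hN r hr hh).symm)
    have w2 := wD_third h uD j2 (fun hp => by
      obtain ⟨q, q1, q2, q3, q4⟩ := hL'.nopay h e12.symm (by rw [e13]; exact e12.symm) e24 hp
      rcases hN q q1.1 q2 with e | e
      · exact q3 e
      · subst e
        have : G.Adj o2 (m u) ∨ G.Adj o2 q := by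
          exfalso
          obtain ⟨q', hq, n1, n2, _, hN', _⟩ := payerX h s2 hp
          have xq : G.Adj o2 q' := (hN' q' hq.1).2 (by simp)
          obtain ⟨q'', r1, r2, r3, r4⟩ := hL'.nopay h e12.symm (by rw [e13]; exact e12.symm) e24 hp
          obtain ⟨x', hx'⟩ := payerX h s2 hp
          obtain ⟨hq, n1, n2, _, hN', hh⟩ := hx'
          have xq : G.Adj o2 x' := (hN' x' hq.1).2 (by simp)
          have xq' : G.Adj o2 (m x') := (hN' _ (h.mS hq.1)).2 (by simp)
          obtain ⟨l1, l2, l3, l4⟩ := hL'.nC h s2 z2 xq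
          obtain ⟨l1', l2', l3', l4'⟩ := hL'.nC h s2 z2 xq'
          have f3 : o2 ≠ o3 := by rw [e13]; exact e12.symm
          rcases hh with hh | hh | ⟨y, yS, yne, yu, yq, yN⟩
          · rcases (x1 x').1 hh with e | e | e
            · exact l2 e12.symm e
            · exact l3 f3 e
            · exact s2 (e ▸ hq.1)
          · rcases (x2 x').1 hh with e | e | e
            · exact n1 e.symm
            · exact zS (e ▸ hq.1)
            · exact s1 (e ▸ hq.1)
          · rcases ((hL'.y h yS).2.1).1 yu with e | e
            · subst e
              rcases yN _ a4 ((zN _ a4).2 (by simp)) with e | e | e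
              · exact l4 e24 e.symm
              · exact l4' e24 e.symm
              · exact c6 e.symm
            · subst e
              rcases yN _ a3 j3 with e | e | e
              · exact l3 f3 e.symm
              · exact l3' f3 e.symm
              · exact hvm e
        rcases this with e | e
        · rcases ((hL'.y h s2).2.1).1 e with e | e
          · exact z2 e
          · exact e12 e.symm
        · exact e12 (((hL'.y h s2).2.2.1.1 e).trans e13).symm)
    rw [e13]
    linarith
  have gS' := h.mS gS
  have mg := h.mm gS
  have ga := h.madj gS
  have m1 := mne1 h gS g1.symm
  have m2 := mne2 h gS a1 k1
  have m3 := mne1 h gS k4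
  have m4 := mne2 h gS a3 g2.symm
  by_cases gD : isD G S m g
  · exfalso
    have hN2 := (hL'.e1 h gS k1 g1.symm g2.symm k4 gD.2.2 og).2.2.2.2.2
    by_cases oz : G.Adj o2 z
    · obtain ⟨x, p1, p2, p3, p4, q1, q2, q3, q4, r1, r2⟩ := h.ex2 (a := o1) (b := g) (a' := z) (b' := o2) a1 a3 gS
        c3.symm hvm k1 g1.symm g2.symm k4 og oz.symm z1 e12 (by rintro rfl; exact zS gS) (by rintro rfl; exact s2 gS)
        (fun e => absurd e s1) (by tauto) (fun e => absurd e zS) (fun e => absurd e s2)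
      have hxS : x ∉ S := by
        intro hx
        rcases r2 hx with rfl | rfl | rfl | rfl | rfl | rfl
        · exact q4 j2.symm
        · exact q1 j1.symm
        · exact q1 j3.symm
        · exact q3 ((Nmv _).2 (by simp))
        · exact p2 rfl
        · exact q2 ga.symm
      obtain ⟨y1, y2, y3, y4⟩ := hL'.y h hxS
      have hN : ∀ s ∈ S, G.Adj x s → s = m v ∨ s = m g := by
        intro s hs hxs
        rcases r1 s hs hxs with rfl | rfl | rfl | rfl | rfl | rfl
        · exact absurd (y1.1 hxs) p4
        · rcases y2.1 hxs with e | e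
          · exact absurd e p3
          · exact absurd e p1
        · exact absurd ((y3.1 hxs).trans e13) p1
        · exact Or.inl rfl
        · exact absurd hxs q2
        · exact Or.inr rfl
      obtain ⟨d1, d2⟩ := dom2 h hxS hN vD.2.2 gD.2.2
      rcases y4.1 d1 with e | e
      · exact p3 e
      · subst e
        exact m4 (hD4 _ (isD_m h gD) d2)
    · have nfull : ∀ t, t ∉ S → ¬ G.Adj o1 t := by
        intro t ht hh
        rcases (full t).1 hh with e | e | e
        · exact ht (e ▸ a2)
        · exact ht (e ▸ a3)
        · exact ht (e ▸ gS)
      have hx := h.lx3 (k := u) (l := m v) (n := g) (a := o2) (b := z) (c := o1) a1 a4 gS c4.symm c6.symm k1 g1.symm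
        k4 (by rw [b2]; exact g2.symm) s2 zS s1 z2 e12.symm z1.symm j2.symm ((Nmv _).2 (by simp)) og.symm (by
          rw [b2]
          intro x xS p1 p2 p3 q1 q2 q3 r1 r2 r3 r
          obtain ⟨y1, y2, y3, y4⟩ := hL'.y h xS
          refine dom1 h xS (a := m g) (fun s hs hxs => ?_) gD.2.2
          rcases r s hs hxs with rfl | rfl | rfl
          · rcases y2.1 hxs with e | e
            · exact absurd e p2
            · exact absurd e p3
          · exact absurd ((y3.1 hxs).trans e13) p3
          · rfl)
      rw [b2, io0 (fun e => oz e.symm), io0 (nfull _ s2), io0 (nfull _ zS)] at hx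
      have d1 : 2 ≤ dg G (S \ {m u, v, m g}) v := dg_ge2 (k := m v) (l := u) (by simp [a4, c2.symm, m4.symm, c6.symm])
        (by simp [a1, c1, c3, m1.symm]) c4.symm ((Nv _).2 (by simp)) ((Nv _).2 (by simp))
      have d2 : 1 ≤ dg G (S \ {m u, v, m g}) (m g) := dg_ge1 (k := g) (by simp [gS, g1.symm, g2.symm, (h.mne gS).symm]) ga.symm
      have d3 : 1 ≤ dg G (S \ {m u, v, m g}) (m u) := dg_ge1 (k := u) (by simp [a1, c1, c3, m1.symm]) ((Nmu _).2 (by simp))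
      have d4 : dg G (S \ {m u, v, m g}) o2 ≤ 1 := dg_le1 (k := u) (by
        simp only [mem_sdiff, mem_insert, mem_singleton, not_or]
        intro t ht hadj
        rcases (hN2 t ht.1).1 hadj with e | e
        · exact e
        · exact absurd e ht.2.2.2)
      have d5 : dg G (S \ {m u, v, m g}) z ≤ 1 := dg_le1 (k := m v) (by
        simp only [mem_sdiff, mem_insert, mem_singleton, not_or]
        intro t ht hadj
        rcases (zN t ht.1).1 hadj with e | e
        · exact absurd e ht.2.1
        · exact e)
      have d6 : dg G (S \ {m u, v, m g}) o1 ≤ 1 := dg_le1 (k := g) (by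
        simp only [mem_sdiff, mem_insert, mem_singleton, not_or]
        intro t ht hadj
        rcases (full t).1 hadj with e | e | e
        · exact absurd e ht.2.1
        · exact absurd e ht.2.2.1
        · exact e)
      omega
  · have hD2 : ∀ t, isD G S m t → G.Adj o2 t → t = u := by
      intro w hw ow
      by_contra wu
      obtain ⟨l1, l2, l3, l4⟩ := hL'.nC h s2 z2 ow
      obtain ⟨x, xS, xo, xne, xne', xz, x2', xw, xN⟩ := hL'.e2 h hw.1 wu (l2 e12.symm) (l3 (by rw [e13]; exact e12.symm))
        (l4 e24) hw.2.2 ow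
      have hx1 : x = o1 := by
        rcases xo with e | e
        · exact e
        · exact e.trans e13
      subst hx1
      rcases xN g gS og with e | e | e
      · exact g1 e.symm
      · exact g2 e.symm
      · exact gD (e ▸ isD_m h hw)
    have w2 := wD_noD h uD j2 hD2
    have w1 := wD_512 h umD j1 gS og gD
    have w3 := wD_512 h vD j3 gS og gD
    rw [e13]
    linarith

end
end PDom

open Finset
set_option linter.unusedSectionVars false
set_option linter.unusedVariables false
set_option linter.unusedSimpArgs false
namespace PDom
section
variable {V : Type*} [Fintype V] [DecidableEq V] {G : SimpleGraph V} [DecidableRel G.Adj]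
  {S : Finset V} {m : V → V}

variable {u v z o1 o2 o3 o4 : V}

theorem Lnk.c1423 (h : Opt G S m) (hL : Lnk G S m u v z o1 o2 o3 o4) (e14 : o4 = o1) (e23 : o3 = o2) (e12 : o1 ≠ o2) :
    2 ≤ wt G S m o1 (m u) + wt G S m o2 u + wt G S m o3 v + wt G S m o4 (m v) := by
  have hL' := hL
  obtain ⟨a1, a2, a3, a4, b1, b2, c1, c2, c3, c4, c5, c6, x1, x2, x3, x4, z2, z3, umD, vmD⟩ := hL.f h
  obtain ⟨j1, j2, j3, j4⟩ := hL.adj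
  obtain ⟨uD, vD, hvm, zS, zN, Nu, Nmu, Nv, Nmv, s1, s2, s3, s4, z1, z4⟩ := hL
  rw [e23] at j3
  rw [e14] at j4
  have zu : G.Adj z (m u) := (zN _ a2).2 (by simp)
  have zv : G.Adj z (m v) := (zN _ a4).2 (by simp)
  obtain ⟨g, g1, g2, full⟩ := nb3'' h.cub j2 j3 c3
  have og : G.Adj o2 g := (full g).2 (by simp)
  obtain ⟨g', g1', g2', full'⟩ := nb3'' h.cub j1 j4 c6
  have og' : G.Adj o1 g' := (full' g').2 (by simp)
  obtain ⟨-, k2, -, k4⟩ := hL'.nC h s2 z2 og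
  obtain ⟨k1', -, k3', -⟩ := hL'.nC h s1 z1 og'
  replace k2 := k2 e12.symm
  replace k4 := k4 (by rw [e14]; exact e12.symm)
  replace k1' := k1' e12
  replace k3' := k3' (by rw [e23]; exact e12)
  have hD' : ¬ isD G S m g' := fun hw => 
    (hL'.e1 h hw.1 k1' g1'.symm k3' g2'.symm hw.2.2 og').2.2.1 e23.symm
  have q12 : 5/12 ≤ wt G S m o1 (m u) ∧ 5/12 ≤ wt G S m o1 (m v) ∧ 
      (g' ∉ S → 1/2 ≤ wt G S m o1 (m u) ∧ 1/2 ≤ wt G S m o1 (m v)) := by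
    by_cases gS : g' ∈ S
    · exact ⟨wD_512 h umD j1 gS og' hD', wD_512 h vmD j4 gS og' hD', fun e => absurd gS e⟩
    · have hN : ∀ r ∈ S, G.Adj o1 r → r = m u ∨ r = m v := fun r hr hh => by
        rcases (full' r).1 hh with e | e | e
        · exact Or.inl e
        · exact Or.inr e
        · exact absurd (e ▸ hr) gS
      have w1 := wD_two h umD j1 hN
      have w2 := wD_two h vmD j4 (fun r hr hh => (hN r hr hh).symm)
      exact ⟨by linarith, by linarith, fun _ => ⟨w1, w2⟩⟩
  rw [e14, e23]
  obtain ⟨w1, w2, w3⟩ := q12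
  by_cases gS : g ∈ S
  · have hweak : ¬ NP G S (m g) := fun hw => by
      obtain ⟨x, xS, xo, xne, xne', _⟩ := hL'.e2 h gS g1.symm k2 g2.symm k4 hw og
      rcases xo with e | e
      · exact xne' (e.trans e14.symm)
      · exact xne (e.trans e23)
    rcases CorA h gS hweak with hA | ⟨p, hC⟩
    · have := wD_A h uD j2 hA og
      have := wD_A h vD j3 hA og
      linarith
    · exfalso
      obtain ⟨gS', mg, ga, gm, pS, pg, pN⟩ := hC.mgS h
      have m1 := mne1 h gS k2
      have m2 := mne2 h gS a1 g1.symm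
      have m3 := mne1 h gS k4
      have m4 := mne2 h gS a3 g2.symm
      by_cases zp : G.Adj z p
      · obtain ⟨x, p1, p2, p3, p4, q1, q2, q3, q4, r1, r2⟩ := h.ex2 (a := m u) (b := z) (a' := o2) (b' := g) a1 a3 gS
          c3.symm hvm g1.symm k2 g2.symm k4 zu.symm og (fun e => s2 (e ▸ a2)) k2.symm z2.symm (fun e => zS (e ▸ gS))
          (by simp) (fun e => absurd e zS) (fun e => absurd e s2) (by simp)
        have hxS : x ∉ S := by
          intro hx
          rcases r2 hx with rfl | rfl | rfl | rfl | rfl | rfl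
          · exact q3 j2.symm
          · exact p1 rfl
          · exact q3 j3.symm
          · exact q2 zv.symm
          · exact p4 rfl
          · exact q4 ga.symm
        obtain ⟨y1, y2, y3, y4⟩ := hL'.y h hxS
        have hN : ∀ s ∈ S, G.Adj x s → s = m g := by
          intro s hs hxs
          rcases r1 s hs hxs with rfl | rfl | rfl | rfl | rfl | rfl
          · exact absurd (y1.1 hxs) p3
          · exact absurd hxs q1
          · exact absurd ((y3.1 hxs).trans e23) p3
          · rcases y4.1 hxs with e | e
            · exact absurd e p2
            · rw [e, e14] at q1; exact absurd j1 q1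
          · exact absurd hxs q4
          · rfl
        obtain ⟨s, hs, hxs⟩ := h.dom x hxS
        have hs' := hN s hs hxs
        subst hs'
        have := Pv_uniq gS hC.2.2.1 hC.2.2.2 ⟨hxS, hxs, hN⟩
        subst this
        exact q2 zp.symm
      · have nfull : ∀ t, t ∉ S → ¬ G.Adj o2 t := by
          intro t ht hh
          rcases (full t).1 hh with e | e | e
          · exact ht (e ▸ a1)
          · exact ht (e ▸ a3)
          · exact ht (e ▸ gS)
        have hx := h.lx3 (k := m u) (l := v) (n := m g) (a := z) (b := o2) (c := p) a2 a3 gS' hvm (by rw [b1]; exact c3.symm)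
          m2 (by rw [b1]; exact m1) m3 m4 zS s2 pS z2.symm (by rintro rfl; exact m2 (pN _ a2 zu).symm) 
          (by rintro rfl; exact m1 (pN _ a1 j2).symm) zu.symm j3.symm pg.symm (by
            rw [b1, mg]
            intro x xS p1 p2 p3 q1 q2 q3 r1 r2 r3 r
            obtain ⟨y1, y2, y3, y4⟩ := hL'.y h xS
            refine dom1 h xS (a := g) (fun s hs hxs => ?_) hC.2.1
            rcases r s hs hxs with rfl | rfl | rfl
            · exact absurd (y1.1 hxs) p2
            · rcases y4.1 hxs with e | e
              · exact absurd e p1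
              · rw [e, e14] at q1; exact absurd j1 q1
            · rfl)
        rw [b1, mg, io0 (nfull _ zS), io0 (fun e => zp e.symm), io0 (fun e => nfull _ pS e.symm)] at hx
        have d1 : 2 ≤ dg G (S \ {u, m v, g}) u := dg_ge2 (k := m u) (l := v) (by simp [a2, c1.symm, c6, k2.symm])
          (by simp [a3, c3.symm, c2, g2]) c5 ((Nu _).2 (by simp)) ((Nu _).2 (by simp))
        have d2 : 1 ≤ dg G (S \ {u, m v, g}) (m v) := dg_ge1 (k := v) (by simp [a3, c3.symm, c2, g2]) (h.madj a3).symm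
        have d3 : 1 ≤ dg G (S \ {u, m v, g}) g := dg_ge1 (k := m g) (by simp [gS', m1, m4, gm.symm]) ga
        have d4 : dg G (S \ {u, m v, g}) z ≤ 1 := dg_le1 (k := m u) (by
          simp only [mem_sdiff, mem_insert, mem_singleton, not_or]
          intro t ht hadj
          rcases (zN t ht.1).1 hadj with e | e
          · exact e
          · exact absurd e ht.2.2.1)
        have d5 : dg G (S \ {u, m v, g}) o2 ≤ 1 := dg_le1 (k := v) (by
          simp only [mem_sdiff, mem_insert, mem_singleton, not_or]
          intro t ht hadj
          rcases (full t).1 hadj with e | e | e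
          · exact absurd e ht.2.1
          · exact e
          · exact absurd e ht.2.2.2)
        have d6 : dg G (S \ {u, m v, g}) p ≤ 1 := dg_le1 (k := m g) (fun t ht hadj => pN t (mem_sdiff.1 ht).1 hadj)
        omega
  · have hN : ∀ r ∈ S, G.Adj o2 r → r = u ∨ r = v := fun r hr hh => by
      rcases (full r).1 hh with e | e | e
      · exact Or.inl e
      · exact Or.inr e
      · exact absurd (e ▸ hr) gS
    have w4 := wD_two h uD j2 hN
    have w5 := wD_two h vD j3 (fun r hr hh => (hN r hr hh).symm)
    by_cases gS' : g' ∈ S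
    swap
    · obtain ⟨w6, w7⟩ := w3 gS'
      linarith
    exfalso
    by_cases oz : G.Adj o2 z
    · obtain ⟨x, p1, p2, q1, q2, r1, r2⟩ := h.ex1 (a := o2) (b := z) a1 a3 c3.symm hvm oz 
        (fun e => absurd e s2) (fun e => absurd e zS)
      have hxS : x ∉ S := by
        intro hx
        rcases r2 hx with rfl | rfl | rfl | rfl
        · exact q1 j2.symm
        · exact q2 zu.symm
        · exact q1 j3.symm
        · exact q2 zv.symm
      obtain ⟨y1, y2, y3, y4⟩ := hL'.y h hxS
      have hx : x = o1 := by
        obtain ⟨s, hs, hxs⟩ := h.dom x hxS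
        rcases r1 s hs hxs with rfl | rfl | rfl | rfl
        · exact absurd (y1.1 hxs) p1
        · rcases y2.1 hxs with e | e
          · exact absurd e p2
          · exact e
        · exact absurd ((y3.1 hxs).trans e23) p1
        · rcases y4.1 hxs with e | e
          · exact absurd e p2
          · exact e.trans e14
      subst hx
      rcases r1 _ gS' og' with e | e | e | e
      · exact k1' e
      · exact g1' e.symm
      · exact k3' e
      · exact g2' e.symm
    · have hx := h.lx2 (k := m u) (l := v) (a := z) (b := o2) a2 a3 hvm (by rw [b1]; exact c3.symm) zS s2 z2.symm
        zu.symm j3.symm (by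
        rw [b1]
        intro x xS p1 p2 q1 q2 q3 q4 r
        obtain ⟨y1, y2, y3, y4⟩ := hL'.y h xS
        obtain ⟨s, hs, hxs⟩ := h.dom x xS
        rcases r s hs hxs with rfl | rfl
        · exact absurd (y1.1 hxs) p2
        · rcases y4.1 hxs with e | e
          · exact absurd e p1
          · rw [e, e14] at q1; exact absurd j1 q1)
      rw [b1, io0 oz] at hx
      have d1 : 2 ≤ dg G (S \ {u, m v}) u := dg_ge2 (k := m u) (l := v) (by simp [a2, c1.symm, c6])
          (by simp [a3, c3.symm, c2]) c5 ((Nu _).2 (by simp)) ((Nu _).2 (by simp))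
      have d2 : 1 ≤ dg G (S \ {u, m v}) (m v) := dg_ge1 (k := v) (by simp [a3, c3.symm, c2]) (h.madj a3).symm
      have d4 : dg G (S \ {u, m v}) z ≤ 1 := dg_le1 (k := m u) (by
          simp only [mem_sdiff, mem_insert, mem_singleton, not_or]
          intro t ht hadj
          rcases (zN t ht.1).1 hadj with e | e
          · exact e
          · exact absurd e ht.2.2)
      have d5 : dg G (S \ {u, m v}) o2 ≤ 1 := dg_le1 (k := v) (by
          simp only [mem_sdiff, mem_insert, mem_singleton, not_or]
          intro t ht hadj
          rcases hN t ht.1 hadj with e | e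
          · exact absurd e ht.2.1
          · exact e)
      omega

end
end PDom

open Finset
set_option linter.unusedSectionVars false
set_option linter.unusedVariables false
set_option linter.unusedSimpArgs false
namespace PDom
section
variable {V : Type*} [Fintype V] [DecidableEq V] {G : SimpleGraph V} [DecidableRel G.Adj]
  {S : Finset V} {m : V → V}

variable {u v z o1 o2 o3 o4 : V}

theorem isC.ne (h : Opt G S m) {g p d : V} (hC : isC G S m g p) (hd : isD G S m d) :
    g ≠ d ∧ g ≠ m d ∧ m g ≠ d ∧ m g ≠ m d := by
  have h1 : g ≠ d := fun e => hC.notD (e ▸ hd)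
  have h2 : g ≠ m d := fun e => hC.notD (e ▸ isD_m h hd)
  exact ⟨h1, h2, mne1 h hC.1 h2, mne2 h hC.1 hd.1 h1⟩

theorem Lnk.c1324X (h : Opt G S m) (hL : Lnk G S m u v z o1 o2 o3 o4) (e13 : o3 = o1) (e24 : o4 = o2) (e12 : o1 ≠ o2)
    {g p : V} (hC : isC G S m g p) (og : G.Adj o1 g) (h2 : ∀ s ∈ S, G.Adj o2 s → s = u ∨ s = m v ∨ s = g) : False := by
  have hL' := hL
  obtain ⟨a1, a2, a3, a4, b1, b2, c1, c2, c3, c4, c5, c6, x1, x2, x3, x4, z2, z3, umD, vmD⟩ := hL.f h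
  obtain ⟨j1, j2, j3, j4⟩ := hL.adj
  obtain ⟨uD, vD, hvm, zS, zN, Nu, Nmu, Nv, Nmv, s1, s2, s3, s4, z1, z4⟩ := hL
  rw [e13] at j3
  rw [e24] at j4
  have gS := hC.1
  obtain ⟨gS', mg, ga, gm, pS, pg, pN⟩ := hC.mgS h
  obtain ⟨k1, k2, m1, m2⟩ := hC.ne h uD
  obtain ⟨k3, k4, m3, m4⟩ := hC.ne h vD
  have full := nb3''' h.cub j1 j3 og c5 k2.symm k3.symm
  have zv : G.Adj z (m v) := (zN _ a4).2 (by simp)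
  by_cases op : G.Adj o2 p
  · obtain ⟨x, p1, p2, p3, p4, q1, q2, q3, q4, r1, r2⟩ := h.ex2 (a := o2) (b := m v) (a' := o1) (b' := g) a1 a3 gS
      c3.symm hvm k1 k2 k3 k4 j4 og e12.symm (fun e => s2 (e ▸ gS)) (fun e => s1 (e ▸ a4)) k4.symm
      (fun e => absurd e s2) (by simp) (fun e => absurd e s1) (by simp)
    have hxS : x ∉ S := by
      intro hx
      rcases r2 hx with rfl | rfl | rfl | rfl | rfl | rfl
      · exact q1 j2.symm
      · exact q3 j1.symm
      · exact q3 j3.symm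
      · exact p2 rfl
      · exact p4 rfl
      · exact q4 ga.symm
    obtain ⟨y1, y2, y3, y4⟩ := hL'.y h hxS
    have hN : ∀ s ∈ S, G.Adj x s → s = m g := by
      intro s hs hxs
      rcases r1 s hs hxs with rfl | rfl | rfl | rfl | rfl | rfl
      · exact absurd (y1.1 hxs) p1
      · rcases y2.1 hxs with e | e
        · rw [e] at q2; exact absurd zv q2
        · exact absurd e p3
      · exact absurd ((y3.1 hxs).trans e13) p3
      · exact absurd hxs q2
      · exact absurd hxs q4
      · rfl
    obtain ⟨s, hs, hxs⟩ := h.dom x hxS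
    have hs' := hN s hs hxs
    subst hs'
    have := Pv_uniq gS hC.2.2.1 hC.2.2.2 ⟨hxS, hxs, hN⟩
    subst this
    exact q1 op.symm
  · have nfull : ∀ t, t ∉ S → ¬ G.Adj o1 t := by
      intro t ht hh
      rcases (full t).1 hh with e | e | e
      · exact ht (e ▸ a2)
      · exact ht (e ▸ a3)
      · exact ht (e ▸ gS)
    have hx := h.lx3 (k := m u) (l := m v) (n := m g) (a := o1) (b := o2) (c := p) a2 a4 gS' c6.symm (by rw [b1]; exact c4.symm)
      m2 (by rw [b1]; exact m1) m4 (by rw [b2]; exact m3) s1 s2 pS e12 (by rintro rfl; exact m2 (pN _ a2 j1).symm) 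
      (by rintro rfl; exact m1 (pN _ a1 j2).symm) j1.symm j4.symm pg.symm (by
        rw [b1, b2, mg]
        intro x xS p1 p2 p3 q1 q2 q3 r1 r2 r3 r
        obtain ⟨y1, y2, y3, y4⟩ := hL'.y h xS
        refine dom1 h xS (a := g) (fun s hs hxs => ?_) hC.2.1
        rcases r s hs hxs with rfl | rfl | rfl
        · exact absurd (y1.1 hxs) p2
        · exact absurd ((y3.1 hxs).trans e13) p1
        · rfl)
    rw [b1, b2, mg, io1 ((Nv u).2 (by simp)), io0 (fun e => nfull _ s2 e.symm), io0 (fun e => op e.symm),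
      io0 (fun e => nfull _ pS e.symm)] at hx
    have d1 : 1 ≤ dg G (S \ {u, v, g}) u := dg_ge1 (k := m u) (by simp [a2, c1.symm, c5, k2.symm]) (h.madj a1)
    have d2 : 1 ≤ dg G (S \ {u, v, g}) v := dg_ge1 (k := m v) (by simp [a4, c4.symm, c2.symm, k4.symm]) (h.madj a3)
    have d3 : 1 ≤ dg G (S \ {u, v, g}) g := dg_ge1 (k := m g) (by simp [gS', m1, m3, gm.symm]) ga
    have d4 : dg G (S \ {u, v, g}) o1 ≤ 1 := dg_le1 (k := m u) (by
      simp only [mem_sdiff, mem_insert, mem_singleton, not_or]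
      intro t ht hadj
      rcases (full t).1 hadj with e | e | e
      · exact e
      · exact absurd e ht.2.2.1
      · exact absurd e ht.2.2.2)
    have d5 : dg G (S \ {u, v, g}) o2 ≤ 1 := dg_le1 (k := m v) (by
      simp only [mem_sdiff, mem_insert, mem_singleton, not_or]
      intro t ht hadj
      rcases h2 t ht.1 hadj with e | e | e
      · exact absurd e ht.2.1
      · exact e
      · exact absurd e ht.2.2.2)
    have d6 : dg G (S \ {u, v, g}) p ≤ 1 := dg_le1 (k := m g) (fun t ht hadj => pN t (mem_sdiff.1 ht).1 hadj)
    omega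

theorem Lnk.c1324C (h : Opt G S m) (hL : Lnk G S m u v z o1 o2 o3 o4) (e13 : o3 = o1) (e24 : o4 = o2) (e12 : o1 ≠ o2)
    {g p g' p' : V} (hC : isC G S m g p) (og : G.Adj o1 g) (hC' : isC G S m g' p') (og' : G.Adj o2 g') (gg : g' ≠ g)
    (hw' : ¬ NP G S (m g')) : exc G S m g ∧ exc G S m g' := by
  have hL' := hL
  obtain ⟨a1, a2, a3, a4, b1, b2, c1, c2, c3, c4, c5, c6, x1, x2, x3, x4, z2, z3, umD, vmD⟩ := hL.f h
  obtain ⟨j1, j2, j3, j4⟩ := hL.adj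
  obtain ⟨uD, vD, hvm, zS, zN, Nu, Nmu, Nv, Nmv, s1, s2, s3, s4, z1, z4⟩ := hL
  rw [e13] at j3
  rw [e24] at j4
  have gS := hC.1
  obtain ⟨gS', mg, ga, gm, pS, pg, pN⟩ := hC.mgS h
  obtain ⟨k1, k2, m1, m2⟩ := hC.ne h uD
  obtain ⟨k3, k4, m3, m4⟩ := hC.ne h vD
  have fS := hC'.1
  obtain ⟨fS', mf, fa, fm, qS, qg, qN⟩ := hC'.mgS h
  obtain ⟨k1', k2', m1', m2'⟩ := hC'.ne h uD
  obtain ⟨k3', k4', m3', m4'⟩ := hC'.ne h vD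
  have full := nb3''' h.cub j1 j3 og c5 k2.symm k3.symm
  have full' := nb3''' h.cub j2 j4 og' c4 k1'.symm k4'.symm
  have zu : G.Adj z (m u) := (zN _ a2).2 (by simp)
  have t1 : g' ≠ m g := fun e => hw' (by rw [e, mg]; exact hC.2.1)
  have t2 := mne1 h fS t1
  have t3 := mne2 h fS gS gg
  have pq : p ≠ p' := by rintro rfl; exact t3 (pN _ fS' qg)
  have po1 : p ≠ o1 := by rintro rfl; exact m2 (pN _ a2 j1).symm
  have po2 : p ≠ o2 := by rintro rfl; exact m1 (pN _ a1 j2).symm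
  have qo1 : p' ≠ o1 := by rintro rfl; exact m2' (qN _ a2 j1).symm
  have qo2 : p' ≠ o2 := by rintro rfl; exact m1' (qN _ a1 j2).symm
  by_cases pp : G.Adj p p'
  · have hnd : [u, m u, v, m v, g, m g, g', m g'].Nodup := by
      simp only [List.nodup_cons, List.mem_cons, List.not_mem_nil, or_false, not_or, not_false_eq_true, List.nodup_nil, and_true]
      exact ⟨⟨c1, c3, c4, k1.symm, m1.symm, k1'.symm, m1'.symm⟩, ⟨c5, c6, k2.symm, m2.symm, k2'.symm, m2'.symm⟩,
        ⟨c2, k3.symm, m3.symm, k3'.symm, m3'.symm⟩, ⟨k4.symm, m4.symm, k4'.symm, m4'.symm⟩, ⟨gm, gg.symm, t2.symm⟩,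
        ⟨t1.symm, t3.symm⟩, fm⟩
    have hnl : [o1, m u, o2, g', m g, p].Nodup := by
      have r1 : ∀ s ∈ S, s ≠ o1 := fun s hs e => s1 (e ▸ hs)
      have r2 : ∀ s ∈ S, s ≠ o2 := fun s hs e => s2 (e ▸ hs)
      have r3 : ∀ s ∈ S, s ≠ p := fun s hs e => pS (e ▸ hs)
      simp only [List.nodup_cons, List.mem_cons, List.not_mem_nil, or_false, not_or, not_false_eq_true, List.nodup_nil, and_true]
      exact ⟨⟨(r1 _ a2).symm, e12, (r1 _ fS).symm, (r1 _ gS').symm, po1.symm⟩, ⟨r2 _ a2, k2'.symm, m2.symm, r3 _ a2⟩,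
        ⟨(r2 _ fS).symm, (r2 _ gS').symm, po2.symm⟩, ⟨t1, r3 _ fS⟩, r3 _ gS'⟩
    obtain ⟨x, i1, i2, i3, i4⟩ := h.exch {u, m u, v, m v, g, m g, g', m g'} {o1, m u, o2, g', m g, p} _
      (by simp [a1, a2, a3, a4, gS, gS', fS, fS', b1, b2, mg, mf]) (swm3 j1 og' pg.symm hnl) (by
        intro l hl hlS
        simp only [mem_insert, mem_singleton] at hl ⊢
        rcases hl with rfl | rfl | rfl | rfl | rfl | rfl
        · exact absurd hlS s1
        · simp
        · exact absurd hlS s2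
        · simp
        · simp
        · exact absurd hlS pS) (by rw [card_six hnl, card_eight hnd]; norm_num)
    simp only [mem_insert, mem_singleton, not_or] at i1 i2 i3 i4
    obtain ⟨p1, p2, p3, p4, p5, p6⟩ := i1
    have q1 := i2 o1 (by simp)
    have q2 := i2 (m u) (by simp)
    have q3 := i2 o2 (by simp)
    have q4 := i2 g' (by simp)
    have q5 := i2 (m g) (by simp)
    have q6 := i2 p (by simp)
    have hxS : x ∉ S := by
      intro hx
      rcases i4 hx with rfl | rfl | rfl | rfl | rfl | rfl | rfl | rfl
      · exact q3 j2.symm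
      · exact p2 rfl
      · exact q1 j3.symm
      · exact q3 j4.symm
      · exact q5 ga
      · exact p5 rfl
      · exact p4 rfl
      · exact q4 fa.symm
    obtain ⟨y1, y2, y3, y4⟩ := hL'.y h hxS
    have hN : ∀ s ∈ S, G.Adj x s → s = g ∨ s = m g' := by
      intro s hs hxs
      rcases i3 s hs hxs with rfl | rfl | rfl | rfl | rfl | rfl | rfl | rfl
      · exact absurd (y1.1 hxs) p3
      · exact absurd hxs q2
      · exact absurd ((y3.1 hxs).trans e13) p1
      · rcases y4.1 hxs with e | e
        · rw [e] at q2; exact absurd zu q2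
        · exact absurd (e.trans e24) p3
      · exact Or.inl rfl
      · exact absurd hxs q5
      · exact absurd hxs q4
      · exact Or.inr rfl
    have xf : G.Adj x (m g') := by
      by_contra hh
      refine dom1 h hxS (a := g) (fun s hs hxs => ?_) hC.2.1
      rcases hN s hs hxs with e | e
      · exact e
      · rw [e] at hxs; exact absurd hxs hh
    have xg : G.Adj x g := by
      by_contra hh
      have hN' : ∀ s ∈ S, G.Adj x s → s = m g' := fun s hs hxs => by
        rcases hN s hs hxs with e | e
        · rw [e] at hxs; exact absurd hxs hh
        · exact e
      have := Pv_uniq fS hC'.2.2.1 hC'.2.2.2 ⟨hxS, xf, hN'⟩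
      subst this
      exact q6 pp.symm
    have hBC := (isBC_iff_m h fS).2 hC'.isBC
    have hN2 : ∀ s ∈ S, G.Adj x s ↔ s = g ∨ s = m g' := fun s hs => ⟨hN s hs, by rintro (rfl | rfl) <;> assumption⟩
    exact ⟨⟨x, hxS, Or.inl xg, g, m g', t2.symm, hC.isBC, hBC, hN2⟩,
      ⟨x, hxS, Or.inr xf, g, m g', t2.symm, hC.isBC, hBC, hN2⟩⟩
  · by_cases hex : ∃ x, x ∉ S ∧ ∀ s ∈ S, G.Adj x s ↔ s = g ∨ s = g'
    · obtain ⟨x, hxS, hN⟩ := hex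
      exact ⟨⟨x, hxS, Or.inl ((hN g gS).2 (by simp)), g, g', gg.symm, hC.isBC, hC'.isBC, hN⟩,
        ⟨x, hxS, Or.inl ((hN g' fS).2 (by simp)), g, g', gg.symm, hC.isBC, hC'.isBC, hN⟩⟩
    · exfalso
      have nfull : ∀ t, t ∉ S → ¬ G.Adj t o1 := by
        intro t ht hh
        rcases (full t).1 hh.symm with e | e | e
        · exact ht (e ▸ a2)
        · exact ht (e ▸ a3)
        · exact ht (e ▸ gS)
      have nfull' : ∀ t, t ∉ S → ¬ G.Adj t o2 := by
        intro t ht hh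
        rcases (full' t).1 hh.symm with e | e | e
        · exact ht (e ▸ a1)
        · exact ht (e ▸ a4)
        · exact ht (e ▸ fS)
      have hx := h.lx4 (k := m u) (l := m v) (n := m g) (o := m g') (a := o1) (b := o2) (c := p) (d := p') a2 a4 gS' fS' (by
        rw [b1, b2, mg, mf]
        simp only [List.nodup_cons, List.mem_cons, List.not_mem_nil, or_false, not_or, not_false_eq_true, List.nodup_nil, and_true]
        exact ⟨⟨c1.symm, c6, c5, m2.symm, k2.symm, m2'.symm, k2'.symm⟩, ⟨c4, c3, m1.symm, k1.symm, m1'.symm, k1'.symm⟩,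
          ⟨c2.symm, m4.symm, k4.symm, m4'.symm, k4'.symm⟩, ⟨m3.symm, k3.symm, m3'.symm, k3'.symm⟩,
          ⟨gm.symm, t3.symm, t1.symm⟩, ⟨t2.symm, gg.symm⟩, fm.symm⟩) s1 s2 pS qS (by
        simp only [List.nodup_cons, List.mem_cons, List.not_mem_nil, or_false, not_or, not_false_eq_true, List.nodup_nil, and_true]
        exact ⟨⟨e12, po1.symm, qo1.symm⟩, ⟨po2.symm, qo2.symm⟩, pq⟩) j1.symm j4.symm pg.symm qg.symm (by
        rw [b1, b2, mg, mf]
        intro x xS p1 p2 p3 p4 _ _ _ _ _ _ _ _ r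
        obtain ⟨y1, y2, y3, y4⟩ := hL'.y h xS
        have hN : ∀ s ∈ S, G.Adj x s → s = g ∨ s = g' := by
          intro s hs hxs
          rcases r s hs hxs with rfl | rfl | rfl | rfl
          · exact absurd (y1.1 hxs) p2
          · exact absurd ((y3.1 hxs).trans e13) p1
          · exact Or.inl rfl
          · exact Or.inr rfl
        obtain ⟨d1, d2⟩ := dom2 h xS hN hC.2.1 hC'.2.1
        exact hex ⟨x, xS, fun s hs => ⟨hN s hs, by rintro (rfl | rfl) <;> assumption⟩⟩)
      rw [b1, b2, mg, mf, io1 ((Nv u).2 (by simp)), io0 (nfull _ s2), io0 (nfull _ pS), io0 (nfull _ qS),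
        io0 (nfull' _ pS), io0 (nfull' _ qS), io0 (fun e => pp e.symm)] at hx
      have d1 : 1 ≤ dg G (S \ {u, v, g, g'}) u := dg_ge1 (k := m u) (by simp [a2, c1.symm, c5, k2.symm, k2'.symm]) (h.madj a1)
      have d2 : 1 ≤ dg G (S \ {u, v, g, g'}) v := dg_ge1 (k := m v) (by simp [a4, c4.symm, c2.symm, k4.symm, k4'.symm]) (h.madj a3)
      have d3 : 1 ≤ dg G (S \ {u, v, g, g'}) g := dg_ge1 (k := m g) (by simp [gS', m1, m3, gm.symm, t1.symm]) ga
      have d3' : 1 ≤ dg G (S \ {u, v, g, g'}) g' := dg_ge1 (k := m g') (by simp [fS', m1', m3', fm.symm, t2]) fa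
      have d4 : dg G (S \ {u, v, g, g'}) o1 ≤ 1 := dg_le1 (k := m u) (by
        simp only [mem_sdiff, mem_insert, mem_singleton, not_or]
        intro t ht hadj
        rcases (full t).1 hadj with e | e | e
        · exact e
        · exact absurd e ht.2.2.1
        · exact absurd e ht.2.2.2.1)
      have d5 : dg G (S \ {u, v, g, g'}) o2 ≤ 1 := dg_le1 (k := m v) (by
        simp only [mem_sdiff, mem_insert, mem_singleton, not_or]
        intro t ht hadj
        rcases (full' t).1 hadj with e | e | e
        · exact absurd e ht.2.1
        · exact e
        · exact absurd e ht.2.2.2.2)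
      have d6 : dg G (S \ {u, v, g, g'}) p ≤ 1 := dg_le1 (k := m g) (fun t ht hadj => pN t (mem_sdiff.1 ht).1 hadj)
      have d7 : dg G (S \ {u, v, g, g'}) p' ≤ 1 := dg_le1 (k := m g') (fun t ht hadj => qN t (mem_sdiff.1 ht).1 hadj)
      omega

theorem Lnk.c1324 (h : Opt G S m) (hL : Lnk G S m u v z o1 o2 o3 o4) (e13 : o3 = o1) (e24 : o4 = o2) (e12 : o1 ≠ o2) :
    2 ≤ wt G S m o1 (m u) + wt G S m o2 u + wt G S m o3 v + wt G S m o4 (m v) := by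
  have hL' := hL
  obtain ⟨a1, a2, a3, a4, b1, b2, c1, c2, c3, c4, c5, c6, x1, x2, x3, x4, z2, z3, umD, vmD⟩ := hL.f h
  obtain ⟨j1, j2, j3, j4⟩ := hL.adj
  obtain ⟨uD, vD, hvm, zS, zN, Nu, Nmu, Nv, Nmv, s1, s2, s3, s4, z1, z4⟩ := hL
  rw [e13] at j3
  rw [e24] at j4
  obtain ⟨g, g2, g3, full⟩ := nb3'' h.cub j1 j3 c5
  have og : G.Adj o1 g := (full g).2 (by simp)
  obtain ⟨g', f1, f4, full'⟩ := nb3'' h.cub j2 j4 c4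
  have og' : G.Adj o2 g' := (full' g').2 (by simp)
  obtain ⟨k1, -, -, k4⟩ := hL'.nC h s1 z1 og
  obtain ⟨-, k2', k3', -⟩ := hL'.nC h s2 z2 og'
  replace k1 := k1 e12
  replace k4 := k4 (by rw [e24]; exact e12)
  replace k2' := k2' e12.symm
  replace k3' := k3' (by rw [e13]; exact e12.symm)
  have hw : g ∈ S → ¬ NP G S (m g) := fun gS hw => 
    (hL'.e1 h gS k1 g2.symm g3.symm k4 hw og).2.2.2.1 e24.symm
  have hw' : g' ∈ S → ¬ NP G S (m g') := fun gS hw => 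
    ((hL'.symm h).e1 h gS k3' f4.symm f1.symm k2' hw (by rw [e24]; exact og')).2.2.2.1 e13
  have A1 : g ∉ S → ∀ r ∈ S, G.Adj o1 r → r = m u ∨ r = v := fun gS r hr hh => by
    rcases (full r).1 hh with e | e | e
    · exact Or.inl e
    · exact Or.inr e
    · exact absurd (e ▸ hr) gS
  have A2 : g' ∉ S → ∀ r ∈ S, G.Adj o2 r → r = u ∨ r = m v := fun gS r hr hh => by
    rcases (full' r).1 hh with e | e | e
    · exact Or.inl e
    · exact Or.inr e
    · exact absurd (e ▸ hr) gS
  have B1 : 5/12 ≤ wt G S m o1 (m u) ∧ 5/12 ≤ wt G S m o1 v := by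
    by_cases gS : g ∈ S
    · have gD : ¬ isD G S m g := fun e => hw gS e.2.2
      exact ⟨wD_512 h umD j1 gS og gD, wD_512 h vD j3 gS og gD⟩
    · have := wD_two h umD j1 (A1 gS)
      have := wD_two h vD j3 (fun r hr hh => (A1 gS r hr hh).symm)
      constructor <;> linarith
  have B2 : 5/12 ≤ wt G S m o2 u ∧ 5/12 ≤ wt G S m o2 (m v) := by
    by_cases gS : g' ∈ S
    · have gD : ¬ isD G S m g' := fun e => hw' gS e.2.2
      exact ⟨wD_512 h uD j2 gS og' gD, wD_512 h vmD j4 gS og' gD⟩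
    · have := wD_two h uD j2 (A2 gS)
      have := wD_two h vmD j4 (fun r hr hh => (A2 gS r hr hh).symm)
      constructor <;> linarith
  obtain ⟨B1, B1'⟩ := B1
  obtain ⟨B2, B2'⟩ := B2
  rw [e13, e24]
  by_cases gS : g ∈ S
  · rcases CorA h gS (hw gS) with hA | ⟨p, hC⟩
    · have := wD_A h umD j1 hA og
      have := wD_A h vD j3 hA og
      linarith
    by_cases gS' : g' ∈ S
    · rcases CorA h gS' (hw' gS') with hA | ⟨p', hC'⟩
      · have := wD_A h uD j2 hA og'
        have := wD_A h vmD j4 hA og'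
        linarith
      · by_cases gg : g' = g
        · exact (hL'.c1324X h e13 e24 e12 hC og (fun s hs hh => by rw [← gg]; exact (full' s).1 hh)).elim
        · obtain ⟨i, j⟩ := hL'.c1324C h e13 e24 e12 hC og hC' og' gg (hw' gS')
          have := wD_exc h umD j1 gS og hC.notD hC.2.2.1 i
          have := wD_exc h vD j3 gS og hC.notD hC.2.2.1 i
          have := wD_exc h uD j2 gS' og' hC'.notD hC'.2.2.1 j
          have := wD_exc h vmD j4 gS' og' hC'.notD hC'.2.2.1 j
          linarith
    · exact (hL'.c1324X h e13 e24 e12 hC og (fun s hs hh => by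
        rcases A2 gS' s hs hh with e | e
        · exact Or.inl e
        · exact Or.inr (Or.inl e))).elim
  · have w1 := wD_two h umD j1 (A1 gS)
    have w2 := wD_two h vD j3 (fun r hr hh => (A1 gS r hr hh).symm)
    by_cases gS' : g' ∈ S
    · rcases CorA h gS' (hw' gS') with hA | ⟨p', hC'⟩
      · have := wD_A h uD j2 hA og'
        have := wD_A h vmD j4 hA og'
        linarith
      · exact ((hL'.symm h).c1324X h e24.symm e13.symm (by rw [e24, e13]; exact e12.symm) hC' (by rw [e24]; exact og')
          (fun s hs hh => by
            rw [e13] at hh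
            rcases A1 gS s hs hh with e | e
            · exact Or.inr (Or.inl e)
            · exact Or.inl e)).elim
    · have w3 := wD_two h uD j2 (A2 gS')
      have w4 := wD_two h vmD j4 (fun r hr hh => (A2 gS' r hr hh).symm)
      linarith

end
end PDom

open Finset
set_option linter.unusedSectionVars false
set_option linter.unusedVariables false
set_option linter.unusedSimpArgs false
namespace PDom
section
variable {V : Type*} [Fintype V] [DecidableEq V] {G : SimpleGraph V} [DecidableRel G.Adj]
  {S : Finset V} {m : V → V}

variable {u v z o1 o2 o3 o4 : V}

theorem Lnk.W (h : Opt G S m) (hL : Lnk G S m u v z o1 o2 o3 o4) :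
    2 ≤ wt G S m o1 (m u) + wt G S m o2 u + wt G S m o3 v + wt G S m o4 (m v) := by
  have hM := hL.symm h
  by_cases e12 : o2 = o1
  · have e13 : o1 ≠ o3 := fun e => hM.t1 h (e12.trans e) e
    have e14 : o1 ≠ o4 := fun e => hM.t2 h (e12.trans e) e
    have w1 := hL.c12 h e12 e13 e14
    by_cases e34 : o3 = o4
    · have := hM.c12 h e34 (by rw [e12]; exact e14.symm) e14.symm
      linarith
    · have := hM.halfweak h (fun e => e34 e.symm) (by rw [e12]; exact e14.symm) e14.symm
      linarith
  have n12 : o1 ≠ o2 := fun e => e12 e.symm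
  by_cases e34 : o3 = o4
  · have e13 : o1 ≠ o3 := fun e => hL.t2 h e.symm (e34.symm.trans e.symm)
    have e14 : o1 ≠ o4 := by rw [← e34]; exact e13
    have e24 : o4 ≠ o2 := fun e => hL.t1 h (e34.trans e) e
    have w1 := hM.c12 h e34 e24 e14.symm
    have := hL.halfweak h n12 e13 e14
    linarith
  have n43 : o4 ≠ o3 := fun e => e34 e.symm
  by_cases e13 : o3 = o1
  · by_cases e24 : o4 = o2
    · exact hL.c1324 h e13 e24 n12
    · exact hL.c13 h e13 n12 (fun e => n43 (e.symm.trans e13.symm)) (fun e => e24 e.symm)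
  have n13 : o1 ≠ o3 := fun e => e13 e.symm
  by_cases e24 : o4 = o2
  · have := hM.c13 h e24.symm n43 (fun e => n12 (e.symm.trans e24)) e13
    linarith
  have n24 : o2 ≠ o4 := fun e => e24 e.symm
  by_cases e14 : o4 = o1
  · by_cases e23 : o3 = o2
    · exact hL.c1423 h e14 e23 n12
    · have := hL.c14 h e14 n12 n13 (fun e => e23 e.symm)
      have := hM.c14 h e14.symm n43 e24 e23
      linarith
  have n14 : o1 ≠ o4 := fun e => e14 e.symm
  by_cases e23 : o3 = o2
  · have := hL.c23 h e23 n12 n14 n24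
    have := hM.c23 h e23.symm n43 e14 e13
    linarith
  have := hL.half h n12 n13 n14 (fun e => e23 e.symm) n24
  have := hM.half h n43 e24 e14 e23 e13
  linarith

theorem ch_one {s a b : V} (hs : s ∈ S) (ha : a ∈ S) (hm : m s ∈ S) (hb : b ∉ S)
    (hN : ∀ t, G.Adj s t ↔ t = m s ∨ t = a ∨ t = b) : ch G S m s = wt G S m b s := by
  classical
  unfold ch
  have : (univ.filter (fun x => x ∉ S ∧ G.Adj s x)) = {b} := by
    ext x
    simp only [mem_filter, mem_univ, true_and, mem_singleton, hN]
    constructor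
    · rintro ⟨h1, rfl | rfl | rfl⟩
      · exact absurd hm h1
      · exact absurd ha h1
      · rfl
    · rintro rfl; exact ⟨hb, by simp⟩
  exact (sum_congr (by convert this) (fun _ _ => rfl)).trans (sum_singleton _ _)

theorem ch_two {s r a b : V} (hr : r ∈ S) (ha : a ∉ S) (hb : b ∉ S) (hab : a ≠ b)
    (hN : ∀ t, G.Adj s t ↔ t = r ∨ t = a ∨ t = b) : ch G S m s = wt G S m a s + wt G S m b s := by
  classical
  unfold ch
  have : (univ.filter (fun x => x ∉ S ∧ G.Adj s x)) = {a, b} := by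
    ext x
    simp only [mem_filter, mem_univ, true_and, mem_singleton, hN, mem_insert]
    constructor
    · rintro ⟨h1, rfl | rfl | rfl⟩
      · exact absurd hr h1
      · simp
      · simp
    · rintro (rfl | rfl)
      · exact ⟨ha, by simp⟩
      · exact ⟨hb, by simp⟩
  exact (sum_congr (by convert this) (fun _ _ => rfl)).trans (sum_pair hab)

theorem pairDD (h : Opt G S m) (hu : isD G S m u) (hv : isD G S m v) (huv : G.Adj u v) (hvm : v ≠ m u) :
    3/2 ≤ fin G S m u + fin G S m (m u) := by
  have a1 := hu.1
  have a3 := hv.1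
  have a2 := h.mS a1
  have a4 := h.mS a3
  have b1 := h.mm a1
  have b2 := h.mm a3
  have hum : u ≠ m v := fun e => hvm (by rw [e, b2])
  have c6 : m u ≠ m v := fun e => huv.ne (by rw [← b1, e, b2])
  obtain ⟨o2, n1, n2, Nu⟩ := nb3'' h.cub (h.madj a1) huv hvm.symm
  by_cases s2 : o2 ∈ S
  · exact pairD31 h hu a3 s2 hvm.symm n1 n2 Nu
  obtain ⟨z, zS, zu, zv, zN⟩ := h.F2 a1 a3 huv hvm
  obtain ⟨zmu, zmv⟩ := dom2 h zS zN hu.2.2 hv.2.2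
  obtain ⟨o3, n3, n4, Nv⟩ := nb3'' h.cub (h.madj a3) huv.symm hum.symm
  have s3 : o3 ∉ S := by
    intro hs
    have hh := h.F1b a3 hv.2.1 a1 huv.symm hum hs ((Nv o3).2 (by simp)) n3.symm n4 zS zmv
    obtain ⟨r, r1, r2, full⟩ := nb3'' h.cub zmu zmv c6
    have := (hh r ((full r).2 (by simp))).1
    rcases zN r this ((full r).2 (by simp)) with e | e
    · exact r1 e.symm
    · exact r2 e.symm
  obtain ⟨o1, q1, q2, Nmu⟩ := nb3'' h.cub (h.madj a1).symm zmu.symm (by rintro rfl; exact zS a1)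
  obtain ⟨o4, q3, q4, Nmv⟩ := nb3'' h.cub (h.madj a3).symm zmv.symm (by rintro rfl; exact zS a3)
  have s1 : o1 ∉ S := fun hs => q1 (h.leafm a1 hu.2.1 a3 huv hvm o1 hs ((Nmu o1).2 (by simp))).symm
  have s4 : o4 ∉ S := fun hs => q3 (h.leafm a3 hv.2.1 a1 huv.symm hum o4 hs ((Nmv o4).2 (by simp))).symm
  have hL : Lnk G S m u v z o1 o2 o3 o4 := ⟨hu, hv, hvm, zS, fun s hs => ⟨zN s hs, by rintro (rfl | rfl) <;> assumption⟩,
    Nu, Nmu, Nv, Nmv, s1, s2, s3, s4, q2.symm, q4.symm⟩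
  have hW := hL.W h
  have w1 := wD_two h (isD_m h hu) zmu zN
  have w2 := wD_two h (isD_m h hv) zmv (fun r hr hh => (zN r hr hh).symm)
  rw [fin_eq hvm.symm n1 n2 Nu, fin_eq (s := m u) (a := z) (b := o1) (by rw [b1]; rintro rfl; exact zS a1)
    (by rw [b1]; exact q1) q2 (by rw [b1]; exact Nmu), ctr_int a3, ctr_ext s2, ctr_ext zS, ctr_ext s1]
  unfold tr
  rw [if_pos ⟨hu, hv⟩, ch_one a1 a3 a2 s2 Nu, ch_one a3 a1 a4 s3 Nv, ch_two a1 zS s1 q2 Nmu, ch_two a3 zS s4 q4 Nmv]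
  have g1 : give G S m v u = 0 := by
    unfold give; rw [if_neg (fun e => not_A_of_D hv e.1), if_neg (fun e => e.2.2.1 hu)]
  have g2 : give G S m u v = 0 := by
    unfold give; rw [if_neg (fun e => not_A_of_D hu e.1), if_neg (fun e => e.2.2.1 hv)]
  rw [g1, g2]
  linarith

end
end PDom

open Finset
set_option linter.unusedSectionVars false
set_option linter.unusedVariables false
set_option linter.unusedSimpArgs false
namespace PDom
section
variable {V : Type*} [Fintype V] [DecidableEq V] {G : SimpleGraph V} [DecidableRel G.Adj]
  {S : Finset V} {m : V → V}

variable {u y1 y2 x1 x2 : V}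

/-- a D-pair with all four outer neighbours outside `S` -/
structure D11 (G : SimpleGraph V) (S : Finset V) (m : V → V) (u y1 y2 x1 x2 : V) : Prop where
  D : isD G S m u
  Nu : ∀ t, G.Adj u t ↔ t = m u ∨ t = y1 ∨ t = y2
  Nm : ∀ t, G.Adj (m u) t ↔ t = u ∨ t = x1 ∨ t = x2
  hy1 : y1 ∉ S
  hy2 : y2 ∉ S
  hx1 : x1 ∉ S
  hx2 : x2 ∉ S
  yy : y1 ≠ y2
  xx : x1 ≠ x2

theorem D11.swY (d : D11 G S m u y1 y2 x1 x2) : D11 G S m u y2 y1 x1 x2 :=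
  ⟨d.D, fun t => by rw [d.Nu t]; constructor <;> (rintro (h | h | h) <;> simp [h]), d.Nm, d.hy2, d.hy1, d.hx1, d.hx2, d.yy.symm, d.xx⟩
theorem D11.swX (d : D11 G S m u y1 y2 x1 x2) : D11 G S m u y1 y2 x2 x1 :=
  ⟨d.D, d.Nu, fun t => by rw [d.Nm t]; constructor <;> (rintro (h | h | h) <;> simp [h]), d.hy1, d.hy2, d.hx2, d.hx1, d.yy, d.xx.symm⟩
theorem D11.swU (h : Opt G S m) (d : D11 G S m u y1 y2 x1 x2) : D11 G S m (m u) x1 x2 y1 y2 :=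
  ⟨isD_m h d.D, by rw [h.mm d.D.1]; exact d.Nm, by rw [h.mm d.D.1]; exact d.Nu, d.hx1, d.hx2, d.hy1, d.hy2, d.xx, d.yy⟩

theorem triEx (h : Opt G S m) {y w : V} (hu : isD G S m u) (hw : isD G S m w) (w1 : w ≠ u) (w2 : w ≠ m u)
    (hy : y ∉ S) (hyu : G.Adj y u) (hyu' : G.Adj y (m u)) (hyw : G.Adj y w) :
    ∃ z, z ∉ S ∧ z ≠ y ∧ ¬ G.Adj z w ∧ (∀ s ∈ S, G.Adj z s → s = u ∨ s = m u ∨ s = m w) ∧ (G.Adj z u ∨ G.Adj z (m u)) := by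
  obtain ⟨z, k1, k2, k3, k4, k5, k6⟩ := h.ex1 (a := y) (b := w) hu.1 hw.1 w1 w2 hyw (fun q => absurd q hy) (by intro; simp)
  have hz : z ∉ S := by
    intro hz
    rcases k6 hz with rfl | rfl | rfl | rfl
    · exact k3 hyu.symm
    · exact k3 hyu'.symm
    · exact k2 rfl
    · exact k4 (h.madj hw.1).symm
  have k7 : ∀ s ∈ S, G.Adj z s → s = u ∨ s = m u ∨ s = m w := by
    intro s hs hzs
    rcases k5 s hs hzs with e | e | e | e
    · exact Or.inl e
    · exact Or.inr (Or.inl e)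
    · exact absurd (e ▸ hzs) k4
    · exact Or.inr (Or.inr e)
  refine ⟨z, hz, k1, k4, k7, ?_⟩
  by_contra hh
  push Not at hh
  refine dom1 h hz (a := m w) (fun s hs hzs => ?_) hw.2.2
  rcases k7 s hs hzs with e | e | e
  · exact absurd (e ▸ hzs) hh.1
  · exact absurd (e ▸ hzs) hh.2
  · exact e

theorem tri1 (h : Opt G S m) {y : V} (d : D11 G S m u y y2 y x2) (hne : y2 ≠ x2)
    (hp : ∀ x, ¬ payer G S m x u) (hp' : ∀ x, ¬ payer G S m x (m u)) :
    3/2 ≤ wt G S m y u + wt G S m y2 u + (wt G S m y (m u) + wt G S m x2 (m u)) := by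
  have hu := d.D
  have hu' := isD_m h hu
  have e1 : G.Adj y u := ((d.Nu y).2 (by simp)).symm
  have e2 : G.Adj y (m u) := ((d.Nm y).2 (by simp)).symm
  have e3 : G.Adj y2 u := ((d.Nu y2).2 (by simp)).symm
  have e4 : G.Adj x2 (m u) := ((d.Nm x2).2 (by simp)).symm
  have q1 := wD_third h hu e3 (hp y2)
  have q2 := wD_third h hu' e4 (hp' x2)
  obtain ⟨w, w1, w2, hN⟩ := nb3'' h.cub e1 e2 (h.mne hu.1).symm
  have hyw : G.Adj y w := (hN w).2 (by simp)
  by_cases hw : w ∈ S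
  · by_cases hwD : isD G S m w
    · obtain ⟨z, k1, k2, k3, k4, k5⟩ := triEx h hu hwD w1.symm w2.symm d.hy1 e1 e2 hyw
      have hq3 : 1/3 ≤ wt G S m y u := wD_third h hu e1 (hp y)
      have hq4 : 1/3 ≤ wt G S m y (m u) := wD_third h hu' e2 (hp' y)
      by_cases c1 : G.Adj z u
      · have : z = y2 := by
          rcases (d.Nu z).1 c1.symm with e | e | e
          · exact absurd (e ▸ h.mS hu.1) k1
          · exact absurd e k2
          · exact e
        subst this
        have c2 : ¬ G.Adj z (m u) := by
          intro c2
          rcases (d.Nm z).1 c2.symm with e | e | e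
          · exact absurd (e ▸ hu.1) k1
          · exact absurd e k2
          · exact hne e
        have := wD_two h hu e3 (t := m w) (fun s hs hzs => by
          rcases k4 s hs hzs with e | e | e
          · exact Or.inl e
          · exact absurd (e ▸ hzs) c2
          · exact Or.inr e)
        linarith
      · have c2 := k5.resolve_left c1
        have : z = x2 := by
          rcases (d.Nm z).1 c2.symm with e | e | e
          · exact absurd (e ▸ hu.1) k1
          · exact absurd e k2
          · exact e
        subst this
        have := wD_two h hu' e4 (t := m w) (fun s hs hzs => by
          rcases k4 s hs hzs with e | e | e
          · exact absurd (e ▸ hzs) c1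
          · exact Or.inl e
          · exact Or.inr e)
        linarith
    · have a1 := wD_512 h hu e1 hw hyw hwD
      have a2 := wD_512 h hu' e2 hw hyw hwD
      linarith
  · have a1 := wD_two h hu e1 (t := m u) (fun s hs hzs => by
      rcases (hN s).1 hzs with e | e | e
      · exact Or.inl e
      · exact Or.inr e
      · exact absurd (e ▸ hs) hw)
    have a2 := wD_two h hu' e2 (t := u) (fun s hs hzs => by
      rcases (hN s).1 hzs with e | e | e
      · exact Or.inr e
      · exact Or.inl e
      · exact absurd (e ▸ hs) hw)
    linarith

theorem tri2half (h : Opt G S m) {y w : V} (hu : isD G S m u) (e1 : G.Adj y u) (e2 : G.Adj y (m u))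
    (hN : ∀ t, G.Adj y t ↔ t = u ∨ t = m u ∨ t = w) (hw : ¬ isD G S m w) :
    5/6 ≤ wt G S m y u + wt G S m y (m u) := by
  have hu' := isD_m h hu
  have hyw : G.Adj y w := (hN w).2 (by simp)
  by_cases hwS : w ∈ S
  · have a1 := wD_512 h hu e1 hwS hyw hw
    have a2 := wD_512 h hu' e2 hwS hyw hw
    linarith
  · have a1 := wD_two h hu e1 (t := m u) (fun s hs hzs => by
      rcases (hN s).1 hzs with e | e | e
      · exact Or.inl e
      · exact Or.inr e
      · exact absurd (e ▸ hs) hwS)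
    have a2 := wD_two h hu' e2 (t := u) (fun s hs hzs => by
      rcases (hN s).1 hzs with e | e | e
      · exact Or.inr e
      · exact Or.inl e
      · exact absurd (e ▸ hs) hwS)
    linarith

theorem tri2 (h : Opt G S m) {y y' : V} (d : D11 G S m u y y' y y')
    (hp : ∀ x, ¬ payer G S m x u) (hp' : ∀ x, ¬ payer G S m x (m u)) :
    3/2 ≤ wt G S m y u + wt G S m y' u + (wt G S m y (m u) + wt G S m y' (m u)) := by
  have hu := d.D
  have hu' := isD_m h hu
  have e1 : G.Adj y u := ((d.Nu y).2 (by simp)).symm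
  have e2 : G.Adj y (m u) := ((d.Nm y).2 (by simp)).symm
  have e3 : G.Adj y' u := ((d.Nu y').2 (by simp)).symm
  have e4 : G.Adj y' (m u) := ((d.Nm y').2 (by simp)).symm
  have q1 := wD_third h hu e3 (hp y')
  have q2 := wD_third h hu' e4 (hp' y')
  have q3 := wD_third h hu e1 (hp y)
  have q4 := wD_third h hu' e2 (hp' y)
  obtain ⟨w, w1, w2, hN⟩ := nb3'' h.cub e1 e2 (h.mne hu.1).symm
  obtain ⟨w', w3, w4, hN'⟩ := nb3'' h.cub e3 e4 (h.mne hu.1).symm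
  by_cases hw : isD G S m w
  swap
  · linarith [tri2half h hu e1 e2 hN hw]
  by_cases hw' : isD G S m w'
  swap
  · linarith [tri2half h hu e3 e4 hN' hw']
  have hyw : G.Adj y w := (hN w).2 (by simp)
  have hyw' : G.Adj y' w' := (hN' w').2 (by simp)
  obtain ⟨z, k1, k2, k3, k4, k5⟩ := triEx h hu hw w1.symm w2.symm d.hy1 e1 e2 hyw
  have : z = y' := by
    rcases k5 with c1 | c1
    · rcases (d.Nu z).1 c1.symm with e | e | e
      · exact absurd (e ▸ h.mS hu.1) k1
      · exact absurd e k2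
      · exact e
    · rcases (d.Nm z).1 c1.symm with e | e | e
      · exact absurd (e ▸ hu.1) k1
      · exact absurd e k2
      · exact e
  subst this
  have hww : w' = m w := by
    rcases k4 w' hw'.1 hyw' with e | e | e
    · exact absurd e w3.symm
    · exact absurd e w4.symm
    · exact e
  subst hww
  have p1 : payer G S m y w := ⟨u, hu, hw, w1.symm, w2.symm, fun t _ => hN t, Or.inr ⟨z, k1, k2, fun t _ => hN' t⟩⟩
  have p2 : payer G S m z (m w) := ⟨u, hu, hw', w3.symm, w4.symm, fun t _ => hN' t, Or.inr ⟨y, d.hy1, k2.symm, fun t _ => by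
    rw [h.mm hw.1]; exact hN t⟩⟩
  rw [wt_recv hu e1 p1 w1 h, wt_recv hu' e2 p1 w2 h, wt_recv hu e3 p2 w3 h, wt_recv hu' e4 p2 w4 h]
  norm_num
end
end PDom

open Finset
set_option linter.unusedSectionVars false
set_option linter.unusedVariables false
set_option linter.unusedSimpArgs false
namespace PDom
section
variable {V : Type*} [Fintype V] [DecidableEq V] {G : SimpleGraph V} [DecidableRel G.Adj]
  {S : Finset V} {m : V → V}

variable {u w v y s x r : V}

theorem payIa_core (h : Opt G S m) (d : D11 G S m w y s x r) (hu : isD G S m u) (w1 : w ≠ u) (w2 : w ≠ m u)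
    (hN : ∀ t ∈ S, G.Adj y t ↔ t = u ∨ t = m u ∨ t = w) (hv : v ∈ S) (hNu : ∀ t, G.Adj u t ↔ t = m u ∨ t = v ∨ t = y)
    (hxu : G.Adj x (m u)) (hxN : ∀ t ∈ S, G.Adj x t → t = m u ∨ t = m w) (hyx : y ≠ x) :
    3/2 ≤ wt G S m y w + wt G S m s w + (wt G S m x (m w) + wt G S m r (m w)) := by
  have hw := d.D
  have hw' := isD_m h hw
  have hu' := isD_m h hu
  have w3 := mne1 h hw.1 w2
  have w4 := mne2 h hw.1 hu.1 w1
  have e1 : G.Adj y w := ((d.Nu y).2 (by simp)).symm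
  have e2 : G.Adj s w := ((d.Nu s).2 (by simp)).symm
  have e3 : G.Adj x (m w) := ((d.Nm x).2 (by simp)).symm
  have e4 : G.Adj r (m w) := ((d.Nm r).2 (by simp)).symm
  have hyu : G.Adj y u := (hN u hu.1).2 (by simp)
  have hyu' : G.Adj y (m u) := (hN _ hu'.1).2 (by simp)
  have hNm := nb3''' h.cub (h.madj hu.1).symm hyu'.symm hxu.symm (by rintro rfl; exact d.hy1 hu.1) (by rintro rfl; exact d.hx1 hu.1) hyx
  have a1 := wD_low h hw e1
  have a2 := wD_two h hw' e3 (t := m u) (fun t ht hxt => (hxN t ht hxt).symm)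
  have hxw : ¬ G.Adj x w := by
    intro hh
    rcases hxN w hw.1 hh with e | e
    · exact w2 e
    · exact h.mne hw.1 e.symm
  have hsx : s ≠ x := by rintro rfl; exact hxw e2
  have hyw' : ¬ G.Adj y (m w) := by
    intro hh
    rcases (hN _ hw'.1).1 hh with e | e | e
    · exact w3 e
    · exact w4 e
    · exact h.mne hw.1 e
  have hsu : ¬ G.Adj s u := by
    intro hh
    rcases (hNu s).1 hh.symm with e | e | e
    · exact d.hy2 (e ▸ hu'.1)
    · exact d.hy2 (e ▸ hv)
    · exact d.yy e.symm
  have hsu' : ¬ G.Adj s (m u) := by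
    intro hh
    rcases (hNm s).1 hh.symm with e | e | e
    · exact d.hy2 (e ▸ hu.1)
    · exact d.yy e.symm
    · exact hsx e
  by_cases hq : ∃ q, isD G S m q ∧ q ≠ w ∧ q ≠ m w ∧ G.Adj s q
  · obtain ⟨q, hq, q1, q2, hsq⟩ := hq
    have q3 : q ≠ u := by rintro rfl; exact hsu hsq
    have q4 : q ≠ m u := by rintro rfl; exact hsu' hsq
    obtain ⟨z, k1, k2, k3, k4, k5, k6, k7, k8, k9, k10⟩ := h.ex2 (a := x) (b := m u) (a' := s) (b' := q) hu.1 hw.1 hq.1 w1 w2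
      q3 q4 q1 q2 hxu hsq hsx.symm (by rintro rfl; exact d.hx1 hq.1) (by rintro e; exact d.hy2 (e ▸ hu'.1)) q4.symm
      (fun hh => absurd hh d.hx1) (by intro; simp) (fun hh => absurd hh d.hy2) (by intro; simp)
    have hz : z ∉ S := by
      intro hz
      rcases k10 hz with rfl | rfl | rfl | rfl | rfl | rfl
      · exact k6 (h.madj hu.1)
      · exact k2 rfl
      · exact k7 e2.symm
      · exact k5 e3.symm
      · exact k4 rfl
      · exact k8 (h.madj hq.1).symm
    have hzN : ∀ t ∈ S, G.Adj z t → t = m w ∨ t = m q := by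
      intro t ht hzt
      rcases k9 t ht hzt with rfl | rfl | rfl | rfl | rfl | rfl
      · exfalso
        rcases (hNu z).1 hzt.symm with e | e | e
        · exact hz (e ▸ hu'.1)
        · exact hz (e ▸ hv)
        · exact k6 (e ▸ hyu')
      · exact absurd hzt k6
      · exfalso
        rcases (d.Nu z).1 hzt.symm with e | e | e
        · exact hz (e ▸ hw'.1)
        · exact k6 (e ▸ hyu')
        · exact k3 e
      · exact Or.inl rfl
      · exact absurd hzt k8
      · exact Or.inr rfl
    have hzw := (dom2 h hz hzN hw.2.2 hq.2.2).1
    have : z = r := by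
      rcases (d.Nm z).1 hzw.symm with e | e | e
      · exact absurd (e ▸ hw.1) hz
      · exact absurd e k1
      · exact e
    subst this
    have a3 := wD_two h hw' e4 hzN
    have a4 := wD_low h hw e2
    linarith
  · push Not at hq
    by_cases hsr : s = r
    · subst hsr
      have a3 := wD_one h hw e2 (w := m w) (fun t ht hst => by
        by_contra hh; push Not at hh; exact hq t ht hh.1 hh.2 hst)
      have a4 := wD_one h hw' e4 (w := w) (fun t ht hst => by
        by_contra hh; push Not at hh; exact hq t ht hh.2 hh.1 hst)
      linarith
    · have a3 := wD_noD h hw e2 (fun t ht hst => by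
        by_contra hh
        refine hq t ht hh ?_ hst
        rintro rfl
        rcases (d.Nm s).1 hst.symm with e | e | e
        · exact d.hy2 (e ▸ hw.1)
        · exact hsx e
        · exact hsr e)
      have a4 := wD_low h hw' e4
      linarith

theorem payIa (h : Opt G S m) (d : D11 G S m w y s x r) (hu : isD G S m u) (w1 : w ≠ u) (w2 : w ≠ m u)
    (hN : ∀ t ∈ S, G.Adj y t ↔ t = u ∨ t = m u ∨ t = w) (hv : v ∈ S) (huv : G.Adj u v) (hvm : v ≠ m u) :
    3/2 ≤ wt G S m y w + wt G S m s w + (wt G S m x (m w) + wt G S m r (m w)) := by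
  have hw := d.D
  have hw' := isD_m h hw
  have hu' := isD_m h hu
  have e1 : G.Adj y w := ((d.Nu y).2 (by simp)).symm
  have hyu : G.Adj y u := (hN u hu.1).2 (by simp)
  have hyu' : G.Adj y (m u) := (hN _ hu'.1).2 (by simp)
  have hNu := nb3''' h.cub (h.madj hu.1) huv hyu.symm hvm.symm (fun e => d.hy1 (e ▸ hu'.1)) (fun e => d.hy1 (e ▸ hv))
  obtain ⟨z, k1, k2, k3, k4, k5⟩ := triEx h hu hw w1 w2 d.hy1 hyu hyu' e1
  have c1 : ¬ G.Adj z u := by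
    intro hh
    rcases (hNu z).1 hh.symm with e | e | e
    · exact k1 (e ▸ hu'.1)
    · exact k1 (e ▸ hv)
    · exact k2 e
  have c2 := k5.resolve_left c1
  have hzN : ∀ t ∈ S, G.Adj z t → t = m u ∨ t = m w := by
    intro t ht hzt
    rcases k4 t ht hzt with e | e | e
    · exact absurd (e ▸ hzt) c1
    · exact Or.inl e
    · exact Or.inr e
  have hzw := (dom2 h k1 hzN hu.2.2 hw.2.2).2
  rcases (d.Nm z).1 hzw.symm with e | e | e
  · exact absurd (e ▸ hw.1) k1
  · subst e
    exact payIa_core h d hu w1 w2 hN hv hNu c2 hzN k2.symm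
  · subst e
    have := payIa_core h d.swX hu w1 w2 hN hv hNu c2 hzN k2.symm
    linarith
end
end PDom

open Finset
set_option linter.unusedSectionVars false
set_option linter.unusedVariables false
set_option linter.unusedSimpArgs false
namespace PDom
section
variable {V : Type*} [Fintype V] [DecidableEq V] {G : SimpleGraph V} [DecidableRel G.Adj]
  {S : Finset V} {m : V → V}

theorem pendMove (h : Opt G S m) {q p : V} (hC : isC G S m q p) (hZ : PendZ G q) : PendZ G p := by
  classical
  obtain ⟨g1, g2, g3, g4, g5, g6, g7⟩ := hC.mgS h
  have hq := hC.1
  have hpe : p ∉ S.erase q := fun hh => g5 (Finset.mem_of_mem_erase hh)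
  have hPDS : IsPDS G ((S \ {q, m q}) ∪ {m q, p}) := by
    refine h.mkPDS {q, m q} {m q, p} (sw1 (m q) p) ?_ (swm1 g6.symm) ?_ ?_
    · intro k hk
      simp only [mem_insert, mem_singleton] at hk
      rcases hk with rfl | rfl
      · exact ⟨hq, by simp⟩
      · exact ⟨g1, by rw [g2]; simp⟩
    · intro l hl hlS
      simp only [mem_insert, mem_singleton] at hl
      rcases hl with rfl | rfl
      · simp
      · exact absurd hlS g5
    · intro z z1 z2 z3 z4
      simp only [mem_insert, mem_singleton, not_or] at z1
      have zS : z ∉ S := by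
        intro hz
        have := z4 hz
        simp only [mem_insert, mem_singleton] at this
        rcases this with rfl | rfl
        · exact z2 _ (by simp) g3
        · exact z1.1 rfl
      refine dom1 h zS (a := q) (fun s hs hzs => ?_) hC.2.1
      have := z3 s hs hzs
      simp only [mem_insert, mem_singleton] at this
      rcases this with rfl | rfl
      · rfl
      · exact absurd hzs (z2 _ (by simp))
  have hS1 : (S \ {q, m q}) ∪ {m q, p} = insert p (S.erase q) := by
    ext t
    simp only [mem_union, mem_sdiff, mem_insert, mem_singleton, mem_erase, not_or]
    constructor
    · rintro (⟨a, b, c⟩ | rfl | rfl)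
      · exact Or.inr ⟨b, a⟩
      · exact Or.inr ⟨g4.symm, g1⟩
      · exact Or.inl rfl
    · rintro (rfl | ⟨a, b⟩)
      · simp
      · by_cases e : t = m q
        · simp [e]
        · exact Or.inl ⟨b, a, e⟩
  rw [hS1] at hPDS
  have hcard : (insert p (S.erase q)).card ≤ S.card := by
    rw [Finset.card_insert_of_notMem hpe, Finset.card_erase_add_one hq]
  have hlam : lam G (insert p (S.erase q)) ≤ lam G S := by
    rw [lam_insert _ _ hpe]
    have e : lam G S = lam G (S.erase q) + 2 * dg G (S.erase q) q := by
      rw [← lam_insert _ _ (Finset.notMem_erase q S), Finset.insert_erase hq]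
    have e1 : dg G (S.erase q) p ≤ 1 := dg_le1 (k := m q) (fun t ht => g7 t (Finset.mem_of_mem_erase ht))
    have e2 : 1 ≤ dg G (S.erase q) q := dg_ge1 (k := m q) (Finset.mem_erase.2 ⟨g4.symm, g1⟩) g3
    omega
  have hz := h.zmin _ hPDS hcard hlam
  by_contra hp
  have : zc G (insert p (S.erase q)) < zc G S := by
    unfold zc
    apply Finset.card_lt_card
    rw [Finset.ssubset_iff_of_subset]
    · refine ⟨q, by simp [hq, hZ], ?_⟩
      simp only [mem_filter, mem_insert, mem_erase, not_and, ne_eq, not_true, false_and, or_false]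
      rintro rfl
      exact absurd hq g5
    · intro t
      simp only [mem_filter, mem_insert, mem_erase]
      rintro ⟨rfl | ⟨_, b⟩, c⟩
      · exact absurd c hp
      · exact ⟨b, c⟩
  omega

/-- the pendant gadget -/
structure Gad (G : SimpleGraph V) (U U' Y Y' W W' R p : V) : Prop where
  nd : [U, U', Y, Y', W, W', R, p].Nodup
  NU : ∀ t, G.Adj U t ↔ t = U' ∨ t = Y ∨ t = Y'
  NU' : ∀ t, G.Adj U' t ↔ t = U ∨ t = Y ∨ t = Y'
  NY : ∀ t, G.Adj Y t ↔ t = U ∨ t = U' ∨ t = W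
  NY' : ∀ t, G.Adj Y' t ↔ t = U ∨ t = U' ∨ t = W'
  NW : ∀ t, G.Adj W t ↔ t = Y ∨ t = W' ∨ t = R
  NW' : ∀ t, G.Adj W' t ↔ t = Y' ∨ t = W ∨ t = R
  NR : ∀ t, G.Adj R t ↔ t = W ∨ t = W' ∨ t = p

theorem PendZ.gad (hc : ∀ v, G.degree v = 3) {p : V} (hZ : PendZ G p) : ∃ U U' Y Y' W W' R, Gad G U U' Y Y' W W' R p := by
  obtain ⟨U, U', Y, Y', W, W', R, nd, h1, h2, h3, h4, h5, h6, h7, h8, h9, h10, h11⟩ := hZ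
  have nd' := nd
  simp only [List.nodup_cons, List.mem_cons, List.not_mem_nil, not_or, or_false] at nd
  obtain ⟨⟨a1, a2, a3, a4, a5, a6, a7⟩, ⟨b2, b3, b4, b5, b6, b7⟩, ⟨c3, c4, c5, c6, c7⟩, ⟨d4, d5, d6, d7⟩, ⟨e5, e6, e7⟩, ⟨f6, f7⟩, f8, _⟩ := nd
  exact ⟨U, U', Y, Y', W, W', R, nd', nb3''' hc h1 h2 h3 b2 b3 c3, nb3''' hc h1.symm h4 h5 a2 a3 c3, nb3''' hc h2.symm h4.symm h6 a1 a4 b4,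
    nb3''' hc h3.symm h5.symm h7 a1 a5 b5, nb3''' hc h6.symm h8 h9.symm c5 c6 f6, nb3''' hc h7.symm h8.symm h10.symm d4 d6 e6,
    nb3''' hc h9 h10 h11 e5 e7 f7⟩

variable {U U' Y Y' W W' R p : V}
theorem Gad.sw (g : Gad G U U' Y Y' W W' R p) : Gad G U U' Y' Y W' W R p := by
  obtain ⟨nd, h1, h2, h3, h4, h5, h6, h7⟩ := g
  refine ⟨?_, fun t => ?_, fun t => ?_, h4, h3, h6, h5, fun t => ?_⟩
  · simp only [List.nodup_cons, List.mem_cons, List.not_mem_nil, not_or, or_false] at nd ⊢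
    obtain ⟨⟨a1, a2, a3, a4, a5, a6, a7⟩, ⟨b2, b3, b4, b5, b6, b7⟩, ⟨c3, c4, c5, c6, c7⟩, ⟨d4, d5, d6, d7⟩, ⟨e5, e6, e7⟩, ⟨f6, f7⟩, f8⟩ := nd
    exact ⟨⟨a1, a3, a2, a5, a4, a6, a7⟩, ⟨b3, b2, b5, b4, b6, b7⟩, ⟨Ne.symm c3, d5, d4, d6, d7⟩, ⟨c5, c4, c6, c7⟩,
      ⟨Ne.symm e5, f6, f7⟩, ⟨e6, e7⟩, f8⟩
  · rw [h1 t, or_comm (a := t = Y')]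
  · rw [h2 t, or_comm (a := t = Y')]
  · rw [h7 t]; constructor <;> (rintro (h | h | h) <;> simp [h])

theorem Gad.cl (g : Gad G U U' Y Y' W W' R p) {a b : V} (ha : a ∈ ({U, U', Y, Y', W, W', R} : Finset V)) (hab : G.Adj a b) :
    b ∈ ({U, U', Y, Y', W, W', R} : Finset V) ∨ (a = R ∧ b = p) := by
  simp only [mem_insert, mem_singleton] at ha ⊢
  rcases ha with rfl | rfl | rfl | rfl | rfl | rfl | rfl
  · rcases (g.NU b).1 hab with e | e | e <;> simp [e]
  · rcases (g.NU' b).1 hab with e | e | e <;> simp [e]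
  · rcases (g.NY b).1 hab with e | e | e <;> simp [e]
  · rcases (g.NY' b).1 hab with e | e | e <;> simp [e]
  · rcases (g.NW b).1 hab with e | e | e <;> simp [e]
  · rcases (g.NW' b).1 hab with e | e | e <;> simp [e]
  · rcases (g.NR b).1 hab with e | e | e <;> simp [e]

theorem Gad.out (g : Gad G U U' Y Y' W W' R p) {a b : V} (ha : a ∉ ({U, U', Y, Y', W, W', R} : Finset V)) (hap : a ≠ p)
    (hab : G.Adj a b) : b ∉ ({U, U', Y, Y', W, W', R} : Finset V) := by
  intro hb
  rcases g.cl hb hab.symm with h | h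
  · exact ha h
  · exact hap h.2

theorem Gad.three (h : Opt G S m) (g : Gad G U U' Y Y' W W' R p) (hp : p ∉ S) :
    3 ≤ (S ∩ ({U, U', Y, Y', W, W', R} : Finset V)).card := by
  have nd := g.nd
  simp only [List.nodup_cons, List.mem_cons, List.not_mem_nil, not_or, or_false] at nd
  obtain ⟨⟨a1, a2, a3, a4, a5, a6, a7⟩, ⟨b2, b3, b4, b5, b6, b7⟩, ⟨c3, c4, c5, c6, c7⟩, ⟨d4, d5, d6, d7⟩, ⟨e5, e6, e7⟩, ⟨f6, f7⟩, f8, _⟩ := nd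
  have key : ∀ a b c, a ∈ S → b ∈ S → c ∈ S → a ∈ ({U, U', Y, Y', W, W', R} : Finset V) →
      b ∈ ({U, U', Y, Y', W, W', R} : Finset V) → c ∈ ({U, U', Y, Y', W, W', R} : Finset V) → a ≠ b → a ≠ c → b ≠ c →
      3 ≤ (S ∩ ({U, U', Y, Y', W, W', R} : Finset V)).card := by
    intro a b c ha hb hc ha' hb' hc' hab hac hbc
    rw [← Finset.card_eq_three.2 ⟨a, b, c, hab, hac, hbc, rfl⟩]
    apply Finset.card_le_card
    intro t ht
    simp only [mem_insert, mem_singleton] at ht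
    rcases ht with rfl | rfl | rfl
    · exact mem_inter.2 ⟨ha, ha'⟩
    · exact mem_inter.2 ⟨hb, hb'⟩
    · exact mem_inter.2 ⟨hc, hc'⟩
  have dm : ∀ v a b c, (∀ t, G.Adj v t ↔ t = a ∨ t = b ∨ t = c) → v ∈ S ∨ a ∈ S ∨ b ∈ S ∨ c ∈ S := by
    intro v a b c hN
    by_cases hv : v ∈ S
    · exact Or.inl hv
    · obtain ⟨t, ht, hvt⟩ := h.dom v hv
      rcases (hN t).1 hvt with rfl | rfl | rfl <;> simp [ht]
  obtain ⟨s1, hs1, hs1'⟩ : ∃ s1 ∈ S, s1 = R ∨ s1 = W ∨ s1 = W' := by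
    rcases dm _ _ _ _ g.NR with e | e | e | e
    · exact ⟨_, e, by simp⟩
    · exact ⟨_, e, by simp⟩
    · exact ⟨_, e, by simp⟩
    · exact absurd e hp
  obtain ⟨s2, hs2, hs2'⟩ : ∃ s2 ∈ S, s2 = U ∨ s2 = U' ∨ s2 = Y ∨ s2 = Y' := by
    rcases dm _ _ _ _ g.NU with e | e | e | e <;> exact ⟨_, e, by simp⟩
  have hs1G : s1 ∈ ({U, U', Y, Y', W, W', R} : Finset V) := by
    simp only [mem_insert, mem_singleton]; rcases hs1' with rfl | rfl | rfl <;> simp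
  have hs2G : s2 ∈ ({U, U', Y, Y', W, W', R} : Finset V) := by
    simp only [mem_insert, mem_singleton]; rcases hs2' with rfl | rfl | rfl | rfl <;> simp
  have h12 : s1 ≠ s2 := by
    rcases hs1' with rfl | rfl | rfl <;> rcases hs2' with rfl | rfl | rfl | rfl <;> exact Ne.symm (by assumption)
  by_cases hm : m s1 = s2
  · have hadj := h.madj hs1
    rw [hm] at hadj
    rcases hs1' with rfl | rfl | rfl
    · exfalso
      rcases (g.NR s2).1 hadj with e | e | e
      · subst e; rcases hs2' with e | e | e | e
        · exact a4 e.symm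
        · exact b4 e.symm
        · exact c4 e.symm
        · exact d4 e.symm
      · subst e; rcases hs2' with e | e | e | e
        · exact a5 e.symm
        · exact b5 e.symm
        · exact c5 e.symm
        · exact d5 e.symm
      · exact hp (e ▸ hs2)
    · have e : s2 = Y := by
        rcases (g.NW s2).1 hadj with e | e | e
        · exact e
        · exfalso; subst e; rcases hs2' with e | e | e | e
          · exact a5 e.symm
          · exact b5 e.symm
          · exact c5 e.symm
          · exact d5 e.symm
        · exfalso; subst e; rcases hs2' with e | e | e | e
          · exact a6 e.symm
          · exact b6 e.symm
          · exact c6 e.symm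
          · exact d6 e.symm
      subst e
      rcases dm _ _ _ _ g.NY' with e | e | e | e
      · exact key s1 s2 _ hs1 hs2 e (by simp) (by simp) (by simp) h12 (Ne.symm d4) c3
      · exact key s1 s2 _ hs1 hs2 e (by simp) (by simp) (by simp) h12 (Ne.symm a4) (Ne.symm a2)
      · exact key s1 s2 _ hs1 hs2 e (by simp) (by simp) (by simp) h12 (Ne.symm b4) (Ne.symm b2)
      · exact key s1 s2 _ hs1 hs2 e (by simp) (by simp) (by simp) h12 e5 c5
    · have e : s2 = Y' := by
        rcases (g.NW' s2).1 hadj with e | e | e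
        · exact e
        · exfalso; subst e; rcases hs2' with e | e | e | e
          · exact a4 e.symm
          · exact b4 e.symm
          · exact c4 e.symm
          · exact d4 e.symm
        · exfalso; subst e; rcases hs2' with e | e | e | e
          · exact a6 e.symm
          · exact b6 e.symm
          · exact c6 e.symm
          · exact d6 e.symm
      subst e
      rcases dm _ _ _ _ g.NY with e | e | e | e
      · exact key s1 s2 _ hs1 hs2 e (by simp) (by simp) (by simp) h12 (Ne.symm c5) (Ne.symm c3)
      · exact key s1 s2 _ hs1 hs2 e (by simp) (by simp) (by simp) h12 (Ne.symm a5) (Ne.symm a3)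
      · exact key s1 s2 _ hs1 hs2 e (by simp) (by simp) (by simp) h12 (Ne.symm b5) (Ne.symm b3)
      · exact key s1 s2 _ hs1 hs2 e (by simp) (by simp) (by simp) h12 (Ne.symm e5) d4
  · refine key s1 s2 (m s1) hs1 hs2 (h.mS hs1) hs1G hs2G ?_ h12 (h.mne hs1).symm (fun e => hm e.symm)
    rcases g.cl hs1G (h.madj hs1) with e | e
    · exact e
    · exact absurd (e.2 ▸ h.mS hs1) hp
end
end PDom

open Finset
set_option linter.unusedSectionVars false
set_option linter.unusedVariables false
set_option linter.unusedSimpArgs false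
namespace PDom
section
variable {V : Type*} [Fintype V] [DecidableEq V] {G : SimpleGraph V} [DecidableRel G.Adj]
  {S : Finset V} {m : V → V}

variable {u w y y' r s : V}

/-- configuration (Ib) -/
structure IB (G : SimpleGraph V) (S : Finset V) (m : V → V) (u w y y' r s : V) : Prop where
  d : D11 G S m w y r y' s
  hu : isD G S m u
  w1 : w ≠ u
  w2 : w ≠ m u
  ne : y ≠ y'
  hN : ∀ t, G.Adj y t ↔ t = u ∨ t = m u ∨ t = w
  hN' : ∀ t, G.Adj y' t ↔ t = u ∨ t = m u ∨ t = m w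

theorem IB.sw (h : Opt G S m) (b : IB G S m u w y y' r s) : IB G S m u (m w) y' y s r :=
  ⟨b.d.swU h, b.hu, mne1 h b.d.D.1 b.w2, mne2 h b.d.D.1 b.hu.1 b.w1, b.ne.symm, b.hN', by rw [h.mm b.d.D.1]; exact b.hN⟩

theorem IB.Nu (h : Opt G S m) (b : IB G S m u w y y' r s) : ∀ t, G.Adj u t ↔ t = m u ∨ t = y ∨ t = y' :=
  nb3''' h.cub (h.madj b.hu.1) ((b.hN u).2 (by simp)).symm ((b.hN' u).2 (by simp)).symm
    (fun e => b.d.hy1 (e ▸ h.mS b.hu.1)) (fun e => b.d.hx1 (e ▸ h.mS b.hu.1)) b.ne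
theorem IB.Nm (h : Opt G S m) (b : IB G S m u w y y' r s) : ∀ t, G.Adj (m u) t ↔ t = u ∨ t = y ∨ t = y' :=
  nb3''' h.cub (h.madj b.hu.1).symm ((b.hN _).2 (by simp)).symm ((b.hN' _).2 (by simp)).symm
    (fun e => b.d.hy1 (e ▸ b.hu.1)) (fun e => b.d.hx1 (e ▸ b.hu.1)) b.ne

theorem IB.ry (h : Opt G S m) (b : IB G S m u w y y' r s) : r ≠ y' := by
  rintro rfl
  have hw := b.d.D
  rcases (b.hN' w).1 ((b.d.Nu r).2 (by simp)).symm with e | e | e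
  · exact b.w1 e
  · exact b.w2 e
  · exact h.mne hw.1 e.symm

theorem IB.ru (h : Opt G S m) (b : IB G S m u w y y' r s) : ¬ G.Adj r u ∧ ¬ G.Adj r (m u) := by
  constructor
  · intro hh
    rcases (b.Nu h r).1 hh.symm with e | e | e
    · exact b.d.hy2 (e ▸ h.mS b.hu.1)
    · exact b.d.yy e.symm
    · exact b.ry h e
  · intro hh
    rcases (b.Nm h r).1 hh.symm with e | e | e
    · exact b.d.hy2 (e ▸ b.hu.1)
    · exact b.d.yy e.symm
    · exact b.ry h e

theorem IB.ex (h : Opt G S m) (b : IB G S m u w y y' r s) {q : V} (hq : q ∈ S) (hq' : NP G S (m q)) (q1 : q ≠ w) (q2 : q ≠ m w)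
    (hrq : G.Adj r q) : s ≠ r ∧ (∀ t ∈ S, G.Adj s t → t = m w ∨ t = m q) ∧ G.Adj s (m q) := by
  have hw := b.d.D
  have hu := b.hu
  have q3 : q ≠ u := by rintro rfl; exact (b.ru h).1 hrq
  have q4 : q ≠ m u := by rintro rfl; exact (b.ru h).2 hrq
  have hyu : G.Adj y u := (b.hN u).2 (by simp)
  have hyu' : G.Adj y' u := (b.hN' u).2 (by simp)
  obtain ⟨z, k1, k2, k3, k4, k5, k6, k7, k8, k9, k10⟩ := h.ex2 (a := u) (b := y') (a' := r) (b' := q) hu.1 hw.1 hq b.w1 b.w2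
      q3 q4 q1 q2 hyu'.symm hrq (fun e => b.d.hy2 (e ▸ hu.1)) q3.symm (b.ry h).symm (by rintro rfl; exact b.d.hx1 hq)
      (by intro; simp) (fun hh => absurd hh b.d.hx1) (fun hh => absurd hh b.d.hy2) (by intro; simp)
  have hz : z ∉ S := by
    intro hz
    rcases k10 hz with rfl | rfl | rfl | rfl | rfl | rfl
    · exact k1 rfl
    · exact k5 (h.madj hu.1).symm
    · exact k7 ((b.d.Nu r).2 (by simp))
    · exact k6 ((b.d.Nm y').2 (by simp))
    · exact k4 rfl
    · exact k8 (h.madj hq).symm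
  have hzN : ∀ t ∈ S, G.Adj z t → t = m w ∨ t = m q := by
    intro t ht hzt
    rcases k9 t ht hzt with rfl | rfl | rfl | rfl | rfl | rfl
    · exact absurd hzt k5
    · exfalso
      rcases (b.Nm h z).1 hzt.symm with e | e | e
      · exact k1 e
      · exact k5 (e ▸ hyu)
      · exact k2 e
    · exfalso
      rcases (b.d.Nu z).1 hzt.symm with e | e | e
      · exact hz (e ▸ h.mS hw.1)
      · exact k5 (e ▸ hyu)
      · exact k3 e
    · exact Or.inl rfl
    · exact absurd hzt k8
    · exact Or.inr rfl
  obtain ⟨c1, c2⟩ := dom2 h hz hzN hw.2.2 hq'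
  have : z = s := by
    rcases (b.d.Nm z).1 c1.symm with e | e | e
    · exact absurd (e ▸ hw.1) hz
    · exact absurd e k2
    · exact e
  subst this
  exact ⟨k3, hzN, c2⟩

theorem IB.noC (h : Opt G S m) (b : IB G S m u w y y' r r) {q p : V} (hC : isC G S m q p) (hrq : G.Adj r q) : False := by
  obtain ⟨g1, g2, g3, g4, g5, g6, g7⟩ := hC.mgS h
  have hq := hC.1
  have hw := b.d.D
  have hu := b.hu
  obtain ⟨n1, n2, n3, n4⟩ := hC.ne h hw
  obtain ⟨n5, n6, n7, n8⟩ := hC.ne h hu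
  have hu'S := h.mS hu.1
  have hw'S := h.mS hw.1
  have w3 := mne1 h hw.1 b.w2
  have w4 := mne2 h hw.1 hu.1 b.w1
  have hrw : G.Adj r w := ((b.d.Nu r).2 (by simp)).symm
  have hrw' : G.Adj r (m w) := ((b.d.Nm r).2 (by simp)).symm
  have hNr := nb3''' h.cub hrw hrw' hrq (h.mne hw.1).symm n1.symm n2.symm
  have hyu : G.Adj y u := (b.hN u).2 (by simp)
  have hyu' : G.Adj y' u := (b.hN' u).2 (by simp)
  have hyS := b.d.hy1
  have hy'S := b.d.hx1
  have hrS := b.d.hy2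
  have hZ : PendZ G q := by
    refine ⟨u, m u, y, y', w, m w, r, ?_, h.madj hu.1, hyu.symm, hyu'.symm, ((b.hN _).2 (by simp)).symm,
      ((b.hN' _).2 (by simp)).symm, (b.hN _).2 (by simp), (b.hN' _).2 (by simp), h.madj hw.1, hrw, hrw', hrq⟩
    simp only [List.nodup_cons, List.mem_cons, List.not_mem_nil, not_or, or_false, not_false_iff, and_true, List.nodup_nil]
    refine ⟨⟨(h.mne hu.1).symm, fun e => hyS (e ▸ hu.1), fun e => hy'S (e ▸ hu.1), b.w1.symm, w3.symm, fun e => hrS (e ▸ hu.1), n5.symm⟩,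
      ⟨fun e => hyS (e ▸ hu'S), fun e => hy'S (e ▸ hu'S), b.w2.symm, w4.symm, fun e => hrS (e ▸ hu'S), n6.symm⟩,
      ⟨b.ne, fun e => hyS (e ▸ hw.1), fun e => hyS (e ▸ hw'S), b.d.yy, fun e => hyS (e ▸ hq)⟩,
      ⟨fun e => hy'S (e ▸ hw.1), fun e => hy'S (e ▸ hw'S), (b.ry h).symm, fun e => hy'S (e ▸ hq)⟩,
      ⟨(h.mne hw.1).symm, fun e => hrS (e ▸ hw.1), n1.symm⟩, ⟨fun e => hrS (e ▸ hw'S), n2.symm⟩, fun e => hrS (e ▸ hq)⟩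
  obtain ⟨U, U', Y, Y', W, W', R, g⟩ := (pendMove h hC hZ).gad h.cub
  -- common neighbours of w and m w
  have cm : ∀ t, t ∉ S → G.Adj t w → G.Adj t (m w) → t = r := by
    intro t ht a1 a2
    rcases (b.d.Nu t).1 a1.symm with e | e | e
    · exact absurd (e ▸ hw'S) ht
    · rcases (b.d.Nm t).1 a2.symm with e' | e' | e'
      · exact absurd (e' ▸ hw.1) ht
      · exact absurd (e.symm.trans e') b.ne
      · exact e'
    · exact e
  have cm' : ∀ t, G.Adj t w → G.Adj t (m w) → t = r := by
    intro t a1 a2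
    rcases (b.d.Nu t).1 a1.symm with e | e | e
    · exact absurd (e ▸ a2) (G.loopless.irrefl _)
    · rcases (b.d.Nm t).1 a2.symm with e' | e' | e'
      · exact absurd (e' ▸ a1) (G.loopless.irrefl _)
      · exact absurd (e.symm.trans e') b.ne
      · exact e'
    · exact e
  have hrq' : ¬ G.Adj r (m q) := by
    intro hh
    rcases (hNr _).1 hh with e | e | e
    · exact n3 e
    · exact n4 e
    · exact g4 e.symm
  have hpr : p ≠ r := by rintro rfl; exact hrq' g6
  have aux : ∀ {U U' Y Y' W W' R : V}, Gad G U U' Y Y' W W' R p → m q = R → q = W → False := by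
    intro U U' Y Y' W W' R g e1 e2
    have nd := g.nd
    simp only [List.nodup_cons, List.mem_cons, List.not_mem_nil, not_or, or_false] at nd
    obtain ⟨⟨a1, a2, a3, a4, a5, a6, a7⟩, ⟨b2, b3, b4, b5, b6, b7⟩, ⟨c3, c4, c5, c6, c7⟩, ⟨d4, d5, d6, d7⟩, ⟨e5, e6, e7⟩, ⟨f6, f7⟩, f8, _⟩ := nd
    subst e2
    rcases (g.NW r).1 hrq.symm with e | e | e
    · subst e
      have hY : G.Adj Y' w ∧ G.Adj Y' (m w) := by
        have t1 := (g.NY w).1 hrw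
        have t2 := (g.NY (m w)).1 hrw'
        constructor
        · rcases t1 with e | e | e
          · rw [e]; exact (g.NY' _).2 (by simp)
          · rw [e]; exact (g.NY' _).2 (by simp)
          · exact absurd e.symm n1
        · rcases t2 with e | e | e
          · rw [e]; exact (g.NY' _).2 (by simp)
          · rw [e]; exact (g.NY' _).2 (by simp)
          · exact absurd e.symm n2
      exact c3 (cm' _ hY.1 hY.2).symm
    · subst e
      exact hrq' ((g.NW' _).2 (Or.inr (Or.inr e1)))
    · exact hrS (e ▸ e1 ▸ g1)
  have nd := g.nd
  simp only [List.nodup_cons, List.mem_cons, List.not_mem_nil, not_or, or_false] at nd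
  obtain ⟨⟨a1, a2, a3, a4, a5, a6, a7⟩, ⟨b2, b3, b4, b5, b6, b7⟩, ⟨c3, c4, c5, c6, c7⟩, ⟨d4, d5, d6, d7⟩, ⟨e5, e6, e7⟩, ⟨f6, f7⟩, f8, _⟩ := nd
  have hpG : p ∉ ({U, U', Y, Y', W, W', R} : Finset V) := by
    simp only [mem_insert, mem_singleton, not_or]
    exact ⟨Ne.symm a7, Ne.symm b7, Ne.symm c7, Ne.symm d7, Ne.symm e7, Ne.symm f7, Ne.symm f8⟩
  have o1 : m q ∉ ({U, U', Y, Y', W, W', R} : Finset V) := by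
    intro hh
    rcases g.cl hh g6.symm with e | e
    · exact hpG e
    · have e1 := e.1
      rcases (g.NR q).1 (e1 ▸ g3.symm) with e2 | e2 | e2
      · exact aux g e1 e2
      · exact aux g.sw e1 e2
      · exact g5 (e2 ▸ hq)
  have nS : ∀ t ∈ S, t ≠ p := fun t ht e => g5 (e ▸ ht)
  have o2 := g.out o1 (nS _ g1) g3.symm
  have o3 := g.out o2 (nS _ hq) hrq.symm
  have o4 := g.out o3 hpr.symm hrw
  have o5 := g.out o3 hpr.symm hrw'
  have o6 := g.out o4 (nS _ hw.1) ((b.d.Nu y).2 (by simp))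
  have o7 := g.out o5 (nS _ hw'S) ((b.d.Nm y').2 (by simp))
  have o8 : u ∉ ({U, U', Y, Y', W, W', R} : Finset V) := by
    refine g.out o6 ?_ hyu
    rintro rfl
    rcases (b.hN _).1 g6 with e | e | e
    · exact n7 e
    · exact n8 e
    · exact n3 e
  have o9 := g.out o8 (nS _ hu.1) (h.madj hu.1)
  have hmem : ∀ t, t ∈ ({U, U', Y, Y', W, W', R} : Finset V) ↔ t = U ∨ t = U' ∨ t = Y ∨ t = Y' ∨ t = W ∨ t = W' ∨ t = R := by
    intro t; simp only [mem_insert, mem_singleton]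
  obtain ⟨Γ, hΓ⟩ : ∃ Γ : Finset V, Γ = {U, U', Y, Y', W, W', R} := ⟨_, rfl⟩
  have h3 := g.three h g5
  have hcl := @Gad.cl V _ _ G _ U U' Y Y' W W' R p g
  rw [← hΓ] at hpG o1 o2 o3 o4 o5 o6 o7 o8 o9 hmem h3 hcl
  have iR : R ∈ Γ := (hmem _).2 (by simp)
  have iW : W ∈ Γ := (hmem _).2 (by simp)
  have iU : U ∈ Γ := (hmem _).2 (by simp)
  have iY : Y' ∈ Γ := (hmem _).2 (by simp)
  have io : ∀ {a b : V}, a ∈ Γ → b ∉ Γ → a ≠ b := fun ha hb e => hb (e ▸ ha)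
  have nd6 : [u, m u, w, m w, q, m q].Nodup := by
    simp only [List.nodup_cons, List.mem_cons, List.not_mem_nil, not_or, or_false, not_false_iff, and_true, List.nodup_nil]
    exact ⟨⟨(h.mne hu.1).symm, b.w1.symm, w3.symm, n5.symm, n7.symm⟩, ⟨b.w2.symm, w4.symm, n6.symm, n8.symm⟩,
      ⟨(h.mne hw.1).symm, n1.symm, n3.symm⟩, ⟨n2.symm, n4.symm⟩, g4⟩
  have ndL : [R, W, U, Y', r, q, u, y'].Nodup := by
    simp only [List.nodup_cons, List.mem_cons, List.not_mem_nil, not_or, or_false, not_false_iff, and_true, List.nodup_nil]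
    exact ⟨⟨Ne.symm e6, Ne.symm a6, Ne.symm d6, io iR o3, io iR o2, io iR o8, io iR o7⟩,
      ⟨Ne.symm a4, Ne.symm d4, io iW o3, io iW o2, io iW o8, io iW o7⟩, ⟨a3, io iU o3, io iU o2, io iU o8, io iU o7⟩,
      ⟨io iY o3, io iY o2, io iY o8, io iY o7⟩, ⟨fun e => hrS (e ▸ hq), fun e => hrS (e ▸ hu.1), b.ry h⟩,
      ⟨n5, fun e => hy'S (e ▸ hq)⟩, fun e => hy'S (e ▸ hu.1)⟩
  have hKmem : ∀ t, t ∈ (S ∩ Γ) ∪ ({u, m u, w, m w, q, m q} : Finset V) ↔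
      (t ∈ S ∧ t ∈ Γ) ∨ t = u ∨ t = m u ∨ t = w ∨ t = m w ∨ t = q ∨ t = m q := by
    intro t; simp only [mem_union, mem_inter, mem_insert, mem_singleton]
  have hLmem : ∀ t, t ∈ ({R, W, U, Y', r, q, u, y'} : Finset V) ↔
      t = R ∨ t = W ∨ t = U ∨ t = Y' ∨ t = r ∨ t = q ∨ t = u ∨ t = y' := by
    intro t; simp only [mem_insert, mem_singleton]
  have hKc : 8 < ((S ∩ Γ) ∪ ({u, m u, w, m w, q, m q} : Finset V)).card := by
    rw [Finset.card_union_of_disjoint, card_six nd6]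
    · omega
    · rw [Finset.disjoint_left]
      intro t ht ht'
      have ht := (mem_inter.1 ht).2
      simp only [mem_insert, mem_singleton] at ht'
      rcases ht' with rfl | rfl | rfl | rfl | rfl | rfl
      · exact o8 ht
      · exact o9 ht
      · exact o4 ht
      · exact o5 ht
      · exact o2 ht
      · exact o1 ht
  obtain ⟨z, z1, z2, z3, z4⟩ := h.exch ((S ∩ Γ) ∪ {u, m u, w, m w, q, m q}) {R, W, U, Y', r, q, u, y'} (sw4 R W U Y' r q u y')
    (by
      intro k hk
      rcases (hKmem k).1 hk with ⟨i1, i2⟩ | rfl | rfl | rfl | rfl | rfl | rfl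
      · refine ⟨i1, (hKmem _).2 (Or.inl ⟨h.mS i1, ?_⟩)⟩
        rcases hcl i2 (h.madj i1) with e | e
        · exact e
        · exact absurd (e.2 ▸ h.mS i1) g5
      · exact ⟨hu.1, (hKmem _).2 (by simp)⟩
      · exact ⟨hu'S, (hKmem _).2 (by simp [h.mm hu.1])⟩
      · exact ⟨hw.1, (hKmem _).2 (by simp)⟩
      · exact ⟨hw'S, (hKmem _).2 (by simp [h.mm hw.1])⟩
      · exact ⟨hq, (hKmem _).2 (by simp)⟩
      · exact ⟨g1, (hKmem _).2 (by simp [g2])⟩)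
    (swm4 ((g.NR _).2 (by simp)) ((g.NU _).2 (by simp)) hrq hyu'.symm ndL)
    (by
      intro l hl hlS
      rcases (hLmem l).1 hl with rfl | rfl | rfl | rfl | rfl | rfl | rfl | rfl
      · exact (hKmem _).2 (Or.inl ⟨hlS, iR⟩)
      · exact (hKmem _).2 (Or.inl ⟨hlS, iW⟩)
      · exact (hKmem _).2 (Or.inl ⟨hlS, iU⟩)
      · exact (hKmem _).2 (Or.inl ⟨hlS, iY⟩)
      · exact absurd hlS hrS
      · exact (hKmem _).2 (by simp)
      · exact (hKmem _).2 (by simp)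
      · exact absurd hlS hy'S)
    (by rw [card_eight ndL]; exact hKc)
  have zn : ∀ l, (l = R ∨ l = W ∨ l = U ∨ l = Y' ∨ l = r ∨ l = q ∨ l = u ∨ l = y') → z ≠ l ∧ ¬ G.Adj z l := by
    intro l hl
    exact ⟨fun e => z1 (e ▸ (hLmem l).2 hl), z2 l ((hLmem l).2 hl)⟩
  have nR := zn R (by simp)
  have nU := zn U (by simp)
  have nr := zn r (by simp)
  have nu := zn u (by simp)
  have nq := zn q (by simp)
  have ny' := zn y' (by simp)
  have zp : z ≠ p := by
    rintro rfl; exact nR.2 ((g.NR z).2 (by simp)).symm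
  have zG : z ∉ Γ := by
    intro hz
    rcases (hmem z).1 hz with e | e | e | e | e | e | e
    · exact nU.1 e
    · exact nU.2 ((g.NU z).2 (by simp [e])).symm
    · exact nU.2 ((g.NU z).2 (by simp [e])).symm
    · exact (zn Y' (by simp)).1 e
    · exact (zn W (by simp)).1 e
    · exact nR.2 ((g.NR z).2 (by simp [e])).symm
    · exact nR.1 e
  have zS : z ∉ S := by
    intro hz
    rcases (hKmem z).1 (z4 hz) with e | e | e | e | e | e | e
    · exact zG e.2
    · exact nu.1 e
    · exact nu.2 (e ▸ (h.madj hu.1).symm)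
    · exact nr.2 (e ▸ hrw.symm)
    · exact nr.2 (e ▸ hrw'.symm)
    · exact nq.1 e
    · exact nq.2 (e ▸ g3.symm)
  have zN : ∀ t ∈ S, G.Adj z t → t = m q := by
    intro t ht hzt
    rcases (hKmem t).1 (z3 t ht hzt) with e | e | e | e | e | e | e
    · exfalso
      rcases hcl e.2 hzt.symm with e' | e'
      · exact zG e'
      · exact zp e'.2
    · exact absurd (e ▸ hzt) nu.2
    · exfalso
      subst e
      rcases (b.Nm h z).1 hzt.symm with e | e | e
      · exact nu.1 e
      · exact nu.2 (e ▸ hyu)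
      · exact ny'.1 e
    · exfalso
      subst e
      rcases (b.d.Nu z).1 hzt.symm with e | e | e
      · exact zS (e ▸ hw'S)
      · exact nu.2 (e ▸ hyu)
      · exact nr.1 e
    · exfalso
      subst e
      rcases (b.d.Nm z).1 hzt.symm with e | e | e
      · exact zS (e ▸ hw.1)
      · exact ny'.1 e
      · exact nr.1 e
    · exact absurd (e ▸ hzt) nq.2
    · exact e
  obtain ⟨t, ht, hzt⟩ := h.dom z zS
  have := zN t ht hzt
  subst this
  exact zp (Pv_uniq hq hC.2.2.1 hC.2.2.2 ⟨zS, hzt, zN⟩)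

theorem IB.fin1 (h : Opt G S m) (b : IB G S m u w y y' r s) : 1 ≤ wt G S m r w + wt G S m s (m w) := by
  have hw := b.d.D
  have hw' := isD_m h hw
  have hrw : G.Adj r w := ((b.d.Nu r).2 (by simp)).symm
  have hsw : G.Adj s (m w) := ((b.d.Nm s).2 (by simp)).symm
  by_cases hrs : r = s
  · subst hrs
    obtain ⟨q, q1, q2, hN⟩ := nb3'' h.cub hrw hsw (h.mne hw.1).symm
    have hrq : G.Adj r q := (hN q).2 (by simp)
    by_cases hq : q ∈ S
    · by_cases hqn : NP G S (m q)
      · exact absurd rfl (b.ex h hq hqn q1.symm q2.symm hrq).1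
      · rcases CorA h hq hqn with hA | ⟨p, hC⟩
        · have a1 := wD_A h hw hrw hA hrq
          have a2 := wD_A h hw' hsw hA hrq
          linarith
        · exact absurd (b.noC h hC hrq) id
    · have a1 := wD_two h hw hrw (t := m w) (fun t ht hrt => by
        rcases (hN t).1 hrt with e | e | e
        · exact Or.inl e
        · exact Or.inr e
        · exact absurd (e ▸ ht) hq)
      have a2 := wD_two h hw' hsw (t := w) (fun t ht hrt => by
        rcases (hN t).1 hrt with e | e | e
        · exact Or.inr e
        · exact Or.inl e
        · exact absurd (e ▸ ht) hq)
      linarith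
  · have r1 : ¬ G.Adj r (m w) := by
      intro hh
      rcases (b.d.Nm r).1 hh.symm with e | e | e
      · exact b.d.hy2 (e ▸ hw.1)
      · exact b.ry h e
      · exact hrs e
    have s1 : ¬ G.Adj s w := by
      intro hh
      rcases (b.d.Nu s).1 hh.symm with e | e | e
      · exact b.d.hx2 (e ▸ hw'.1)
      · exact (b.sw h).ry h e
      · exact hrs e.symm
    by_cases c1 : ∃ q, isD G S m q ∧ q ≠ w ∧ G.Adj r q
    · obtain ⟨q, hq, q1, q2⟩ := c1
      have q3 : q ≠ m w := by rintro rfl; exact r1 q2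
      obtain ⟨t1, t2, t3⟩ := b.ex h hq.1 hq.2.2 q1 q3 q2
      have a1 := wD_two h hw' hsw t2
      obtain ⟨t4, t5, t6⟩ := (b.sw h).ex h (h.mS hq.1) (by rw [h.mm hq.1]; exact hq.2.1) (mne2 h hq.1 hw.1 q1)
        (by rw [h.mm hw.1]; exact mne1 h hq.1 q3) t3
      rw [h.mm hw.1] at t5
      have a2 := wD_two h hw hrw t5
      linarith
    · by_cases c2 : ∃ q, isD G S m q ∧ q ≠ m w ∧ G.Adj s q
      · exfalso
        obtain ⟨q, hq, q1, q2⟩ := c2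
        have q3 : q ≠ w := by rintro rfl; exact s1 q2
        obtain ⟨t1, t2, t3⟩ := (b.sw h).ex h hq.1 hq.2.2 q1 (by rw [h.mm hw.1]; exact q3) q2
        exact c1 ⟨m q, isD_m h hq, mne1 h hq.1 q1, t3⟩
      · push Not at c1 c2
        have a1 := wD_noD h hw hrw (fun t ht hrt => by
          by_contra hh; exact c1 t ht hh hrt)
        have a2 := wD_noD h hw' hsw (fun t ht hrt => by
          by_contra hh; exact c2 t ht hh hrt)
        linarith

/-- payer pairs are fine -/
theorem payAll (h : Opt G S m) {x1 x2 : V} (d : D11 G S m w y r x1 x2) (hp : payer G S m y w) :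
    3/2 ≤ wt G S m y w + wt G S m r w + (wt G S m x1 (m w) + wt G S m x2 (m w)) := by
  have hw := d.D
  have hw' := isD_m h hw
  have e1 : G.Adj y w := ((d.Nu y).2 (by simp)).symm
  obtain ⟨u, hu, _, w1, w2, hN, ⟨v, hv, v1, v2, huv | huv⟩ | ⟨y', hy', hne, hN'⟩⟩ := hp
  · exact payIa h d hu w1 w2 hN hv huv v2
  · refine payIa h d (isD_m h hu) w2 (by rw [h.mm hu.1]; exact w1) (fun t ht => ?_) hv huv (by rw [h.mm hu.1]; exact v1)
    rw [h.mm hu.1, hN t ht]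
    constructor <;> (rintro (e | e | e) <;> simp [e])
  · have w3 := mne1 h hw.1 w2
    have w4 := mne2 h hw.1 hu.1 w1
    have full := nb3''' h.cub ((hN u hu.1).2 (by simp)) ((hN _ (h.mS hu.1)).2 (by simp)) ((hN w hw.1).2 (by simp)) (h.mne hu.1).symm w1.symm w2.symm
    have full' := nb3''' h.cub ((hN' u hu.1).2 (by simp)) ((hN' _ (h.mS hu.1)).2 (by simp)) ((hN' (m w) (h.mS hw.1)).2 (by simp)) (h.mne hu.1).symm w3.symm w4.symm
    have hy'w := (full' (m w)).2 (by simp)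
    have a1 := wD_low h hw e1
    have a2 := wD_low h hw' hy'w
    rcases (d.Nm y').1 hy'w.symm with e | e | e
    · exact absurd (e ▸ hw.1) hy'
    · subst e
      have := IB.fin1 h (⟨d, hu, w1, w2, hne.symm, full, full'⟩ : IB G S m u w y y' r x2)
      linarith
    · subst e
      have := IB.fin1 h (⟨d.swX, hu, w1, w2, hne.symm, full, full'⟩ : IB G S m u w y y' r x1)
      linarith
end
end PDom

open Finset
set_option linter.unusedSectionVars false
set_option linter.unusedVariables false
set_option linter.unusedSimpArgs false
namespace PDom
section
variable {V : Type*} [Fintype V] [DecidableEq V] {G : SimpleGraph V} [DecidableRel G.Adj]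
  {S : Finset V} {m : V → V}

variable {u y1 y2 x1 x2 a g c c' b b' e e' : V}

/-- non-triangle D-pair all of whose outer neighbours have three neighbours in `S` -/
structure NT (G : SimpleGraph V) (S : Finset V) (m : V → V) (u y1 y2 x1 x2 a g c c' b b' e e' : V) : Prop where
  d : D11 G S m u y1 y2 x1 x2
  n11 : y1 ≠ x1
  n12 : y1 ≠ x2
  n21 : y2 ≠ x1
  n22 : y2 ≠ x2
  X1 : ∀ t, G.Adj x1 t ↔ t = m u ∨ t = a ∨ t = g
  X2 : ∀ t, G.Adj x2 t ↔ t = m u ∨ t = c ∨ t = c'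
  Y1 : ∀ t, G.Adj y1 t ↔ t = u ∨ t = b ∨ t = b'
  Y2 : ∀ t, G.Adj y2 t ↔ t = u ∨ t = e ∨ t = e'
  ag : a ≠ g
  cc : c ≠ c'
  bb : b ≠ b'
  ee : e ≠ e'
  am : a ≠ m u
  gm : g ≠ m u
  cm : c ≠ m u
  cm' : c' ≠ m u
  bm : b ≠ u
  bm' : b' ≠ u
  em : e ≠ u
  em' : e' ≠ u
  aD : isD G S m a
  cD : isD G S m c
  cD' : isD G S m c'
  bD : isD G S m b
  bD' : isD G S m b'
  eD : isD G S m e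
  gS : g ∈ S
  eS : e' ∈ S

theorem NT.mirror (h : Opt G S m) (n : NT G S m u y1 y2 x1 x2 a g c c' b b' e e') :
    NT G S m (m u) x2 x1 y2 y1 e e' b b' c c' a g := by
  have hm := h.mm n.d.D.1
  exact ⟨((n.d.swY).swX).swU h, n.n22.symm, n.n12.symm, n.n21.symm, n.n11.symm, by rw [hm]; exact n.Y2,
    by rw [hm]; exact n.Y1, n.X2, n.X1, n.ee, n.bb, n.cc, n.ag, by rw [hm]; exact n.em, by rw [hm]; exact n.em',
    by rw [hm]; exact n.bm, by rw [hm]; exact n.bm', n.cm, n.cm', n.am, n.gm, n.eD, n.bD, n.bD', n.cD, n.cD', n.aD, n.eS, n.gS⟩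
theorem NT.swc (n : NT G S m u y1 y2 x1 x2 a g c c' b b' e e') :
    NT G S m u y1 y2 x1 x2 a g c' c b b' e e' :=
  { n with X2 := (fun t => by rw [n.X2 t, or_comm (a := t = c')]), cc := n.cc.symm, cm := n.cm', cm' := n.cm, cD := n.cD', cD' := n.cD }
theorem NT.swb (n : NT G S m u y1 y2 x1 x2 a g c c' b b' e e') :
    NT G S m u y1 y2 x1 x2 a g c c' b' b e e' :=
  { n with Y1 := (fun t => by rw [n.Y1 t, or_comm (a := t = b')]), bb := n.bb.symm, bm := n.bm', bm' := n.bm, bD := n.bD', bD' := n.bD }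
theorem NT.swe (n : NT G S m u y1 y2 x1 x2 a g c c' b b' e e') (he : isD G S m e') :
    NT G S m u y1 y2 x1 x2 a g c c' b b' e' e :=
  { n with Y2 := (fun t => by rw [n.Y2 t, or_comm (a := t = e')]), ee := n.ee.symm, em := n.em', em' := n.em, eD := he, eS := n.eD.1 }
theorem NT.swY (n : NT G S m u y1 y2 x1 x2 a g c c' b b' e e') (he : isD G S m e') :
    NT G S m u y2 y1 x1 x2 a g c c' e e' b b' :=
  { n with d := n.d.swY, n11 := n.n21, n12 := n.n22, n21 := n.n11, n22 := n.n12, Y1 := n.Y2, Y2 := n.Y1, bb := n.ee, ee := n.bb, bm := n.em, bm' := n.em', em := n.bm, em' := n.bm', bD := n.eD, bD' := he, eD := n.bD, eS := n.bD'.1 }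

theorem NT.xu (h : Opt G S m) (n : NT G S m u y1 y2 x1 x2 a g c c' b b' e e') {x : V} (hx : x = x1 ∨ x = x2) :
    x ∉ S ∧ G.Adj x (m u) ∧ ¬ G.Adj x u := by
  have hu' := h.mS n.d.D.1
  rcases hx with rfl | rfl
  · refine ⟨n.d.hx1, (n.X1 _).2 (by simp), fun hh => ?_⟩
    rcases (n.d.Nu x).1 hh.symm with e | e | e
    · exact n.d.hx1 (e ▸ hu')
    · exact n.n11 e.symm
    · exact n.n21 e.symm
  · refine ⟨n.d.hx2, (n.X2 _).2 (by simp), fun hh => ?_⟩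
    rcases (n.d.Nu x).1 hh.symm with e | e | e
    · exact n.d.hx2 (e ▸ hu')
    · exact n.n12 e.symm
    · exact n.n22 e.symm
theorem NT.yu (h : Opt G S m) (n : NT G S m u y1 y2 x1 x2 a g c c' b b' e e') {y : V} (hy : y = y1 ∨ y = y2) :
    y ∉ S ∧ G.Adj y u ∧ ¬ G.Adj y (m u) := by
  have := (n.mirror h).xu h (x := y) (by tauto)
  rwa [h.mm n.d.D.1] at this

/-- `w` is a weak D-neighbour of `x` on the X-side -/
def XW (G : SimpleGraph V) (S : Finset V) (m : V → V) (u x w : V) : Prop := isD G S m w ∧ G.Adj x w ∧ w ≠ u ∧ w ≠ m u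

theorem NT.xw (h : Opt G S m) (n : NT G S m u y1 y2 x1 x2 a g c c' b b' e e') {x w : V} (hx : x = x1 ∨ x = x2)
    (hw : isD G S m w) (hxw : G.Adj x w) (hm : w ≠ m u) : XW G S m u x w :=
  ⟨hw, hxw, fun e => (n.xu h hx).2.2 (e ▸ hxw), hm⟩
theorem NT.yw (h : Opt G S m) (n : NT G S m u y1 y2 x1 x2 a g c c' b b' e e') {y w : V} (hy : y = y1 ∨ y = y2)
    (hw : isD G S m w) (hyw : G.Adj y w) (hm : w ≠ u) : XW G S m u y w :=
  ⟨hw, hyw, hm, fun e => (n.yu h hy).2.2 (e ▸ hyw)⟩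
theorem NT.wa (h : Opt G S m) (n : NT G S m u y1 y2 x1 x2 a g c c' b b' e e') : XW G S m u x1 a :=
  n.xw h (Or.inl rfl) n.aD ((n.X1 a).2 (by simp)) n.am
theorem NT.wc (h : Opt G S m) (n : NT G S m u y1 y2 x1 x2 a g c c' b b' e e') : XW G S m u x2 c :=
  n.xw h (Or.inr rfl) n.cD ((n.X2 c).2 (by simp)) n.cm
theorem NT.wc' (h : Opt G S m) (n : NT G S m u y1 y2 x1 x2 a g c c' b b' e e') : XW G S m u x2 c' :=
  n.xw h (Or.inr rfl) n.cD' ((n.X2 c').2 (by simp)) n.cm'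
theorem NT.wb (h : Opt G S m) (n : NT G S m u y1 y2 x1 x2 a g c c' b b' e e') : XW G S m u y1 b :=
  n.yw h (Or.inl rfl) n.bD ((n.Y1 b).2 (by simp)) n.bm
theorem NT.wb' (h : Opt G S m) (n : NT G S m u y1 y2 x1 x2 a g c c' b b' e e') : XW G S m u y1 b' :=
  n.yw h (Or.inl rfl) n.bD' ((n.Y1 b').2 (by simp)) n.bm'
theorem NT.we (h : Opt G S m) (n : NT G S m u y1 y2 x1 x2 a g c c' b b' e e') : XW G S m u y2 e :=
  n.yw h (Or.inr rfl) n.eD ((n.Y2 e).2 (by simp)) n.em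

theorem over3 (h : Opt G S m) {s t1 t2 t3 : V} (hs : s ∈ S) (h1 : t1 ∉ S) (h2 : t2 ∉ S) (h3 : t3 ∉ S)
    (a1 : G.Adj t1 s) (a2 : G.Adj t2 s) (a3 : G.Adj t3 s) (h12 : t1 ≠ t2) (h13 : t1 ≠ t3) : t2 = t3 := by
  by_contra h23
  rcases (nb3''' h.cub a1.symm a2.symm a3.symm h12 h13 h23 (m s)).1 (h.madj hs) with e | e | e
  · exact h1 (e ▸ h.mS hs)
  · exact h2 (e ▸ h.mS hs)
  · exact h3 (e ▸ h.mS hs)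

theorem NT.E (h : Opt G S m) (n : NT G S m u y1 y2 x1 x2 a g c c' b b' e e') {x y w1 w2 : V} (hx : x = x1 ∨ x = x2)
    (hy : y = y1 ∨ y = y2) (k1 : XW G S m u x w1) (k2 : XW G S m u y w2) (h1 : w1 ≠ w2) (h2 : w1 ≠ m w2) :
    ∃ z, z ∉ S ∧ z ≠ x ∧ z ≠ y ∧ G.Adj z (m w1) ∧ G.Adj z (m w2) ∧ ¬ G.Adj z w1 ∧ ¬ G.Adj z w2 ∧
      ∀ s ∈ S, G.Adj z s → s ≠ u → s ≠ m u → s = m w1 ∨ s = m w2 := by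
  obtain ⟨xS, xu, xu'⟩ := n.xu h hx
  obtain ⟨yS, yu, yu'⟩ := n.yu h hy
  obtain ⟨p1, p2, p3, p4⟩ := k1
  obtain ⟨q1, q2, q3, q4⟩ := k2
  have hu := n.d.D
  have hxy : x ≠ y := by rintro rfl; exact xu' yu
  have h2' : w2 ≠ m w1 := (mne1 h p1.1 h2).symm
  obtain ⟨z, z1, z2, z3, z4, z5, z6, z7, z8, z9, z10⟩ := h.ex2 (a := x) (b := w1) (a' := y) (b' := w2) hu.1 p1.1 q1.1
    p3 p4 q3 q4 h1.symm h2' p2 q2 hxy (fun e => xS (e ▸ q1.1)) (fun e => yS (e ▸ p1.1)) h1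
    (fun hh => absurd hh xS) (by intro; simp) (fun hh => absurd hh yS) (by intro; simp)
  have zS : z ∉ S := by
    intro hz
    rcases z10 hz with rfl | rfl | rfl | rfl | rfl | rfl
    · exact z7 yu.symm
    · exact z5 xu.symm
    · exact z2 rfl
    · exact z6 (h.madj p1.1).symm
    · exact z4 rfl
    · exact z8 (h.madj q1.1).symm
  have zN : ∀ s ∈ S, G.Adj z s → s ≠ u → s ≠ m u → s = m w1 ∨ s = m w2 := by
    intro s hs hzs s1 s2
    rcases z9 s hs hzs with e | e | e | e | e | e
    · exact absurd e s1
    · exact absurd e s2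
    · exact absurd (e ▸ hzs) z6
    · exact Or.inl e
    · exact absurd (e ▸ hzs) z8
    · exact Or.inr e
  have two : ∀ {s t : V}, s ≠ t → s ∈ S → t ∈ S → G.Adj z s → G.Adj z t → s ≠ u → s ≠ m u → t ≠ u → t ≠ m u →
      G.Adj z (m w1) ∧ G.Adj z (m w2) := by
    intro s t hst hs ht as at' s1 s2 t1 t2
    rcases zN s hs as s1 s2 with rfl | rfl
    · rcases zN t ht at' t1 t2 with rfl | rfl
      · exact absurd rfl hst
      · exact ⟨as, at'⟩
    · rcases zN t ht at' t1 t2 with rfl | rfl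
      · exact ⟨at', as⟩
      · exact absurd rfl hst
  have key : G.Adj z (m w1) ∧ G.Adj z (m w2) := by
    by_cases c1 : G.Adj z u
    · have yz : z = y1 ∨ z = y2 := by
        rcases (n.d.Nu z).1 c1.symm with e | e | e
        · exact absurd (e ▸ h.mS hu.1) zS
        · exact Or.inl e
        · exact Or.inr e
      have nm := (n.yu h yz).2.2
      rcases yz with rfl | rfl
      · have i1 := (n.Y1 b).2 (by simp)
        have i2 := (n.Y1 b').2 (by simp)
        exact two n.bb n.bD.1 n.bD'.1 i1 i2 n.bm (fun e => nm (e ▸ i1)) n.bm' (fun e => nm (e ▸ i2))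
      · have i1 := (n.Y2 e).2 (by simp)
        have i2 := (n.Y2 e').2 (by simp)
        exact two n.ee n.eD.1 n.eS i1 i2 n.em (fun e => nm (e ▸ i1)) n.em' (fun e => nm (e ▸ i2))
    · by_cases c2 : G.Adj z (m u)
      · have xz : z = x1 ∨ z = x2 := by
          rcases (n.d.Nm z).1 c2.symm with e | e | e
          · exact absurd (e ▸ hu.1) zS
          · exact Or.inl e
          · exact Or.inr e
        have nm := (n.xu h xz).2.2
        rcases xz with rfl | rfl
        · have i1 := (n.X1 a).2 (by simp)
          have i2 := (n.X1 g).2 (by simp)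
          exact two n.ag n.aD.1 n.gS i1 i2 (fun e => nm (e ▸ i1)) n.am (fun e => nm (e ▸ i2)) n.gm
        · have i1 := (n.X2 c).2 (by simp)
          have i2 := (n.X2 c').2 (by simp)
          exact two n.cc n.cD.1 n.cD'.1 i1 i2 (fun e => nm (e ▸ i1)) n.cm (fun e => nm (e ▸ i2)) n.cm'
      · exact dom2 h zS (fun s hs hzs => zN s hs hzs (fun e => c1 (e ▸ hzs)) (fun e => c2 (e ▸ hzs))) p1.2.2 q1.2.2
  exact ⟨z, zS, z1, z3, key.1, key.2, z6, z8, zN⟩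

theorem XW.mne (h : Opt G S m) {x w : V} (k : XW G S m u x w) (hu : u ∈ S) : m w ≠ u ∧ m w ≠ m u :=
  ⟨mne1 h k.1.1 k.2.2.2, mne2 h k.1.1 hu k.2.2.1⟩

/-- at most two X-elements outside the pair of a Y-element -/
theorem NT.threeX (h : Opt G S m) (n : NT G S m u y1 y2 x1 x2 a g c c' b b' e e') {y w s1 s2 s3 t1 t2 t3 : V}
    (hy : y = y1 ∨ y = y2) (k : XW G S m u y w) (k1 : XW G S m u s1 t1) (k2 : XW G S m u s2 t2) (k3 : XW G S m u s3 t3)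
    (hs1 : s1 = x1 ∨ s1 = x2) (hs2 : s2 = x1 ∨ s2 = x2) (hs3 : s3 = x1 ∨ s3 = x2)
    (h12 : t1 ≠ t2) (h13 : t1 ≠ t3) (h23 : t2 ≠ t3) (a1 : t1 ≠ w) (b1 : t1 ≠ m w) (a2 : t2 ≠ w) (b2 : t2 ≠ m w)
    (a3 : t3 ≠ w) (b3 : t3 ≠ m w) : False := by
  obtain ⟨z1, p1, _, _, p4, p5, _, _, p8⟩ := n.E h hs1 hy k1 k a1 b1
  obtain ⟨z2, q1, _, _, q4, q5, _, _, q8⟩ := n.E h hs2 hy k2 k a2 b2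
  obtain ⟨z3, r1, _, _, r4, r5, _, _, r8⟩ := n.E h hs3 hy k3 k a3 b3
  have hu := n.d.D.1
  have e1 := k1.mne h hu
  have e2 := k2.mne h hu
  have d12 : z1 ≠ z2 := by
    rintro rfl
    rcases q8 _ (h.mS k1.1.1) p4 e1.1 e1.2 with e | e
    · exact mne2 h k1.1.1 k2.1.1 h12 e
    · exact mne2 h k1.1.1 k.1.1 a1 e
  have d13 : z1 ≠ z3 := by
    rintro rfl
    rcases r8 _ (h.mS k1.1.1) p4 e1.1 e1.2 with e | e
    · exact mne2 h k1.1.1 k3.1.1 h13 e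
    · exact mne2 h k1.1.1 k.1.1 a1 e
  have d23 : z2 ≠ z3 := by
    rintro rfl
    rcases r8 _ (h.mS k2.1.1) q4 e2.1 e2.2 with e | e
    · exact mne2 h k2.1.1 k3.1.1 h23 e
    · exact mne2 h k2.1.1 k.1.1 a2 e
  exact d23 (over3 h (h.mS k.1.1) p1 q1 r1 p5 q5 r5 d12 d13)

theorem XW.flip (h : Opt G S m) (hu : u ∈ S) {x w : V} (k : XW G S m u x w) : XW G S m (m u) x w :=
  ⟨k.1, k.2.1, k.2.2.2, by rw [h.mm hu]; exact k.2.2.1⟩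

theorem NT.threeY (h : Opt G S m) (n : NT G S m u y1 y2 x1 x2 a g c c' b b' e e') {y w s1 s2 s3 t1 t2 t3 : V}
    (hy : y = x1 ∨ y = x2) (k : XW G S m u y w) (k1 : XW G S m u s1 t1) (k2 : XW G S m u s2 t2) (k3 : XW G S m u s3 t3)
    (hs1 : s1 = y1 ∨ s1 = y2) (hs2 : s2 = y1 ∨ s2 = y2) (hs3 : s3 = y1 ∨ s3 = y2)
    (h12 : t1 ≠ t2) (h13 : t1 ≠ t3) (h23 : t2 ≠ t3) (a1 : t1 ≠ w) (b1 : t1 ≠ m w) (a2 : t2 ≠ w) (b2 : t2 ≠ m w)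
    (a3 : t3 ≠ w) (b3 : t3 ≠ m w) : False :=
  (n.mirror h).threeX h hy.symm (k.flip h n.d.D.1) (k1.flip h n.d.D.1) (k2.flip h n.d.D.1) (k3.flip h n.d.D.1)
    hs1.symm hs2.symm hs3.symm h12 h13 h23 a1 b1 a2 b2 a3 b3

theorem NT.pair_aux (h : Opt G S m) (n : NT G S m u y1 y2 x1 x2 a g c c' b b' e e') (hb : b' = m b) (h1 : c = b ∨ c = m b) :
    c' = b ∨ c' = m b := by
  by_contra h2
  push Not at h2
  have kb := n.wb h
  have kb' := n.wb' h
  have kc := n.wc h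
  have kc' := n.wc' h
  have hmb := h.mm n.bD.1
  subst hb
  obtain ⟨z, p1, p2, p3, p4, p5, p6, p7, p8⟩ := n.E h (Or.inr rfl) (Or.inl rfl) kc' kb h2.1 h2.2
  obtain ⟨z', q1, q2, q3, q4, q5, q6, q7, q8⟩ := n.E h (Or.inr rfl) (Or.inl rfl) kc' kb' h2.2 (by rw [hmb]; exact h2.1)
  rw [hmb] at q5
  rcases h1 with rfl | rfl
  · exact q3 (over3 h n.bD.1 n.d.hx2 q1 n.d.hy1 kc.2.1 q5 kb.2.1 q2.symm n.n12.symm)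
  · exact p3 (over3 h n.cD.1 n.d.hx2 p1 n.d.hy1 kc.2.1 p5 kb'.2.1 p2.symm n.n12.symm)

theorem NT.pair (h : Opt G S m) (n : NT G S m u y1 y2 x1 x2 a g c c' b b' e e') : b' ≠ m b := by
  intro hb
  have kb := n.wb h
  have kb' := n.wb' h
  have kc := n.wc h
  have kc' := n.wc' h
  have ka := n.wa h
  have hu := n.d.D.1
  have hmb := h.mm n.bD.1
  have hcc : (c = b ∨ c = m b) ∧ (c' = b ∨ c' = m b) := by
    by_cases h1 : c = b ∨ c = m b
    · exact ⟨h1, n.pair_aux h hb h1⟩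
    · by_cases h2 : c' = b ∨ c' = m b
      · exact ⟨n.swc.pair_aux h hb h2, h2⟩
      · exfalso
        push Not at h1 h2
        obtain ⟨z, p1, p2, p3, p4, p5, p6, p7, p8⟩ := n.E h (Or.inr rfl) (Or.inl rfl) kc kb h1.1 h1.2
        obtain ⟨z', q1, q2, q3, q4, q5, q6, q7, q8⟩ := n.E h (Or.inr rfl) (Or.inl rfl) kc' kb h2.1 h2.2
        have e1 := kc.mne h hu
        have : z = z' := over3 h (h.mS n.bD.1) n.d.hy1 p1 q1 (hb ▸ kb'.2.1) p5 q5 p3.symm q3.symm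
        subst this
        rcases q8 _ (h.mS kc.1.1) p4 e1.1 e1.2 with e | e
        · exact mne2 h kc.1.1 kc'.1.1 n.cc e
        · exact mne2 h kc.1.1 kb.1.1 h1.1 e
  have xb : G.Adj x2 b ∧ G.Adj x2 (m b) := by
    obtain ⟨h1, h2⟩ := hcc
    have i1 := kc.2.1
    have i2 := kc'.2.1
    rcases h1 with rfl | rfl
    · rcases h2 with rfl | rfl
      · exact absurd rfl n.cc
      · exact ⟨i1, i2⟩
    · rcases h2 with rfl | rfl
      · exact ⟨i2, i1⟩
      · exact absurd rfl n.cc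
  have a1 : a ≠ b := by
    rintro rfl
    exact n.n12 (over3 h n.aD.1 n.d.hx1 n.d.hy1 n.d.hx2 ka.2.1 kb.2.1 xb.1 n.n11.symm n.d.xx)
  have a2 : a ≠ m b := by
    intro e
    exact n.n12 (over3 h n.aD.1 n.d.hx1 n.d.hy1 n.d.hx2 ka.2.1 (by rw [e, ← hb]; exact kb'.2.1) (e ▸ xb.2) n.n11.symm n.d.xx)
  obtain ⟨z, p1, p2, p3, p4, p5, p6, p7, p8⟩ := n.E h (Or.inl rfl) (Or.inl rfl) ka kb a1 a2
  have : z = x2 := over3 h (h.mS n.bD.1) n.d.hy1 p1 n.d.hx2 (hb ▸ kb'.2.1) p5 xb.2 p3.symm n.n12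
  subst this
  exact p7 xb.1
end
end PDom

open Finset
set_option linter.unusedSectionVars false
set_option linter.unusedVariables false
set_option linter.unusedSimpArgs false
namespace PDom
section
variable {V : Type*} [Fintype V] [DecidableEq V] {G : SimpleGraph V} [DecidableRel G.Adj]
  {S : Finset V} {m : V → V}

variable {u y1 y2 x1 x2 a g c c' b b' e e' : V}

theorem ext2 (h : Opt G S m) {s t1 t2 : V} (hs : s ∈ S) (h1 : t1 ∉ S) (h2 : t2 ∉ S) (h12 : t1 ≠ t2)
    (a1 : G.Adj t1 s) (a2 : G.Adj t2 s) {z : V} (hz : z ∉ S) (az : G.Adj z s) : z = t1 ∨ z = t2 := by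
  by_cases e : z = t1
  · exact Or.inl e
  · exact Or.inr (over3 h hs h1 h2 hz a1 a2 az h12 (fun h => e h.symm)).symm

theorem mne1' (h : Opt G S m) {s t : V} (ht : t ∈ S) (e : s = m t) : t = m s := by
  rw [e, h.mm ht]

theorem NT.we' (h : Opt G S m) (n : NT G S m u y1 y2 x1 x2 a g c c' b b' e e') (he : isD G S m e') : XW G S m u y2 e' :=
  n.yw h (Or.inr rfl) he ((n.Y2 e').2 (by simp)) n.em'

theorem confQ (h : Opt G S m) (d : D11 G S m u y1 y2 x1 x2) (n11 : y1 ≠ x1) (n12 : y1 ≠ x2) (n21 : y2 ≠ x1) (n22 : y2 ≠ x2)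
    {p q : V} (hp : p ∈ S) (hq : q ∈ S) (p1 : p ≠ u) (p2 : p ≠ m u) (q1 : q ≠ u) (q2 : q ≠ m u) (qp : q ≠ p) (qp' : q ≠ m p)
    (a1 : G.Adj x1 (m p)) (a2 : G.Adj x1 (m q)) (a3 : G.Adj x2 (m p)) (a4 : G.Adj x2 q)
    (a5 : G.Adj y1 p) (a6 : G.Adj y1 q) (a7 : G.Adj y2 p) (a8 : G.Adj y2 (m q)) : False := by
  have hu := d.D.1
  have hu' := h.mS hu
  have hx1 : G.Adj x1 (m u) := ((d.Nm x1).2 (by simp)).symm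
  have hx2 : G.Adj x2 (m u) := ((d.Nm x2).2 (by simp)).symm
  obtain ⟨z, z1, z2, z3, z4, z5, z6, z7, z8, z9, z10⟩ := h.ex2 (a := x1) (b := m u) (a' := y1) (b' := p) hu hp hq
    p1 p2 q1 q2 qp qp' hx1 a5 n11.symm (fun e => d.hx1 (e ▸ hp)) (fun e => d.hy1 (e ▸ hu')) p2.symm
    (fun hh => absurd hh d.hx1) (by intro; simp) (fun hh => absurd hh d.hy1) (by intro; simp)
  have zS : z ∉ S := by
    intro hz
    rcases z10 hz with rfl | rfl | rfl | rfl | rfl | rfl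
    · exact z6 (h.madj hu)
    · exact z2 rfl
    · exact z4 rfl
    · exact z8 (h.madj hp).symm
    · exact z7 a6.symm
    · exact z5 a2.symm
  obtain ⟨s, hs, zs⟩ := h.dom z zS
  rcases z9 s hs zs with rfl | rfl | rfl | rfl | rfl | rfl
  · rcases (d.Nu z).1 zs.symm with e | e | e
    · exact zS (e ▸ hu')
    · exact z3 e
    · exact z8 (e ▸ a7)
  · exact z6 zs
  · exact z8 zs
  · rcases ext2 h hs d.hx1 d.hx2 d.xx a1 a3 zS zs with e | e
    · exact z1 e
    · exact z6 (e ▸ hx2)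
  · rcases ext2 h hs d.hy1 d.hx2 n12 a6 a4 zS zs with e | e
    · exact z3 e
    · exact z6 (e ▸ hx2)
  · rcases ext2 h hs d.hx1 d.hy2 n21.symm a2 a8 zS zs with e | e
    · exact z1 e
    · exact z8 (e ▸ a7)

/-- case C1a: common element of the X-side, mate on the Y-side -/
theorem NT.C1a (h : Opt G S m) (n : NT G S m u y1 y2 x1 x2 a g a c' b b' e e') (he : isD G S m e') (hb : b = m a) : False := by
  have hu := n.d.D.1
  have ka := n.wa h
  have kc' := n.wc' h
  have kb := n.wb h
  have kb' := n.wb' h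
  have ke := n.we h
  have ke' := n.we' h he
  have haS := ka.1.1
  have hcS := kc'.1.1
  have xa : G.Adj x2 a := (n.X2 a).2 (by simp)
  have pr : c' ≠ m a := (n.mirror h).pair h
  have prb := n.pair h
  have pre := (n.swY he).pair h
  have hma := h.mm haS
  have ac := n.cc
  obtain ⟨z, p1, p2, p3, p4, p5, p6, p7, p8⟩ := n.E h (Or.inr rfl) (Or.inl rfl) kc' kb (by rw [hb]; exact pr) (by rw [hb, hma]; exact ac.symm)
  rw [hb, hma] at p5
  have zx : z = x1 := by
    rcases ext2 h haS n.d.hx1 n.d.hx2 n.d.xx ka.2.1 xa p1 p5 with e | e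
    · exact e
    · exact absurd e p2
  subst zx
  have mc := kc'.mne h hu
  have mca : m c' ≠ a := mne1 h hcS pr
  have mc1 : m c' ≠ c' := h.mne hcS
  have k3 : XW G S m u z (m c') := ⟨isD_m h kc'.1, p4, mc.1, mc.2⟩
  have full : ∀ {w y : V}, (y = y1 ∨ y = y2) → XW G S m u y w → w = m a ∨ w = c' ∨ w = m c' := by
    intro w y hy k
    by_contra hh
    push Not at hh
    obtain ⟨f1, f2, f3⟩ := hh
    have wa : w ≠ a := by
      rintro rfl
      rcases ext2 h haS n.d.hx1 n.d.hx2 n.d.xx ka.2.1 xa (n.yu h hy).1 k.2.1 with e | e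
      · rcases hy with f | f
        · exact n.n11 (f.symm.trans e)
        · exact n.n21 (f.symm.trans e)
      · rcases hy with f | f
        · exact n.n12 (f.symm.trans e)
        · exact n.n22 (f.symm.trans e)
    exact n.threeX h hy k ka kc' k3 (Or.inl rfl) (Or.inr rfl) (Or.inl rfl) ac mca.symm mc1.symm wa.symm
      (fun e => f1 (mne1' h k.1.1 e)) f2.symm (fun e => f3 (mne1' h k.1.1 e)) f3.symm
      (fun e => mne2 h hcS k.1.1 f2.symm e)
  have fb' : b' = c' ∨ b' = m c' := by
    rcases full (Or.inl rfl) kb' with f | f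
    · exact absurd (hb.trans f.symm) n.bb
    · exact f
  have core : ∀ {w : V}, G.Adj y2 (m a) → (w = c' ∨ w = m c') → G.Adj y2 w → False := by
    intro w i1 hw i2
    rcases fb' with f | f
    · rcases hw with rfl | rfl
      · exact n.n22 (over3 h hcS n.d.hy1 n.d.hy2 n.d.hx2 (f ▸ kb'.2.1) i2 kc'.2.1 n.d.yy n.n12)
      · exact confQ h n.d n.n11 n.n12 n.n21 n.n22 (p := m a) (q := c') (h.mS haS) hcS (ka.mne h hu).1 (ka.mne h hu).2
          kc'.2.2.1 kc'.2.2.2 pr (by rw [hma]; exact ac.symm) (by rw [hma]; exact ka.2.1) p4 (by rw [hma]; exact xa) kc'.2.1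
          (hb ▸ kb.2.1) (f ▸ kb'.2.1) i1 i2
    · rcases hw with rfl | rfl
      · exact confQ h n.d.swY n.n21 n.n22 n.n11 n.n12 (p := m a) (q := w) (h.mS haS) hcS (ka.mne h hu).1 (ka.mne h hu).2
          kc'.2.2.1 kc'.2.2.2 pr (by rw [hma]; exact ac.symm) (by rw [hma]; exact ka.2.1) p4 (by rw [hma]; exact xa) kc'.2.1
          i1 i2 (hb ▸ kb.2.1) (f ▸ kb'.2.1)
      · exact n.n21 (over3 h (h.mS hcS) n.d.hy1 n.d.hy2 n.d.hx1 (f ▸ kb'.2.1) i2 p4 n.d.yy n.n11)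
  have hmc := h.mm hcS
  rcases full (Or.inr rfl) ke with f | f
  · rcases full (Or.inr rfl) ke' with f' | f'
    · exact n.ee (f.trans f'.symm)
    · exact core (f ▸ ke.2.1) f' ke'.2.1
  · rcases full (Or.inr rfl) ke' with f' | f'
    · exact core (f' ▸ ke'.2.1) f ke.2.1
    · rcases f with rfl | rfl <;> rcases f' with rfl | rfl
      · exact n.ee rfl
      · exact pre rfl
      · exact pre hmc.symm
      · exact n.ee rfl

/-- case C1b -/
theorem NT.C1b (h : Opt G S m) (n : NT G S m u y1 y2 x1 x2 a g a c' b b' b b') (h1 : b ≠ m a) (h2 : b' ≠ m a) : False := by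
  have hu := n.d.D.1
  have hu' := h.mS hu
  have ka := n.wa h
  have kc' := n.wc' h
  have kb := n.wb h
  have kb' := n.wb' h
  have haS := ka.1.1
  have hcS := kc'.1.1
  have hbS := kb.1.1
  have hbS' := kb'.1.1
  have xa : G.Adj x2 a := (n.X2 a).2 (by simp)
  have yb : G.Adj y2 b := (n.Y2 b).2 (by simp)
  have yb' : G.Adj y2 b' := (n.Y2 b').2 (by simp)
  have pr : c' ≠ m a := (n.mirror h).pair h
  have prb : b' ≠ m b := n.pair h
  have prb' : b ≠ m b' := n.swb.pair h
  have hma := h.mm haS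
  have ac := n.cc
  have xb : ∀ x, (x = x1 ∨ x = x2) → ¬ G.Adj x b := by
    intro x hx hh
    rcases ext2 h hbS n.d.hy1 n.d.hy2 n.d.yy kb.2.1 yb (n.xu h hx).1 hh with f | f
    · exact (n.xu h hx).2.2 (f ▸ (n.yu h (Or.inl rfl)).2.1)
    · exact (n.xu h hx).2.2 (f ▸ (n.yu h (Or.inr rfl)).2.1)
  have xb' : ∀ x, (x = x1 ∨ x = x2) → ¬ G.Adj x b' := by
    intro x hx hh
    rcases ext2 h hbS' n.d.hy1 n.d.hy2 n.d.yy kb'.2.1 yb' (n.xu h hx).1 hh with f | f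
    · exact (n.xu h hx).2.2 (f ▸ (n.yu h (Or.inl rfl)).2.1)
    · exact (n.xu h hx).2.2 (f ▸ (n.yu h (Or.inr rfl)).2.1)
  have cb : c' ≠ b := by rintro rfl; exact xb _ (Or.inr rfl) kc'.2.1
  have cb' : c' ≠ b' := by rintro rfl; exact xb' _ (Or.inr rfl) kc'.2.1
  have ab : a ≠ b := by rintro rfl; exact xb _ (Or.inl rfl) ka.2.1
  have ab2 : a ≠ m b := (mne1 h hbS h1).symm
  have cmb : c' ≠ m b := by
    intro f
    obtain ⟨z, p1, p2, p3, p4, p5, p6, p7, p8⟩ := n.E h (Or.inr rfl) (Or.inl rfl) kc' kb' cb' (by rw [f]; exact mne2 h hbS hbS' n.bb)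
    rw [f, h.mm hbS] at p4
    rcases ext2 h hbS n.d.hy1 n.d.hy2 n.d.yy kb.2.1 yb p1 p4 with f | f
    · exact p3 f
    · subst f
      exact p7 yb'
  obtain ⟨z1, p1, p2, p3, p4, p5, p6, p7, p8⟩ := n.E h (Or.inr rfl) (Or.inl rfl) (w1 := a) ⟨ka.1, xa, ka.2.2⟩ kb ab ab2
  obtain ⟨z3, q1, q2, q3, q4, q5, q6, q7, q8⟩ := n.E h (Or.inr rfl) (Or.inl rfl) kc' kb cb cmb
  have z13 : z1 ≠ z3 := by
    rintro rfl
    rcases q8 _ (h.mS haS) p4 (ka.mne h hu).1 (ka.mne h hu).2 with f | f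
    · exact mne2 h haS hcS ac f
    · exact mne2 h haS hbS ab f
  obtain ⟨z, t1, t2, t3, t4, t5, t6, t7, t8, t9, t10⟩ := h.ex2 (a := y1) (b := u) (a' := z1) (b' := m a) hu haS hbS
    ka.2.2.1 ka.2.2.2 kb.2.2.1 kb.2.2.2 ab.symm h1 (n.yu h (Or.inl rfl)).2.1 p4 p3.symm (fun f => n.d.hy1 (f ▸ h.mS haS))
    (fun f => p1 (f ▸ hu)) (ka.mne h hu).1.symm
    (fun hh => absurd hh n.d.hy1) (by intro; simp) (fun hh => absurd hh p1) (by intro; simp)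
  have zS : z ∉ S := by
    intro hz
    rcases t10 hz with rfl | rfl | rfl | rfl | rfl | rfl
    · exact t2 rfl
    · exact t6 (h.madj hu).symm
    · exact t8 (h.madj haS)
    · exact t4 rfl
    · exact t5 kb.2.1.symm
    · exact t7 p5.symm
  have nx2 : z ≠ x2 := by
    rintro rfl
    rcases t9 c' hcS kc'.2.1 with f | f | f | f | f | f
    · exact kc'.2.2.1 f
    · exact kc'.2.2.2 f
    · exact ac f.symm
    · exact pr f
    · exact cb f
    · exact cmb f
  have nx1 : z ≠ x1 := by
    rintro rfl
    have zg : G.Adj z g := (n.X1 g).2 (by simp)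
    rcases t9 g n.gS zg with f | f | f | f | f | f
    · exact t6 (f ▸ zg)
    · exact n.gm f
    · exact n.ag f.symm
    · exact t8 (f ▸ zg)
    · exact xb _ (Or.inl rfl) (f ▸ zg)
    · rcases ext2 h (h.mS hbS) p1 q1 z13 p5 q5 zS (f ▸ zg) with e | e
      · exact t3 e
      · rcases q8 a haS (e ▸ ka.2.1) ka.2.2.1 ka.2.2.2 with e' | e'
        · exact pr (mne1' h hcS e')
        · exact ab2 e'
  obtain ⟨s, hs, zs⟩ := h.dom z zS
  rcases t9 s hs zs with f | f | f | f | f | f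
  · exact t6 (f ▸ zs)
  · rw [f] at zs
    rcases (n.d.Nm z).1 zs.symm with e | e | e
    · exact zS (e ▸ hu)
    · exact nx1 e
    · exact nx2 e
  · rcases ext2 h haS n.d.hx1 n.d.hx2 n.d.xx ka.2.1 xa zS (f ▸ zs) with e | e
    · exact nx1 e
    · exact nx2 e
  · exact t8 (f ▸ zs)
  · rcases ext2 h hbS n.d.hy1 n.d.hy2 n.d.yy kb.2.1 yb zS (f ▸ zs) with e | e
    · exact t1 e
    · exact t6 (e ▸ (n.yu h (Or.inr rfl)).2.1)
  · rcases ext2 h (h.mS hbS) p1 q1 z13 p5 q5 zS (f ▸ zs) with e | e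
    · exact t3 e
    · rcases t9 (m c') (h.mS hcS) (e ▸ q4) with f | f | f | f | f | f
      · exact (kc'.mne h hu).1 f
      · exact (kc'.mne h hu).2 f
      · exact mne1 h hcS pr f
      · exact mne2 h hcS haS ac.symm f
      · exact mne1 h hcS cmb f
      · exact mne2 h hcS hbS cb f
end
end PDom

open Finset
set_option linter.unusedSectionVars false
set_option linter.unusedVariables false
set_option linter.unusedSimpArgs false
namespace PDom
section
variable {V : Type*} [Fintype V] [DecidableEq V] {G : SimpleGraph V} [DecidableRel G.Adj]
  {S : Finset V} {m : V → V}

variable {u y1 y2 x1 x2 a g c c' b b' e e' : V}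

theorem NT.C1 (h : Opt G S m) (n : NT G S m u y1 y2 x1 x2 a g a c' b b' e e') (he : isD G S m e') : False := by
  have ka := n.wa h
  have kb := n.wb h
  have kb' := n.wb' h
  have ke := n.we h
  have ke' := n.we' h he
  have haS := ka.1.1
  have xa : G.Adj x2 a := (n.X2 a).2 (by simp)
  by_cases h1 : b = m a
  · exact n.C1a h he h1
  by_cases h2 : b' = m a
  · exact n.swb.C1a h he h2
  by_cases h3 : e = m a
  · exact (n.swY he).C1a h n.bD' h3
  by_cases h4 : e' = m a
  · exact (n.swY he).swb.C1a h n.bD' h4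
  have na : ∀ {w y : V}, (y = y1 ∨ y = y2) → XW G S m u y w → w ≠ a := by
    rintro w y hy k rfl
    rcases ext2 h haS n.d.hx1 n.d.hx2 n.d.xx ka.2.1 xa (n.yu h hy).1 k.2.1 with e | e
    · rcases hy with f | f
      · exact n.n11 (f.symm.trans e)
      · exact n.n21 (f.symm.trans e)
    · rcases hy with f | f
      · exact n.n12 (f.symm.trans e)
      · exact n.n22 (f.symm.trans e)
  have nb := na (Or.inl rfl) kb
  have nb' := na (Or.inl rfl) kb'
  have ne := na (Or.inr rfl) ke
  have ne' := na (Or.inr rfl) ke'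
  have fe : e = b ∨ e = b' := by
    by_contra hh
    push Not at hh
    exact n.threeY h (Or.inl rfl) ka kb kb' ke (Or.inl rfl) (Or.inl rfl) (Or.inr rfl) n.bb hh.1.symm hh.2.symm nb h1 nb' h2 ne h3
  have fe' : e' = b ∨ e' = b' := by
    by_contra hh
    push Not at hh
    exact n.threeY h (Or.inl rfl) ka kb kb' ke' (Or.inl rfl) (Or.inl rfl) (Or.inr rfl) n.bb hh.1.symm hh.2.symm nb h1 nb' h2 ne' h4
  rcases fe with rfl | rfl
  · rcases fe' with rfl | rfl
    · exact n.ee rfl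
    · exact n.C1b h h1 h2
  · rcases fe' with rfl | rfl
    · exact (n.swe he).C1b h h1 h2
    · exact n.ee rfl

theorem NT.C2core (h : Opt G S m) (n : NT G S m u y1 y2 x1 x2 a g c c' b b' e e') (hc : c = m b) (hc' : c' = b')
    (ha : a = m b') (hbe : e = b) (he : e' = m b') : False := by
  subst hc hc' ha hbe he
  have hu := n.d.D.1
  have ka := n.wa h
  have kc := n.wc h
  have kc' := n.wc' h
  have kb := n.wb h
  have kb' := n.wb' h
  have ke := n.we h
  have prb := n.pair h
  have hcS := n.cD'.1
  have heS := n.eD.1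
  have y2b : G.Adj y2 (m c') := (n.Y2 _).2 (by simp)
  obtain ⟨z, p1, p2, p3, p4, p5, p6, p7, p8⟩ := n.E h (Or.inr rfl) (Or.inr rfl) kc' ke n.bb.symm prb
  have zx : z = x1 := by
    rcases ext2 h (h.mS hcS) n.d.hx1 n.d.hy2 n.n21.symm ka.2.1 y2b p1 p4 with f | f
    · exact f
    · exact absurd f p3
  subst zx
  exact confQ h n.d n.n11 n.n12 n.n21 n.n22 heS hcS kb.2.2.1 kb.2.2.2 kb'.2.2.1 kb'.2.2.2 n.bb.symm prb
    p5 p4 kc.2.1 kc'.2.1 kb.2.1 kb'.2.1 ke.2.1 y2b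

theorem NT.C2a' (h : Opt G S m) (n : NT G S m u y1 y2 x1 x2 a g c c' b b' e e') (he : isD G S m e') (hac : a ≠ c) (hac' : a ≠ c')
    (hbe : e = b) (hc : c = m b) (hX : ∀ w, w = a ∨ w = c' → w = m b ∨ w = b' ∨ w = m b') (hm : e' = m b') : False := by
  have hbS' := n.bD'.1
  have fa := hX a (Or.inl rfl)
  have fc := hX c' (Or.inr rfl)
  have c1 := n.cc
  rw [hc] at hac c1
  rcases fa with fa | fa | fa
  · exact hac fa
  · rcases fc with fc | fc | fc
    · exact c1 fc.symm
    · exact hac' (fa.trans fc.symm)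
    · exact (n.swY he).C2core h (hbe ▸ hc) (fc.trans hm.symm) (by rw [hm, h.mm hbS']; exact fa) hbe.symm (by rw [hm, h.mm hbS'])
  · rcases fc with fc | fc | fc
    · exact c1 fc.symm
    · exact n.C2core h hc fc fa hbe hm
    · exact hac' (fa.trans fc.symm)

theorem NT.C2a (h : Opt G S m) (n : NT G S m u y1 y2 x1 x2 a g c c' b b' e e') (he : isD G S m e') (hac : a ≠ c) (hac' : a ≠ c')
    (hbe : e = b) : False := by
  have hu := n.d.D.1
  have ka := n.wa h
  have kc := n.wc h
  have kc' := n.wc' h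
  have kb := n.wb h
  have kb' := n.wb' h
  have ke := n.we h
  have ke' := n.we' h he
  have prb := n.pair h
  have prb' := n.swb.pair h
  have prc : c' ≠ m c := (n.mirror h).pair h
  have hbS := n.bD.1
  have hbS' := n.bD'.1
  have y2b : G.Adj y2 b := hbe ▸ ke.2.1
  have nb : ∀ {w x : V}, (x = x1 ∨ x = x2) → XW G S m u x w → w ≠ b := by
    rintro w x hx k rfl
    rcases ext2 h hbS n.d.hy1 n.d.hy2 n.d.yy kb.2.1 y2b (n.xu h hx).1 k.2.1 with f | f
    · exact (n.xu h hx).2.2 (f ▸ (n.yu h (Or.inl rfl)).2.1)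
    · exact (n.xu h hx).2.2 (f ▸ (n.yu h (Or.inr rfl)).2.1)
  have na := nb (Or.inl rfl) ka
  have nc := nb (Or.inr rfl) kc
  have nc' := nb (Or.inr rfl) kc'
  have em : e' = m b' := by
    have : ∃ x, (x = x1 ∨ x = x2) ∧ XW G S m u x (m b) := by
      by_contra hh
      push Not at hh
      exact n.threeX h (Or.inl rfl) kb ka kc kc' (Or.inl rfl) (Or.inr rfl) (Or.inr rfl) hac hac' n.cc na
        (fun f => hh _ (Or.inl rfl) (f ▸ ka)) nc (fun f => hh _ (Or.inr rfl) (f ▸ kc)) nc' (fun f => hh _ (Or.inr rfl) (f ▸ kc'))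
    obtain ⟨x, hx, k⟩ := this
    obtain ⟨z, p1, p2, p3, p4, p5, p6, p7, p8⟩ := n.E h hx (Or.inl rfl) k kb' prb.symm (mne2 h hbS hbS' n.bb)
    rw [h.mm hbS] at p4
    rcases ext2 h hbS n.d.hy1 n.d.hy2 n.d.yy kb.2.1 y2b p1 p4 with f | f
    · exact absurd f p3
    · subst f
      rcases (n.Y2 _).1 p5 with f | f | f
      · exact absurd f (kb'.mne h hu).1
      · exact absurd (hbe.symm.trans f.symm) prb'
      · exact f.symm
  have hX : ∀ {w x : V}, (x = x1 ∨ x = x2) → XW G S m u x w → w = m b ∨ w = b' ∨ w = m b' := by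
    intro w x hx k
    by_contra hh
    push Not at hh
    obtain ⟨f1, f2, f3⟩ := hh
    exact n.threeY h hx k kb kb' ke' (Or.inl rfl) (Or.inl rfl) (Or.inr rfl) n.bb (fun f => n.ee (hbe.trans f))
      (fun f => h.mne hbS' (f.trans em).symm) (nb hx k).symm (fun f => f1 (mne1' h k.1.1 f)) f2.symm
      (fun f => f3 (mne1' h k.1.1 f)) (fun f => f3 (f.symm.trans em)) (fun f => mne2 h hbS' k.1.1 f2.symm (em.symm.trans f))
  have fa := hX (Or.inl rfl) ka
  have fc := hX (Or.inr rfl) kc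
  have fc' := hX (Or.inr rfl) kc'
  have hmb := h.mm hbS'
  rcases fc with f | f
  · exact n.C2a' h he hac hac' hbe f (by rintro w (rfl | rfl); exacts [fa, fc']) em
  · rcases fc' with f' | f'
    · exact n.swc.C2a' h he hac' hac hbe f' (by rintro w (rfl | rfl); exacts [fa, Or.inr f]) em
    · rcases f with rfl | rfl <;> rcases f' with rfl | rfl
      · exact n.cc rfl
      · exact prc rfl
      · exact prc hmb.symm
      · exact n.cc rfl

/-- the Petersen configuration -/
structure Pet (G : SimpleGraph V) (S : Finset V) (m : V → V) (u y1 y2 x1 x2 c c' : V) : Prop where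
  d : D11 G S m u y1 y2 x1 x2
  n11 : y1 ≠ x1
  n12 : y1 ≠ x2
  n21 : y2 ≠ x1
  n22 : y2 ≠ x2
  X1 : ∀ t, G.Adj x1 t ↔ t = m u ∨ t = m c ∨ t = m c'
  X2 : ∀ t, G.Adj x2 t ↔ t = m u ∨ t = c ∨ t = c'
  Y1 : ∀ t, G.Adj y1 t ↔ t = u ∨ t = c ∨ t = m c'
  Y2 : ∀ t, G.Adj y2 t ↔ t = u ∨ t = m c ∨ t = c'
  cS : c ∈ S
  cS' : c' ∈ S
  cu : c ≠ u
  cu' : c' ≠ u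
  cm : c ≠ m u
  cm' : c' ≠ m u
  cc : c ≠ c'
  cc' : c' ≠ m c

theorem NT.C2b' (h : Opt G S m) (n : NT G S m u y1 y2 x1 x2 a g c c' b b' e e') (he : isD G S m e')
    (ha : a = m c) (hb : b = c) (hb' : b' = c' ∨ b' = m c') (hE : (e = m c ∨ e = c' ∨ e = m c')) (hE' : (e' = m c ∨ e' = c' ∨ e' = m c'))
    (hbe : b' ≠ e) (hbe' : b' ≠ e') : ∃ u y1 y2 x1 x2 c c', Pet G S m u y1 y2 x1 x2 c c' := by
  have hu := n.d.D.1
  have ka := n.wa h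
  have kc := n.wc h
  have kc' := n.wc' h
  have kb := n.wb h
  have kb' := n.wb' h
  have ke := n.we h
  have ke' := n.we' h he
  have prc : c' ≠ m c := (n.mirror h).pair h
  have pre := (n.swY he).pair h
  have hcS := kc.1.1
  have hcS' := kc'.1.1
  subst ha hb
  rcases hb' with rfl | rfl
  · obtain ⟨z, p1, p2, p3, p4, p5, p6, p7, p8⟩ := n.E h (Or.inl rfl) (Or.inl rfl) ka kb' prc.symm (mne2 h hcS hcS' n.cc)
    rw [h.mm hcS] at p4
    rcases ext2 h hcS n.d.hx2 n.d.hy1 n.n12.symm kc.2.1 kb.2.1 p1 p4 with f | f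
    · subst f
      exact absurd kc'.2.1 p7
    · exact absurd f p3
  · have key : G.Adj y2 (m b) ∧ G.Adj y2 c' := by
      rcases hE with f | f | f
      · rcases hE' with f' | f' | f'
        · exact absurd (f.trans f'.symm) n.ee
        · exact ⟨f ▸ ke.2.1, f' ▸ ke'.2.1⟩
        · exact absurd f'.symm hbe'
      · rcases hE' with f' | f' | f'
        · exact ⟨f' ▸ ke'.2.1, f ▸ ke.2.1⟩
        · exact absurd (f.trans f'.symm) n.ee
        · exact absurd f'.symm hbe'
      · exact absurd f.symm hbe
    obtain ⟨z, p1, p2, p3, p4, p5, p6, p7, p8⟩ := n.E h (Or.inr rfl) (Or.inr rfl) kc (w2 := c') ⟨kc'.1, key.2, kc'.2.2⟩ n.cc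
      (mne1 h hcS' prc).symm
    have zx : z = x1 := by
      rcases ext2 h (h.mS hcS) n.d.hx1 n.d.hy2 n.n21.symm ka.2.1 key.1 p1 p4 with f | f
      · exact f
      · exact absurd f p3
    subst zx
    exact ⟨u, y1, y2, z, x2, b, c', n.d, n.n11, n.n12, n.n21, n.n22,
      nb3''' h.cub (n.xu h (Or.inl rfl)).2.1 p4 p5 ka.2.2.2.symm (kc'.mne h hu).2.symm (mne2 h hcS hcS' n.cc),
      n.X2, n.Y1,
      nb3''' h.cub (n.yu h (Or.inr rfl)).2.1 key.1 key.2 ka.2.2.1.symm kc'.2.2.1.symm prc.symm,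
      hcS, hcS', kc.2.2.1, kc'.2.2.1, kc.2.2.2, kc'.2.2.2, n.cc, prc⟩

theorem NT.Y4 (h : Opt G S m) (n : NT G S m u y1 y2 x1 x2 a g c c' b b' e e') (he : isD G S m e')
    (h1 : e ≠ b) (h2 : e ≠ b') (h3 : e' ≠ b) (h4 : e' ≠ b') {x w : V} (hx : x = x1 ∨ x = x2) (k : XW G S m u x w) :
    (w = b ∨ w = b' ∨ w = e ∨ w = e') ∧ (m w = b ∨ m w = b' ∨ m w = e ∨ m w = e') := by
  have kb := n.wb h
  have kb' := n.wb' h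
  have ke := n.we h
  have ke' := n.we' h he
  have bb := n.bb
  have ee := n.ee
  have T : ∀ {s1 s2 s3 t1 t2 t3 : V}, XW G S m u s1 t1 → XW G S m u s2 t2 → XW G S m u s3 t3 → (s1 = y1 ∨ s1 = y2) →
    (s2 = y1 ∨ s2 = y2) → (s3 = y1 ∨ s3 = y2) → t1 ≠ t2 → t1 ≠ t3 → t2 ≠ t3 →
    ¬ (t1 ≠ w ∧ t1 ≠ m w ∧ t2 ≠ w ∧ t2 ≠ m w ∧ t3 ≠ w ∧ t3 ≠ m w) := by
    intro s1 s2 s3 t1 t2 t3 k1 k2 k3 i1 i2 i3 d1 d2 d3 ⟨j1, j2, j3, j4, j5, j6⟩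
    exact n.threeY h hx k k1 k2 k3 i1 i2 i3 d1 d2 d3 j1 j2 j3 j4 j5 j6
  have T1 := T kb kb' ke (Or.inl rfl) (Or.inl rfl) (Or.inr rfl) bb h1.symm h2.symm
  have T2 := T kb kb' ke' (Or.inl rfl) (Or.inl rfl) (Or.inr rfl) bb h3.symm h4.symm
  have T3 := T kb ke ke' (Or.inl rfl) (Or.inr rfl) (Or.inr rfl) h1.symm h3.symm ee
  have T4 := T kb' ke ke' (Or.inl rfl) (Or.inr rfl) (Or.inr rfl) h2.symm h4.symm ee
  clear T
  generalize m w = v at *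
  clear n he hx k kb kb' ke ke' h
  constructor
  · by_contra hh
    push Not at hh
    obtain ⟨g1, g2, g3, g4⟩ := hh
    grind
  · by_contra hh
    push Not at hh
    obtain ⟨g1, g2, g3, g4⟩ := hh
    grind

theorem NT.C2b3 (h : Opt G S m) (n : NT G S m u y1 y2 x1 x2 a g c c' b b' e e') (he : isD G S m e')
    (h1 : e ≠ b) (h2 : e ≠ b') (h3 : e' ≠ b) (h4 : e' ≠ b') (ha : a = m c) (hb : b = c) :
    ∃ u y1 y2 x1 x2 c c', Pet G S m u y1 y2 x1 x2 c c' := by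
  have kc := n.wc h
  have kc' := n.wc' h
  have prc : c' ≠ m c := (n.mirror h).pair h
  have prb := n.pair h
  have Yc := n.Y4 h he h1 h2 h3 h4 (Or.inr rfl) kc
  have Yc' := n.Y4 h he h1 h2 h3 h4 (Or.inr rfl) kc'
  have mcc := mne2 h kc.1.1 kc'.1.1 n.cc
  have mc1 := h.mne kc.1.1
  have mc2 := h.mne kc'.1.1
  have mc3 := mne1 h kc'.1.1 prc
  have bb := n.bb
  have ee := n.ee
  have cc := n.cc
  refine n.C2b' h he ha hb ?_ ?_ ?_ h2.symm h4.symm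
  all_goals
    subst hb
    generalize m b = w at *
    generalize m c' = w' at *
    clear n he kc kc' h
    grind

theorem NT.C2b2 (h : Opt G S m) (n : NT G S m u y1 y2 x1 x2 a g c c' b b' e e') (he : isD G S m e')
    (h1 : e ≠ b) (h2 : e ≠ b') (h3 : e' ≠ b) (h4 : e' ≠ b') (ha : a = m c) :
    ∃ u y1 y2 x1 x2 c c', Pet G S m u y1 y2 x1 x2 c c' := by
  rcases (n.Y4 h he h1 h2 h3 h4 (Or.inr rfl) (n.wc h)).1 with f | f | f | f
  · exact n.C2b3 h he h1 h2 h3 h4 ha f.symm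
  · exact n.swb.C2b3 h he h2 h1 h4 h3 ha f.symm
  · exact (n.swY he).C2b3 h n.bD' h1.symm h3.symm h2.symm h4.symm ha f.symm
  · exact (n.swY he).swb.C2b3 h n.bD' h3.symm h1.symm h4.symm h2.symm ha f.symm

theorem NT.fin (h : Opt G S m) (n : NT G S m u y1 y2 x1 x2 a g c c' b b' e e') (he : isD G S m e') :
    ∃ u y1 y2 x1 x2 c c', Pet G S m u y1 y2 x1 x2 c c' := by
  by_cases i1 : a = c
  · subst i1
    exact (n.C1 h he).elim
  by_cases i2 : a = c'
  · subst i2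
    exact (n.swc.C1 h he).elim
  by_cases h1 : e = b
  · exact (n.C2a h he i1 i2 h1).elim
  by_cases h2 : e = b'
  · exact (n.swb.C2a h he i1 i2 h2).elim
  by_cases h3 : e' = b
  · exact ((n.swe he).C2a h n.eD i1 i2 h3).elim
  by_cases h4 : e' = b'
  · exact ((n.swe he).swb.C2a h n.eD i1 i2 h4).elim
  have prc : c' ≠ m c := (n.mirror h).pair h
  have Ya := (n.Y4 h he h1 h2 h3 h4 (Or.inl rfl) (n.wa h)).1
  have Yc := n.Y4 h he h1 h2 h3 h4 (Or.inr rfl) (n.wc h)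
  have Yc' := n.Y4 h he h1 h2 h3 h4 (Or.inr rfl) (n.wc' h)
  have mcc := mne2 h n.cD.1 n.cD'.1 n.cc
  have mc1 := h.mne n.cD.1
  have mc2 := h.mne n.cD'.1
  have mc3 := mne1 h n.cD'.1 prc
  have cc := n.cc
  have fa : a = m c ∨ a = m c' := by
    generalize m c = w at *
    generalize m c' = w' at *
    clear n he h
    grind
  rcases fa with f | f
  · exact n.C2b2 h he h1 h2 h3 h4 f
  · exact n.swc.C2b2 h he h1 h2 h3 h4 f
end
end PDom

open Finset
set_option linter.unusedSectionVars false
set_option linter.unusedVariables false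
set_option linter.unusedSimpArgs false
namespace PDom
section
variable {V : Type*} [Fintype V] [DecidableEq V] {G : SimpleGraph V} [DecidableRel G.Adj]
  {S : Finset V} {m : V → V}

variable {u y1 y2 x1 x2 : V}

theorem slot3 (h : Opt G S m) {x s : V} (hs : isD G S m s) (hx : G.Adj x s) (hw : wt G S m x s < 1/2) :
    ∃ p q, p ≠ q ∧ p ≠ s ∧ q ≠ s ∧ isD G S m p ∧ q ∈ S ∧ ∀ t, G.Adj x t ↔ t = s ∨ t = p ∨ t = q := by
  have h1 : ∃ p, isD G S m p ∧ G.Adj x p ∧ p ≠ s := by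
    by_contra hh
    push Not at hh
    have := wD_noD h hs hx hh
    linarith
  obtain ⟨p, hp, xp, ps⟩ := h1
  obtain ⟨q, q1, q2, hN⟩ := nb3'' h.cub hx xp ps.symm
  refine ⟨p, q, q2, ps, q1.symm, hp, ?_, hN⟩
  by_contra hq
  have := wD_two h hs hx (t := p) (by
    intro r hr hxr
    rcases (hN r).1 hxr with f | f | f
    · exact Or.inl f
    · exact Or.inr f
    · exact absurd (f ▸ hr) hq)
  linarith

theorem ntmain (h : Opt G S m) (d : D11 G S m u y1 y2 x1 x2) (n11 : y1 ≠ x1) (n12 : y1 ≠ x2) (n21 : y2 ≠ x1) (n22 : y2 ≠ x2)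
    (w1 : wt G S m y1 u < 1/2) (w2 : wt G S m y2 u < 1/2) (w3 : wt G S m x1 (m u) < 1/2) (w4 : wt G S m x2 (m u) < 1/2)
    (h1 : ∀ t ∈ S, G.Adj y1 t → isD G S m t) (h2 : ∀ t ∈ S, G.Adj y2 t → isD G S m t) (h4 : ∀ t ∈ S, G.Adj x2 t → isD G S m t) :
    ∃ u y1 y2 x1 x2 c c', Pet G S m u y1 y2 x1 x2 c c' := by
  have hu := d.D
  have hu' := isD_m h hu
  obtain ⟨b, b', i1, i2, i3, i4, i5, i6⟩ := slot3 h hu ((d.Nu y1).2 (by simp)).symm w1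
  obtain ⟨e, e', j1, j2, j3, j4, j5, j6⟩ := slot3 h hu ((d.Nu y2).2 (by simp)).symm w2
  obtain ⟨a, g, k1, k2, k3, k4, k5, k6⟩ := slot3 h hu' ((d.Nm x1).2 (by simp)).symm w3
  obtain ⟨c, c', l1, l2, l3, l4, l5, l6⟩ := slot3 h hu' ((d.Nm x2).2 (by simp)).symm w4
  exact NT.fin h (a := a) (g := g) (c := c) (c' := c') (b := b) (b' := b') (e := e) (e' := e')
    ⟨d, n11, n12, n21, n22, k6, l6, i6, j6, k1, l1, i1, j1, k2, k3, l2, l3, i2, i3, j2, j3, k4, l4,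
      h4 _ l5 ((l6 _).2 (by simp)), i4, h1 _ i5 ((i6 _).2 (by simp)), j4, k5, j5⟩ (h2 _ j5 ((j6 _).2 (by simp)))

theorem ntsum (h : Opt G S m) (d : D11 G S m u y1 y2 x1 x2) (n11 : y1 ≠ x1) (n12 : y1 ≠ x2) (n21 : y2 ≠ x1) (n22 : y2 ≠ x2)
    (hp : ∀ x, ¬ payer G S m x u) (hp' : ∀ x, ¬ payer G S m x (m u))
    (hP : ¬ ∃ u y1 y2 x1 x2 c c', Pet G S m u y1 y2 x1 x2 c c') :
    3/2 ≤ wt G S m y1 u + wt G S m y2 u + (wt G S m x1 (m u) + wt G S m x2 (m u)) := by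
  by_contra hlt
  have hu := d.D
  have hu' := isD_m h hu
  have a1 := ((d.Nu y1).2 (by simp)).symm
  have a2 := ((d.Nu y2).2 (by simp)).symm
  have a3 := ((d.Nm x1).2 (by simp)).symm
  have a4 := ((d.Nm x2).2 (by simp)).symm
  have t1 := wD_third h hu a1 (hp _)
  have t2 := wD_third h hu a2 (hp _)
  have t3 := wD_third h hu' a3 (hp' _)
  have t4 := wD_third h hu' a4 (hp' _)
  have q : ∀ {x s : V}, isD G S m s → G.Adj x s → (∀ t ∈ S, G.Adj x t → isD G S m t) ∨ 5/12 ≤ wt G S m x s := by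
    intro x s hs hx
    by_cases c : ∀ t ∈ S, G.Adj x t → isD G S m t
    · exact Or.inl c
    · push Not at c
      obtain ⟨t, i1, i2, i3⟩ := c
      exact Or.inr (wD_512 h hs hx i1 i2 i3)
  have s1 := q hu a1
  have s2 := q hu a2
  have s3 := q hu' a3
  have s4 := q hu' a4
  have w1 : wt G S m y1 u < 1/2 := by linarith
  have w2 : wt G S m y2 u < 1/2 := by linarith
  have w3 : wt G S m x1 (m u) < 1/2 := by linarith
  have w4 : wt G S m x2 (m u) < 1/2 := by linarith
  have mm := h.mm hu.1
  have w1' : wt G S m y1 (m (m u)) < 1/2 := by rw [mm]; exact w1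
  have w2' : wt G S m y2 (m (m u)) < 1/2 := by rw [mm]; exact w2
  rcases s1 with s1 | s1
  · rcases s2 with s2 | s2
    · rcases s4 with s4 | s4
      · exact hP (ntmain h d n11 n12 n21 n22 w1 w2 w3 w4 s1 s2 s4)
      · rcases s3 with s3 | s3
        · exact hP (ntmain h d.swX n12 n11 n22 n21 w1 w2 w4 w3 s1 s2 s3)
        · linarith
    · rcases s3 with s3 | s3
      · rcases s4 with s4 | s4
        · exact hP (ntmain h ((d.swY).swU h) n21.symm n11.symm n22.symm n12.symm w3 w4 w2' w1' s3 s4 s1)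
        · linarith
      · linarith
  · rcases s2 with s2 | s2
    · rcases s3 with s3 | s3
      · rcases s4 with s4 | s4
        · exact hP (ntmain h (d.swU h) n11.symm n21.symm n12.symm n22.symm w3 w4 w1' w2' s3 s4 s2)
        · linarith
      · linarith
    · linarith

theorem d11sum (h : Opt G S m) (d : D11 G S m u y1 y2 x1 x2)
    (hP : ¬ ∃ u y1 y2 x1 x2 c c', Pet G S m u y1 y2 x1 x2 c c') :
    3/2 ≤ wt G S m y1 u + wt G S m y2 u + (wt G S m x1 (m u) + wt G S m x2 (m u)) := by
  have hu := d.D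
  have mm := h.mm hu.1
  have pay : ∀ {x w : V}, payer G S m x w → G.Adj w x := by
    rintro x w ⟨p, _, hw, _, _, hN, _⟩
    exact ((hN w hw.1).2 (by simp)).symm
  have pS1 : ∀ {x : V}, payer G S m x u → x ≠ m u := by
    rintro x ⟨p, hp1, hw, q1, q2, hN, _⟩ rfl
    rcases (d.Nm p).1 ((hN p hp1.1).2 (by simp)) with f | f | f
    · exact q1 f.symm
    · exact d.hx1 (f ▸ hp1.1)
    · exact d.hx2 (f ▸ hp1.1)
  have pS2 : ∀ {x : V}, payer G S m x (m u) → x ≠ u := by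
    rintro x ⟨p, hp1, hw, q1, q2, hN, _⟩ rfl
    rcases (d.Nu p).1 ((hN p hp1.1).2 (by simp)) with f | f | f
    · exact q1 f.symm
    · exact d.hy1 (f ▸ hp1.1)
    · exact d.hy2 (f ▸ hp1.1)
  by_cases hp : ∃ x, payer G S m x u
  · obtain ⟨x, hx⟩ := hp
    rcases (d.Nu x).1 (pay hx) with f | rfl | rfl
    · exact absurd f (pS1 hx)
    · exact payAll h d hx
    · have := payAll h d.swY hx
      linarith
  by_cases hp' : ∃ x, payer G S m x (m u)
  · obtain ⟨x, hx⟩ := hp'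
    have d' := d.swU h
    rcases (d.Nm x).1 (pay hx) with f | rfl | rfl
    · exact absurd f (pS2 hx)
    · have := payAll h d' hx
      rw [mm] at this
      linarith
    · have := payAll h d'.swY hx
      rw [mm] at this
      linarith
  push Not at hp hp'
  by_cases n11 : y1 = x1
  · subst n11
    by_cases n22 : y2 = x2
    · subst n22
      exact tri2 h d hp hp'
    · exact tri1 h d n22 hp hp'
  by_cases n12 : y1 = x2
  · subst n12
    by_cases n21 : y2 = x1
    · subst n21
      have := tri2 h d.swX hp hp'
      linarith
    · have := tri1 h d.swX n21 hp hp'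
      linarith
  by_cases n21 : y2 = x1
  · subst n21
    have := tri1 h d.swY n12 hp hp'
    linarith
  by_cases n22 : y2 = x2
  · subst n22
    have := tri1 h d.swX.swY n11 hp hp'
    linarith
  exact ntsum h d n11 n12 n21 n22 hp hp' hP

theorem pairD (h : Opt G S m) (hu : isD G S m u) (hP : ¬ ∃ u y1 y2 x1 x2 c c', Pet G S m u y1 y2 x1 x2 c c') :
    3/2 ≤ fin G S m u + fin G S m (m u) := by
  have mm := h.mm hu.1
  have hu' := isD_m h hu
  have aux : ∀ {u : V}, isD G S m u → (∃ v ∈ S, G.Adj u v ∧ v ≠ m u) → 3/2 ≤ fin G S m u + fin G S m (m u) := by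
    rintro u hu ⟨v, hv, huv, hvm⟩
    by_cases hD : isD G S m v
    · exact pairDD h hu hD huv hvm
    · obtain ⟨y, y1, y2, hN⟩ := nb3'' h.cub (h.madj hu.1) huv hvm.symm
      by_cases hy : y ∈ S
      · exact pairD31 h hu hv hy hvm.symm y1 y2 hN
      · exact pairD21 h hu hv hD hvm.symm y1 y2 hN hy
  by_cases c1 : ∃ v ∈ S, G.Adj u v ∧ v ≠ m u
  · exact aux hu c1
  by_cases c2 : ∃ v ∈ S, G.Adj (m u) v ∧ v ≠ m (m u)
  · have := aux hu' c2
    rw [mm] at this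
    linarith
  push Not at c1 c2
  obtain ⟨y1, y2, p1, p2, p3, p4⟩ := slots h hu.1
  obtain ⟨x1, x2, q1, q2, q3, q4⟩ := slots h hu'.1
  have r1 : y1 ∉ S := fun hh => p1 (c1 _ hh ((p4 _).2 (by simp))).symm
  have r2 : y2 ∉ S := fun hh => p2 (c1 _ hh ((p4 _).2 (by simp))).symm
  have r3 : x1 ∉ S := fun hh => q1 (c2 _ hh ((q4 _).2 (by simp))).symm
  have r4 : x2 ∉ S := fun hh => q2 (c2 _ hh ((q4 _).2 (by simp))).symm
  rw [fin_eq p1 p2 p3 p4, fin_eq q1 q2 q3 q4, ctr_ext r1, ctr_ext r2, ctr_ext r3, ctr_ext r4]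
  exact d11sum h ⟨hu, p4, by rw [mm] at q4; exact q4, r1, r2, r3, r4, p3, q3⟩ hP

theorem bound (h : Opt G S m) (hP : ¬ ∃ u y1 y2 x1 x2 c c', Pet G S m u y1 y2 x1 x2 c c') :
    7 * S.card ≤ 4 * Fintype.card V := by
  refine main_sum h fun s hs => ?_
  by_cases h1 : isD G S m s
  · exact pairD h h1 hP
  by_cases h2 : isA G S m s
  · exact pairA h h2
  exact pairBC h ⟨hs, h1, h2⟩

theorem Pet.iso (h : Opt G S m) (hconn : G.Connected) {c c' : V} (P : Pet G S m u y1 y2 x1 x2 c c') :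
    Nonempty (G ≃g petersenGraph) := by
  have hu := P.d.D.1
  have hu' := h.mS hu
  have cS := P.cS
  have cS' := P.cS'
  have mcS := h.mS cS
  have mcS' := h.mS cS'
  have Nc : ∀ t, G.Adj c t ↔ t = m c ∨ t = x2 ∨ t = y1 := nb3''' h.cub (h.madj cS) ((P.X2 c).2 (by simp)).symm
    ((P.Y1 c).2 (by simp)).symm (fun f => P.d.hx2 (f ▸ mcS)) (fun f => P.d.hy1 (f ▸ mcS)) P.n12.symm
  have Nc1 : ∀ t, G.Adj (m c) t ↔ t = c ∨ t = x1 ∨ t = y2 := nb3''' h.cub (h.madj cS).symm ((P.X1 (m c)).2 (by simp)).symm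
    ((P.Y2 (m c)).2 (by simp)).symm (fun f => P.d.hx1 (f ▸ cS)) (fun f => P.d.hy2 (f ▸ cS)) P.n21.symm
  have Nc' : ∀ t, G.Adj c' t ↔ t = m c' ∨ t = x2 ∨ t = y2 := nb3''' h.cub (h.madj cS') ((P.X2 c').2 (by simp)).symm
    ((P.Y2 c').2 (by simp)).symm (fun f => P.d.hx2 (f ▸ mcS')) (fun f => P.d.hy2 (f ▸ mcS')) P.n22.symm
  have Nc1' : ∀ t, G.Adj (m c') t ↔ t = c' ∨ t = x1 ∨ t = y1 := nb3''' h.cub (h.madj cS').symm ((P.X1 (m c')).2 (by simp)).symm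
    ((P.Y1 (m c')).2 (by simp)).symm (fun f => P.d.hx1 (f ▸ cS')) (fun f => P.d.hy1 (f ▸ cS')) P.n11.symm
  let φ : Fin 10 → V := ![u, m u, x1, x2, y1, y2, c, m c, c', m c']
  let ψ : Fin 10 → {s : Finset (Fin 5) // s.card = 2} := ![⟨{0, 1}, rfl⟩, ⟨{2, 3}, rfl⟩, ⟨{0, 4}, rfl⟩, ⟨{1, 4}, rfl⟩, ⟨{2, 4}, rfl⟩,
    ⟨{3, 4}, rfl⟩, ⟨{0, 3}, rfl⟩, ⟨{1, 2}, rfl⟩, ⟨{0, 2}, rfl⟩, ⟨{1, 3}, rfl⟩]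
  have hψ : Function.Bijective ψ := by decide
  let A : Fin 10 → Fin 10 × Fin 10 × Fin 10 := ![(1, 4, 5), (0, 2, 3), (1, 7, 9), (1, 6, 8), (0, 6, 9), (0, 7, 8), (7, 3, 4), (6, 2, 5), (9, 3, 5), (8, 2, 4)]
  have hA : ∀ i j, Disjoint (ψ i).1 (ψ j).1 ↔ j = (A i).1 ∨ j = (A i).2.1 ∨ j = (A i).2.2 := by decide
  have hG : ∀ i t, G.Adj (φ i) t ↔ t = φ (A i).1 ∨ t = φ (A i).2.1 ∨ t = φ (A i).2.2 := by
    intro i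
    fin_cases i
    · exact P.d.Nu
    · exact P.d.Nm
    · exact P.X1
    · exact P.X2
    · exact P.Y1
    · exact P.Y2
    · exact Nc
    · exact Nc1
    · exact Nc'
    · exact Nc1'
  have hinj : Function.Injective φ := by
    have e1 := h.mne hu
    have e2 := h.mne cS
    have e3 := h.mne cS'
    have e4 := mne1 h cS P.cm
    have e5 := mne2 h cS hu P.cu
    have e6 := mne1 h cS' P.cm'
    have e7 := mne2 h cS' hu P.cu'
    have e8 := mne1 h cS' P.cc'
    have e9 := mne2 h cS cS' P.cc
    have f : ∀ {s t : V}, s ∈ S → t ∉ S → s ≠ t := fun h1 h2 h3 => h2 (h3 ▸ h1)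
    have hx1 := P.d.hx1
    have hx2 := P.d.hx2
    have hy1 := P.d.hy1
    have hy2 := P.d.hy2
    have hn : [u, m u, x1, x2, y1, y2, c, m c, c', m c'].Nodup := by
      simp only [List.nodup_cons, List.mem_cons, List.not_mem_nil, or_false, not_or, not_false_eq_true, List.nodup_nil, and_true]
      exact ⟨⟨e1.symm, f hu hx1, f hu hx2, f hu hy1, f hu hy2, P.cu.symm, e4.symm, P.cu'.symm, e6.symm⟩,
        ⟨f hu' hx1, f hu' hx2, f hu' hy1, f hu' hy2, P.cm.symm, e5.symm, P.cm'.symm, e7.symm⟩,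
        ⟨P.d.xx, P.n11.symm, P.n21.symm, (f cS hx1).symm, (f mcS hx1).symm, (f cS' hx1).symm, (f mcS' hx1).symm⟩,
        ⟨P.n12.symm, P.n22.symm, (f cS hx2).symm, (f mcS hx2).symm, (f cS' hx2).symm, (f mcS' hx2).symm⟩,
        ⟨P.d.yy, (f cS hy1).symm, (f mcS hy1).symm, (f cS' hy1).symm, (f mcS' hy1).symm⟩,
        ⟨(f cS hy2).symm, (f mcS hy2).symm, (f cS' hy2).symm, (f mcS' hy2).symm⟩,
        ⟨e2.symm, P.cc, e8.symm⟩, ⟨P.cc'.symm, e9⟩, e3.symm⟩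
    intro i j hij
    have hi : φ i = [u, m u, x1, x2, y1, y2, c, m c, c', m c'].get i := by fin_cases i <;> rfl
    have hj : φ j = [u, m u, x1, x2, y1, y2, c, m c, c', m c'].get j := by fin_cases j <;> rfl
    exact hn.injective_get (hi.symm.trans (hij.trans hj))
  have hsurj : Function.Surjective φ := by
    intro v
    obtain ⟨w⟩ := hconn.preconnected v (φ 0)
    have key : ∀ {a b : V}, G.Walk a b → (∃ i, φ i = b) → ∃ i, φ i = a := by
      intro a b w
      induction w with
      | nil => exact id
      | cons hadj _ ih =>
        intro hb
        obtain ⟨i, rfl⟩ := ih hb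
        rcases (hG i _).1 hadj.symm with f | f | f
        · exact ⟨_, f.symm⟩
        · exact ⟨_, f.symm⟩
        · exact ⟨_, f.symm⟩
    exact key w ⟨0, rfl⟩
  let F := Equiv.ofBijective φ ⟨hinj, hsurj⟩
  let K := Equiv.ofBijective ψ hψ
  have hFK : ∀ i j, petersenGraph.Adj (ψ i) (ψ j) ↔ G.Adj (φ i) (φ j) := by
    intro i j
    rw [hG i (φ j), hinj.eq_iff, hinj.eq_iff, hinj.eq_iff]
    exact hA i j
  refine ⟨⟨F.symm.trans K, ?_⟩⟩
  intro a b
  obtain ⟨i, rfl⟩ := F.surjective a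
  obtain ⟨j, rfl⟩ := F.surjective b
  simp only [Equiv.trans_apply, Equiv.symm_apply_apply]
  exact hFK i j

theorem final (hconn : G.Connected) (hcubic : ∀ v, G.degree v = 3) (hnp : ¬ Nonempty (G ≃g petersenGraph)) :
    (gammaPr G : ℝ) ≤ 4 * (Fintype.card V : ℝ) / 7 := by
  by_cases hex : ∃ T : Finset V, IsPDS G T
  · obtain ⟨T, hT⟩ := hex
    obtain ⟨S, m, h⟩ := exists_opt hcubic T hT
    have hb := bound h (by
      rintro ⟨u, y1, y2, x1, x2, c, c', P⟩
      exact hnp (P.iso h hconn))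
    have hle : gammaPr G ≤ S.card := Nat.sInf_le ⟨S, ⟨h.dom, m, h.mat⟩, rfl⟩
    have h7 : 7 * gammaPr G ≤ 4 * Fintype.card V := le_trans (by omega) hb
    have h8 : (7 : ℝ) * (gammaPr G : ℝ) ≤ 4 * (Fintype.card V : ℝ) := by exact_mod_cast h7
    linarith
  · have h0 : gammaPr G = 0 := by
      unfold gammaPr
      have : {k : ℕ | ∃ S : Finset V, IsPDS G S ∧ S.card = k} = ∅ := by
        ext k
        simp only [Set.mem_ofPred_eq, Set.mem_empty_iff_false, iff_false]
        rintro ⟨S, hS, _⟩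
        exact hex ⟨S, hS⟩
      rw [this, Nat.sInf_empty]
    rw [h0]
    simp only [Nat.cast_zero]
    positivity
end
end PDom

theorem paired_domination_cubic {V : Type*} [Fintype V] [DecidableEq V]
    (G : SimpleGraph V) [DecidableRel G.Adj]
    (hconn : G.Connected)
    (hcubic : ∀ v : V, G.degree v = 3)
    (hnotPetersen : ¬ Nonempty (G ≃g petersenGraph)) :
    (gammaPr G : ℝ) ≤ 4 * (Fintype.card V : ℝ) / 7 := by
  exact PDom.final hconn hcubic hnotPetersen
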